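/- Let Ω ⊆ ℝ^d be a bounded open set with smooth boundary, T > 0 and A > 0. Let f = (f₁,…,f_d) with each f_j ∈ C²(ℝ) and f_j′ bounded, satisfying the nondegeneracy condition on [−A,A], and let B ∈ C¹(ℝ) be bounded with B ≥ 0. Let (ε_n) be a sequence of positive reals with ε_n → 0, and suppose that for each n and each δ > 0 there is a classical solution u^{n,δ} of the regularized viscosity problem with flux f, viscosity coefficient B + δ, parameter ε_n and data u₀^{n,δ} ∈ C_c^∞(Ω) with ‖u₀^{n,δ}‖_{L^∞(Ω)} ≤ A, and that u^{n,δ} → u^n almost everywhere in Ω_T as δ → 0. Then the sequence (u^n) has a subsequence that converges in L¹(Ω_T) and almost everywhere in Ω_T. -/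

import Mathlib

open MeasureTheory Set

noncomputable section

/-- The spatial partial derivative of `v` in the `j`-th coordinate direction. -/
def pderiv' {d : ℕ} (v : (Fin d → ℝ) → ℝ) (j : Fin d) (x : Fin d → ℝ) : ℝ :=
  fderiv ℝ v x (Pi.single j 1)

/-- A classical solution of the regularized viscosity problem
`∂ₜ u + Σⱼ ∂ⱼ(fⱼ(u)) = ε Σⱼ ∂ⱼ((B(u)+δ) ∂ⱼ u)` on `Ω × (0,T)`, with homogeneous
Dirichlet boundary condition on `∂Ω × (0,T)` and initial data `u₀`. -/
structure IsClassicalSolution {d : ℕ} (Ω : Set (Fin d → ℝ)) (T ε δ : ℝ)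
    (f : Fin d → ℝ → ℝ) (B : ℝ → ℝ) (u₀ : (Fin d → ℝ) → ℝ)
    (u : (Fin d → ℝ) → ℝ → ℝ) : Prop where
  cont : ContinuousOn (fun p : (Fin d → ℝ) × ℝ => u p.1 p.2) (closure Ω ×ˢ Set.Icc 0 T)
  diff_t : ∀ x ∈ Ω, ∀ t ∈ Set.Ioo 0 T, DifferentiableAt ℝ (u x) t
  diff_x : ∀ x ∈ Ω, ∀ t ∈ Set.Ioo 0 T, DifferentiableAt ℝ (fun y => u y t) x
  diff_xx : ∀ j, ∀ x ∈ Ω, ∀ t ∈ Set.Ioo 0 T,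
      DifferentiableAt ℝ (fun y => pderiv' (fun z => u z t) j y) x
  cont_dt : ContinuousOn (fun p : (Fin d → ℝ) × ℝ => deriv (u p.1) p.2) (Ω ×ˢ Set.Ioo 0 T)
  cont_dx : ∀ j, ContinuousOn
      (fun p : (Fin d → ℝ) × ℝ => pderiv' (fun y => u y p.2) j p.1) (Ω ×ˢ Set.Ioo 0 T)
  cont_dxx : ∀ i j, ContinuousOn
      (fun p : (Fin d → ℝ) × ℝ => pderiv' (pderiv' (fun y => u y p.2) j) i p.1)
      (Ω ×ˢ Set.Ioo 0 T)
  pde : ∀ x ∈ Ω, ∀ t ∈ Set.Ioo 0 T,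
      deriv (u x) t + ∑ j, pderiv' (fun y => f j (u y t)) j x
        = ε * ∑ j, pderiv' (fun y => (B (u y t) + δ) * pderiv' (fun z => u z t) j y) j x
  bc : ∀ x ∈ frontier Ω, ∀ t ∈ Set.Ioo 0 T, u x t = 0
  ic : ∀ x ∈ Ω, u x 0 = u₀ x

section Plancherel

open FourierTransform Real

variable {E : Type*} [NormedAddCommGroup E] [InnerProductSpace ℝ E] [FiniteDimensional ℝ E]
  [MeasurableSpace E] [BorelSpace E]

/-- The Fourier integral of an integrable function is continuous. -/
theorem continuous_fourier_of_integrable {f : E → ℂ} (hf : Integrable f) :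
    Continuous (𝓕 f) :=
  VectorFourier.fourierIntegral_continuous Real.continuous_fourierChar
    (by exact continuous_inner) hf

theorem norm_fourier_le_integral_norm (f : E → ℂ) (k : E) : ‖𝓕 f k‖ ≤ ∫ x, ‖f x‖ :=
  VectorFourier.norm_fourierIntegral_le_integral_norm _ _ _ _ _

/-- On `L¹ ∩ L²` the `L²` Fourier transform is given by the Fourier integral. -/
theorem fourier_toLp_ae_eq {f : E → ℂ} (hf : Integrable f) (hf2 : MemLp f 2) :
    (𝓕 (hf2.toLp f) : Lp ℂ 2 (volume : Measure E)) =ᵐ[volume] 𝓕 f := by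
  apply ae_eq_of_integral_contDiff_smul_eq
  · exact (Lp.memLp _).locallyIntegrable (by norm_num)
  · exact (continuous_fourier_of_integrable hf).locallyIntegrable
  intro g g_smooth g_cpt
  have hg₁ : HasCompactSupport (Complex.ofRealCLM ∘ g) := g_cpt.comp_left rfl
  have hg₂ : ContDiff ℝ (⊤ : ℕ∞) (Complex.ofRealCLM ∘ g) := by fun_prop
  set G := hg₁.toSchwartzMap hg₂ with hG
  have hGa : ∀ x, G x = (g x : ℂ) := fun x => rfl
  have h1 : ∫ x, g x • (𝓕 (hf2.toLp f) : Lp ℂ 2 (volume : Measure E)) x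
      = ((𝓕 (hf2.toLp f) : Lp ℂ 2 (volume : Measure E)) : TemperedDistribution E ℂ) G := by
    rw [Lp.toTemperedDistribution_apply]
    rfl
  rw [h1, ← Lp.fourier_toTemperedDistribution_eq, TemperedDistribution.fourier_apply,
    Lp.toTemperedDistribution_apply]
  have h2 := VectorFourier.integral_fourierIntegral_smul_eq_flip (μ := (volume : Measure E))
    (ν := (volume : Measure E)) (L := innerₗ E) (e := Real.fourierChar)
    Real.continuous_fourierChar (by exact continuous_inner) hf G.integrable
  calc ∫ x, (𝓕 G) x • (hf2.toLp f) x = ∫ x, (𝓕 G) x • f x := by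
        apply integral_congr_ae
        filter_upwards [hf2.coeFn_toLp] with x hx
        rw [hx]
    _ = ∫ x, f x • (𝓕 (G : E → ℂ)) x := by
        congr 1; ext x
        rw [smul_eq_mul, smul_eq_mul, mul_comm, SchwartzMap.fourier_coe]
    _ = ∫ x, f x • VectorFourier.fourierIntegral Real.fourierChar volume (innerₗ E).flip G x := by
        rw [flip_innerₗ]; rfl
    _ = _ := h2.symm
    _ = _ := by
        congr 1; ext x
        rw [hGa, smul_eq_mul, mul_comm]; rfl

theorem memLp_fourier {f : E → ℂ} (hf : Integrable f) (hf2 : MemLp f 2) :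
    MemLp (𝓕 f) 2 :=
  (Lp.memLp _).ae_eq (fourier_toLp_ae_eq hf hf2)

/-- Plancherel's identity for functions in `L¹ ∩ L²`. -/
theorem integral_norm_sq_fourier {f : E → ℂ} (hf : Integrable f) (hf2 : MemLp f 2) :
    ∫ k, ‖𝓕 f k‖ ^ 2 = ∫ x, ‖f x‖ ^ 2 := by
  have key : ∀ h : Lp ℂ 2 (volume : Measure E), ‖h‖ ^ 2 = ∫ x, ‖h x‖ ^ 2 := fun h => by
    have h0 := L2.inner_def (𝕜 := ℂ) h h
    simp only [inner_self_eq_norm_sq_to_K] at h0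
    have h1 : ∫ x, ((‖h x‖ : ℂ)) ^ 2 = ((∫ x, ‖h x‖ ^ 2 : ℝ) : ℂ) := by
      rw [← integral_complex_ofReal]
      push_cast
      rfl
    have h2 : ((‖h‖ ^ 2 : ℝ) : ℂ) = ((∫ x, ‖h x‖ ^ 2 : ℝ) : ℂ) := by
      rw [← h1]
      push_cast
      exact h0
    exact_mod_cast h2
  have h1 := key (𝓕 (hf2.toLp f))
  have h2 := key (hf2.toLp f)
  rw [Lp.norm_fourier_eq] at h1
  rw [h2] at h1
  have e1 : ∫ x, ‖(𝓕 (hf2.toLp f) : Lp ℂ 2 (volume : Measure E)) x‖ ^ 2 = ∫ k, ‖𝓕 f k‖ ^ 2 := by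
    apply integral_congr_ae
    filter_upwards [fourier_toLp_ae_eq hf hf2] with x hx
    rw [hx]
  have e2 : ∫ x, ‖(hf2.toLp f) x‖ ^ 2 = ∫ k, ‖f k‖ ^ 2 := by
    apply integral_congr_ae
    filter_upwards [hf2.coeFn_toLp] with x hx
    rw [hx]
  rw [← e1, ← e2, h1]

end Plancherel

section GaussianKernel

open FourierTransform Real
open scoped RealInnerProductSpace

variable {E : Type*} [NormedAddCommGroup E] [InnerProductSpace ℝ E]

/-- The modulus of the gradient of the heat kernel, up to normalisation: it bounds the Fourier
transform of `k ↦ ⟪k, v⟫ exp (-s ‖k‖²)` for unit vectors `v`. -/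
def gaussGradKernel (s : ℝ) (z : E) : ℝ :=
  (π / s) ^ (Module.finrank ℝ E / 2 : ℝ) * (π / s) * (‖z‖ * exp (-(π ^ 2 / s) * ‖z‖ ^ 2))

theorem gaussGradKernel_nonneg {s : ℝ} (hs : 0 < s) (z : E) : 0 ≤ gaussGradKernel s z := by
  unfold gaussGradKernel; positivity

variable [FiniteDimensional ℝ E] [MeasurableSpace E] [BorelSpace E]

theorem integrable_exp_neg_mul_norm_sq {s : ℝ} (hs : 0 < s) :
    Integrable fun k : E => exp (-s * ‖k‖ ^ 2) := by
  have h := GaussianFourier.integrable_cexp_neg_mul_sq_norm_add (V := E) (b := s)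
    (by simpa using hs) 0 0
  have h2 := h.norm
  refine h2.congr (Filter.Eventually.of_forall fun k => ?_)
  simp only [zero_mul, add_zero, Complex.norm_exp]
  congr 1
  rw [show (-(s : ℂ) * (‖k‖ : ℂ) ^ 2) = ((-s * ‖k‖ ^ 2 : ℝ) : ℂ) by push_cast; ring]
  exact Complex.ofReal_re _

theorem integrable_norm_mul_exp_neg_mul_norm_sq {s : ℝ} (hs : 0 < s) :
    Integrable fun k : E => ‖k‖ * exp (-s * ‖k‖ ^ 2) := by
  have h := (integrable_exp_neg_mul_norm_sq (E := E) (half_pos hs)).const_mul (1 + 2 / s)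
  refine h.mono' (by fun_prop) (Filter.Eventually.of_forall fun k => ?_)
  rw [norm_mul, norm_norm, Real.norm_of_nonneg (exp_pos _).le,
    show -s * ‖k‖ ^ 2 = -(s / 2) * ‖k‖ ^ 2 + -(s / 2) * ‖k‖ ^ 2 by ring, exp_add, ← mul_assoc]
  refine mul_le_mul_of_nonneg_right ?_ (exp_pos _).le
  have h1 : s / 2 * ‖k‖ ^ 2 + 1 ≤ exp (s / 2 * ‖k‖ ^ 2) := add_one_le_exp _
  have h2 : exp (-(s / 2) * ‖k‖ ^ 2) * exp (s / 2 * ‖k‖ ^ 2) = 1 := by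
    rw [← exp_add]; simp
  have h3 : ‖k‖ ≤ (1 + 2 / s) * (s / 2 * ‖k‖ ^ 2 + 1) := by
    have : (1 + 2 / s) * (s / 2 * ‖k‖ ^ 2 + 1) = s / 2 * ‖k‖ ^ 2 + 1 + ‖k‖ ^ 2 + 2 / s := by
      field_simp; ring
    rw [this]
    have : 0 < 2 / s := by positivity
    have : 0 ≤ s / 2 * ‖k‖ ^ 2 := by positivity
    nlinarith [sq_nonneg (‖k‖ - 1)]
  calc ‖k‖ * exp (-(s / 2) * ‖k‖ ^ 2)
      ≤ ((1 + 2 / s) * exp (s / 2 * ‖k‖ ^ 2)) * exp (-(s / 2) * ‖k‖ ^ 2) := by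
        refine mul_le_mul_of_nonneg_right (h3.trans ?_) (exp_pos _).le
        exact mul_le_mul_of_nonneg_left h1 (by positivity)
    _ = 1 + 2 / s := by rw [mul_assoc, mul_comm (exp (s / 2 * _)), h2, mul_one]

theorem integrable_gaussGradKernel {s : ℝ} (hs : 0 < s) :
    Integrable (gaussGradKernel s : E → ℝ) :=
  (integrable_norm_mul_exp_neg_mul_norm_sq (by positivity)).const_mul _

theorem integral_gaussGradKernel {s : ℝ} (hs : 0 < s) :
    ∫ z : E, gaussGradKernel s z = (√s)⁻¹ * ∫ z : E, gaussGradKernel 1 z := by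
  have hr : 0 < (√s)⁻¹ := by positivity
  have h := Measure.integral_comp_smul (volume : Measure E) (gaussGradKernel 1) (√s)⁻¹
  have hsq : √s ^ 2 = s := sq_sqrt hs.le
  have key : ∀ z : E, gaussGradKernel s z
      = (√s)⁻¹ ^ (Module.finrank ℝ E) * (√s)⁻¹ * gaussGradKernel 1 ((√s)⁻¹ • z) := by
    intro z
    unfold gaussGradKernel
    rw [norm_smul, Real.norm_of_nonneg hr.le, div_rpow pi_pos.le hs.le, div_one, mul_pow, inv_pow,
      inv_pow, hsq]
    have : s ^ (Module.finrank ℝ E / 2 : ℝ) = √s ^ (Module.finrank ℝ E) := by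
      rw [sqrt_eq_rpow, ← rpow_natCast, ← rpow_mul hs.le]
      congr 1; ring
    rw [this, div_one, show -(π ^ 2 / s) * ‖z‖ ^ 2 = -π ^ 2 * (s⁻¹ * ‖z‖ ^ 2) by
      field_simp]
    have : s⁻¹ = (√s)⁻¹ * (√s)⁻¹ := by rw [← mul_inv, mul_self_sqrt hs.le]
    rw [div_eq_mul_inv, div_eq_mul_inv π s]
    nth_rewrite 1 [this]
    ring
  simp_rw [key]
  rw [integral_const_mul, h, abs_of_nonneg (by positivity), smul_eq_mul, inv_pow, inv_inv]
  have : (√s) ^ (Module.finrank ℝ E) ≠ 0 := by positivity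
  field_simp

theorem norm_fourier_inner_mul_exp_le {s : ℝ} (hs : 0 < s) (v z : E) :
    ‖𝓕 (fun k : E => ((⟪k, v⟫ * exp (-s * ‖k‖ ^ 2) : ℝ) : ℂ)) z‖
      ≤ ‖v‖ * gaussGradKernel s z := by
  set g : E → ℂ := fun k => ((exp (-s * ‖k‖ ^ 2) : ℝ) : ℂ) with hg
  have hgi : Integrable g := (integrable_exp_neg_mul_norm_sq hs).ofReal
  have hgi2 : Integrable (fun k => ‖k‖ * ‖g k‖) := by
    refine (integrable_norm_mul_exp_neg_mul_norm_sq (E := E) hs).congr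
      (Filter.Eventually.of_forall fun k => ?_)
    simp only [hg, Complex.norm_real, Real.norm_of_nonneg (exp_pos _).le]
  have hF : 𝓕 g = fun w : E => (((π / s) ^ (Module.finrank ℝ E / 2 : ℝ)
      * exp (-(π ^ 2 / s) * ‖w‖ ^ 2) : ℝ) : ℂ) := by
    ext w
    have := fourier_gaussian_innerProductSpace (V := E) (b := s) (by simpa using hs) w
    rw [show g = fun v : E => Complex.exp (-(s : ℂ) * ‖v‖ ^ 2) by ext k; simp [hg], this]
    push_cast
    rw [Complex.ofReal_cpow (by positivity)]
    push_cast
    congr 2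
    ring
  have h1 := hasFDerivAt_fourier hgi hgi2 z
  have h2 : HasFDerivAt (fun w : E => (π / s) ^ (Module.finrank ℝ E / 2 : ℝ)
      * exp (-(π ^ 2 / s) * ‖w‖ ^ 2))
      ((π / s) ^ (Module.finrank ℝ E / 2 : ℝ) • (exp (-(π ^ 2 / s) * ‖z‖ ^ 2) •
        (-(π ^ 2 / s)) • ((2 : ℝ) • innerSL ℝ z))) z := by
    have := ((hasStrictFDerivAt_norm_sq z).hasFDerivAt.const_mul (-(π ^ 2 / s))).exp.const_mul
      ((π / s) ^ (Module.finrank ℝ E / 2 : ℝ))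
    exact this.congr_fderiv (by ext y; simp)
  have h3 := Complex.ofRealCLM.hasFDerivAt.comp z h2
  rw [hF] at h1
  have h4 := congrArg (fun L : E →L[ℝ] ℂ => ‖L v‖) (h1.unique h3)
  rw [Real.fourier_continuousLinearMap_apply
    (by
      refine (hgi2.const_mul (2 * π * ‖(innerSL ℝ : E →L[ℝ] E →L[ℝ] ℝ)‖)).mono'
        hgi.aestronglyMeasurable.fourierSMulRight
        (Filter.Eventually.of_forall fun k => ?_)
      refine (VectorFourier.norm_fourierSMulRight_le _ _ _).trans (le_of_eq ?_)
      ring)] at h4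
  have e1 : (fun k : E => VectorFourier.fourierSMulRight (innerSL ℝ) g k v)
      = (-(2 * π * Complex.I)) • fun k : E => ((⟪k, v⟫ * exp (-s * ‖k‖ ^ 2) : ℝ) : ℂ) := by
    ext k
    simp [VectorFourier.fourierSMulRight_apply, hg]
    rfl
  have e2 : 𝓕 ((-(2 * π * Complex.I)) • fun k : E => ((⟪k, v⟫ * exp (-s * ‖k‖ ^ 2) : ℝ) : ℂ)) z
      = (-(2 * π * Complex.I)) • 𝓕 (fun k : E => ((⟪k, v⟫ * exp (-s * ‖k‖ ^ 2) : ℝ) : ℂ)) z := by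
    exact congrFun (VectorFourier.fourierIntegral_const_smul _ _ _ _ _) z
  rw [e1, e2, norm_smul] at h4
  have h5 : ‖-(2 * π * Complex.I)‖ = 2 * π := by
    simp [abs_of_pos pi_pos]
  rw [h5] at h4
  simp only [ContinuousLinearMap.comp_apply, Complex.ofRealCLM_apply, Complex.norm_real,
    smul_apply, innerSL_apply_apply, smul_eq_mul, norm_mul, norm_neg, norm_div,
    norm_pow, Real.norm_of_nonneg (exp_pos _).le, Real.norm_of_nonneg pi_pos.le,
    Real.norm_of_nonneg hs.le, Real.norm_of_nonneg
      (show 0 ≤ (π / s) ^ (Module.finrank ℝ E / 2 : ℝ) by positivity)] at h4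
  have h6 : ‖⟪z, v⟫‖ ≤ ‖z‖ * ‖v‖ := norm_inner_le_norm z v
  have h7 : (2 * π) * ‖𝓕 (fun k : E => ((⟪k, v⟫ * exp (-s * ‖k‖ ^ 2) : ℝ) : ℂ)) z‖
      ≤ (2 * π) * (‖v‖ * gaussGradKernel s z) := by
    rw [h4]
    unfold gaussGradKernel
    calc _ ≤ (π / s) ^ (Module.finrank ℝ E / 2 : ℝ) * (exp (-(π ^ 2 / s) * ‖z‖ ^ 2) *
          (π ^ 2 / s * (‖(2 : ℝ)‖ * (‖z‖ * ‖v‖)))) := by gcongr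
      _ = _ := by
        rw [Real.norm_of_nonneg (by norm_num : (0 : ℝ) ≤ 2)]
        field_simp
  exact le_of_mul_le_mul_left h7 (by positivity)

end GaussianKernel

section CrossTerm

open FourierTransform Real
open scoped RealInnerProductSpace ComplexConjugate

variable {E : Type*} [NormedAddCommGroup E] [InnerProductSpace ℝ E] [FiniteDimensional ℝ E]
  [MeasurableSpace E] [BorelSpace E]

/-- The symbol of the divergence of the vector field `Φ`, up to the factor `2πi`: the pairing of
`k` with the Fourier transform of `Φ` at `k`. -/
def fourierPairing (Φ : E → E) (k : E) : ℂ := 𝓕 (fun x => ((⟪k, Φ x⟫ : ℝ) : ℂ)) k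

theorem norm_fourierPairing_le {Φ : E → E} (hΦ : Integrable Φ) (k : E) :
    ‖fourierPairing Φ k‖ ≤ ‖k‖ * ∫ x, ‖Φ x‖ := by
  refine (norm_fourier_le_integral_norm _ _).trans ?_
  rw [← integral_const_mul]
  refine integral_mono_of_nonneg (Filter.Eventually.of_forall fun x => norm_nonneg _)
    (hΦ.norm.const_mul _) (Filter.Eventually.of_forall fun x => ?_)
  simp only [Complex.norm_real]
  exact norm_inner_le_norm k (Φ x)

theorem fourierPairing_eq_sum {Φ : E → E} (hΦ : Integrable Φ) (k : E) :
    fourierPairing Φ k = ∑ i, ((⟪k, stdOrthonormalBasis ℝ E i⟫ : ℝ) : ℂ)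
      * 𝓕 (fun x => ((⟪stdOrthonormalBasis ℝ E i, Φ x⟫ : ℝ) : ℂ)) k := by
  unfold fourierPairing
  simp_rw [Real.fourier_eq, ← integral_const_mul]
  rw [← integral_finsetSum]
  · congr 1; ext x
    rw [← OrthonormalBasis.sum_inner_mul_inner (stdOrthonormalBasis ℝ E) k (Φ x)]
    push_cast
    rw [Finset.smul_sum]
    refine Finset.sum_congr rfl fun i _ => ?_
    simp only [Circle.smul_def, smul_eq_mul]
    ring
  · intro i _
    refine Integrable.const_mul ?_ _
    exact (Real.fourierIntegral_convergent_iff k).2 ((hΦ.const_inner _).ofReal)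

theorem continuous_fourierPairing {Φ : E → E} (hΦ : Integrable Φ) :
    Continuous (fourierPairing Φ) := by
  rw [show fourierPairing Φ = _ from funext (fourierPairing_eq_sum hΦ)]
  refine continuous_finsetSum _ fun i _ => Continuous.mul (by fun_prop) ?_
  exact continuous_fourier_of_integrable (hΦ.const_inner _).ofReal

theorem conj_fourierPairing (Φ : E → E) (k : E) :
    conj (fourierPairing Φ k) = ∫ x, 𝐞 (⟪x, k⟫) • ((⟪k, Φ x⟫ : ℝ) : ℂ) := by
  unfold fourierPairing
  rw [Real.fourier_eq, ← integral_conj]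
  congr 1; ext x
  simp only [Circle.smul_def, smul_eq_mul, map_mul, Complex.conj_ofReal]
  rw [AddChar.map_neg_eq_inv, Circle.coe_inv_eq_conj, Complex.conj_conj]

theorem norm_fourier_gauss_mul_conj_fourierPairing_le {s C : ℝ} (hs : 0 < s) {Φ : E → E}
    (hΦ : Integrable Φ) (hC : ∀ x, ‖Φ x‖ ≤ C) (y : E) :
    ‖𝓕 (fun k => ((exp (-s * ‖k‖ ^ 2) : ℝ) : ℂ) * conj (fourierPairing Φ k)) y‖
      ≤ C * ∫ z : E, gaussGradKernel s z := by
  have e1 : 𝓕 (fun k => ((exp (-s * ‖k‖ ^ 2) : ℝ) : ℂ) * conj (fourierPairing Φ k)) y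
      = ∫ k, ∫ x, 𝐞 (-⟪k, y - x⟫) • ((⟪k, Φ x⟫ * exp (-s * ‖k‖ ^ 2) : ℝ) : ℂ) := by
    rw [Real.fourier_eq]
    congr 1; ext k
    rw [conj_fourierPairing, Circle.smul_def, smul_eq_mul, ← mul_assoc, ← integral_const_mul]
    congr 1; ext x
    simp only [Circle.smul_def, smul_eq_mul]
    rw [inner_sub_right, neg_sub, sub_eq_add_neg, AddChar.map_add_eq_mul, Circle.coe_mul,
      real_inner_comm k x]
    push_cast
    ring
  have hint : Integrable (Function.uncurry fun (k x : E) =>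
      𝐞 (-⟪k, y - x⟫) • ((⟪k, Φ x⟫ * exp (-s * ‖k‖ ^ 2) : ℝ) : ℂ))
      ((volume : Measure E).prod volume) := by
    have hdom := (integrable_norm_mul_exp_neg_mul_norm_sq (E := E) hs).mul_prod hΦ.norm
    refine hdom.mono' ?_ (Filter.Eventually.of_forall fun p => ?_)
    · refine AEStronglyMeasurable.smul ?_ ?_
      · have hc : Continuous fun p : E × E => -⟪p.1, y - p.2⟫ := by fun_prop
        exact (continuous_subtype_val.comp
          (Real.continuous_fourierChar.comp hc)).aestronglyMeasurable
      · refine Complex.continuous_ofReal.comp_aestronglyMeasurable ?_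
        refine AEStronglyMeasurable.mul ?_ (by fun_prop)
        exact AEStronglyMeasurable.inner continuous_fst.aestronglyMeasurable
          hΦ.aestronglyMeasurable.comp_snd
    · obtain ⟨k, x⟩ := p
      simp only [Function.uncurry_apply_pair, Circle.norm_smul, Complex.norm_real, norm_mul,
        Real.norm_of_nonneg (exp_pos _).le]
      calc _ ≤ (‖k‖ * ‖Φ x‖) * exp (-s * ‖k‖ ^ 2) :=
            mul_le_mul_of_nonneg_right (norm_inner_le_norm k (Φ x)) (exp_pos _).le
        _ = _ := by ring
  rw [e1, integral_integral_swap hint]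
  have hK : ∫ x, C * gaussGradKernel s (y - x) = C * ∫ z : E, gaussGradKernel s z := by
    rw [integral_const_mul, integral_sub_left_eq_self (gaussGradKernel s) volume y]
  rw [← hK]
  refine norm_integral_le_of_norm_le
    (((integrable_gaussGradKernel hs).comp_sub_left y).const_mul C)
    (Filter.Eventually.of_forall fun x => ?_)
  have := norm_fourier_inner_mul_exp_le hs (Φ x) (y - x)
  rw [Real.fourier_eq] at this
  exact this.trans (mul_le_mul_of_nonneg_right (hC x) (gaussGradKernel_nonneg hs _))

theorem integrable_gauss_mul_conj_fourierPairing {s : ℝ} (hs : 0 < s) {Φ : E → E}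
    (hΦ : Integrable Φ) :
    Integrable fun k => ((exp (-s * ‖k‖ ^ 2) : ℝ) : ℂ) * conj (fourierPairing Φ k) := by
  refine ((integrable_norm_mul_exp_neg_mul_norm_sq (E := E) hs).mul_const (∫ x, ‖Φ x‖)).mono'
    ?_ (Filter.Eventually.of_forall fun k => ?_)
  · have := continuous_fourierPairing hΦ
    exact (Continuous.mul (by fun_prop) (Complex.continuous_conj.comp this)).aestronglyMeasurable
  · rw [norm_mul, RCLike.norm_conj, Complex.norm_real, Real.norm_of_nonneg (exp_pos _).le]
    calc _ ≤ exp (-s * ‖k‖ ^ 2) * (‖k‖ * ∫ x, ‖Φ x‖) :=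
          mul_le_mul_of_nonneg_left (norm_fourierPairing_le hΦ k) (exp_pos _).le
      _ = _ := by ring

/-- The pairing of a bounded function of `x` in `L¹` with the heat flow of the divergence of a
bounded vector field. -/
theorem norm_integral_gauss_mul_conj_fourierPairing_mul_fourier_le {s C : ℝ} (hs : 0 < s)
    {Φ : E → E} (hΦ : Integrable Φ) (hC : ∀ x, ‖Φ x‖ ≤ C) {M : E → ℂ} (hM : Integrable M) :
    ‖∫ k, ((exp (-s * ‖k‖ ^ 2) : ℝ) : ℂ) * conj (fourierPairing Φ k) * 𝓕 M k‖
      ≤ C * ((√s)⁻¹ * ∫ z : E, gaussGradKernel 1 z) * ∫ y, ‖M y‖ := by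
  have h2 := VectorFourier.integral_fourierIntegral_smul_eq_flip (μ := (volume : Measure E))
    (ν := (volume : Measure E)) (L := innerₗ E) (e := Real.fourierChar)
    Real.continuous_fourierChar (by exact continuous_inner) hM
    (integrable_gauss_mul_conj_fourierPairing hs hΦ)
  rw [flip_innerₗ] at h2
  have e1 : ∫ k, ((exp (-s * ‖k‖ ^ 2) : ℝ) : ℂ) * conj (fourierPairing Φ k) * 𝓕 M k
      = ∫ y, M y • 𝓕 (fun k => ((exp (-s * ‖k‖ ^ 2) : ℝ) : ℂ) * conj (fourierPairing Φ k)) y := by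
    refine Eq.trans ?_ h2
    congr 1; ext k
    rw [smul_eq_mul, mul_comm]; rfl
  rw [e1, ← integral_gaussGradKernel hs, ← integral_const_mul]
  refine norm_integral_le_of_norm_le (hM.norm.const_mul _)
    (Filter.Eventually.of_forall fun y => ?_)
  rw [norm_smul, mul_comm]
  exact mul_le_mul_of_nonneg_right
    (norm_fourier_gauss_mul_conj_fourierPairing_le hs hΦ hC y) (norm_nonneg _)

end CrossTerm

section HeatWeight

open FourierTransform Real
open scoped RealInnerProductSpace ComplexConjugate

variable {E : Type*} [NormedAddCommGroup E]

/-- The multiplier `∫_σ^r exp (-s ‖k‖²) ds`, a high-frequency truncation of `‖k‖⁻²`. -/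
def heatWeight (σ r : ℝ) (k : E) : ℝ := ∫ s in σ..r, exp (-s * ‖k‖ ^ 2)

theorem heatWeight_mul_norm_sq (σ r : ℝ) (k : E) :
    heatWeight σ r k * ‖k‖ ^ 2 = exp (-σ * ‖k‖ ^ 2) - exp (-r * ‖k‖ ^ 2) := by
  unfold heatWeight
  rw [← intervalIntegral.integral_mul_const]
  have h := intervalIntegral.integral_eq_sub_of_hasDerivAt (a := σ) (b := r)
    (f := fun s => -exp (-s * ‖k‖ ^ 2)) (f' := fun s => exp (-s * ‖k‖ ^ 2) * ‖k‖ ^ 2)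
    (fun s _ => by
      have := (((hasDerivAt_id s).neg.mul_const (‖k‖ ^ 2)).exp).neg
      convert! this using 1
      simp)
    ((by fun_prop : Continuous fun s => exp (-s * ‖k‖ ^ 2) * ‖k‖ ^ 2).intervalIntegrable _ _)
  rw [h]; ring

theorem heatWeight_nonneg {σ r : ℝ} (h : σ ≤ r) (k : E) : 0 ≤ heatWeight σ r k :=
  intervalIntegral.integral_nonneg h fun _ _ => (exp_pos _).le

theorem heatWeight_le {σ r : ℝ} (h0 : 0 < σ) (h : σ ≤ r) (k : E) :
    heatWeight σ r k ≤ r * exp (-σ * ‖k‖ ^ 2) := by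
  have h1 : heatWeight σ r k ≤ ∫ s in σ..r, exp (-σ * ‖k‖ ^ 2) := by
    refine intervalIntegral.integral_mono_on h
      ((by fun_prop : Continuous fun s => exp (-s * ‖k‖ ^ 2)).intervalIntegrable _ _)
      (by simp) fun s hs => ?_
    exact exp_le_exp.2 (by nlinarith [hs.1, sq_nonneg ‖k‖])
  rw [intervalIntegral.integral_const, smul_eq_mul] at h1
  exact h1.trans (mul_le_mul_of_nonneg_right (by linarith) (exp_pos _).le)

theorem heatWeight_mul_norm_sq_le {σ r : ℝ} (h0 : 0 ≤ σ) (k : E) :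
    heatWeight σ r k * ‖k‖ ^ 2 ≤ 1 := by
  rw [heatWeight_mul_norm_sq]
  have h1 : exp (-σ * ‖k‖ ^ 2) ≤ 1 := exp_le_one_iff.2 (by nlinarith [sq_nonneg ‖k‖])
  have h2 := exp_pos (-r * ‖k‖ ^ 2)
  linarith

theorem heatWeight_mul_norm_sq_le_exp (σ r : ℝ) (k : E) :
    heatWeight σ r k * ‖k‖ ^ 2 ≤ exp (-σ * ‖k‖ ^ 2) := by
  rw [heatWeight_mul_norm_sq]
  have h2 := exp_pos (-r * ‖k‖ ^ 2)
  linarith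

theorem continuous_heatWeight (σ r : ℝ) : Continuous (heatWeight σ r : E → ℝ) :=
  intervalIntegral.continuous_parametric_intervalIntegral_of_continuous' (by fun_prop) σ r

variable [InnerProductSpace ℝ E] [FiniteDimensional ℝ E] [MeasurableSpace E] [BorelSpace E]

theorem integrable_heatWeight_mul_norm_fourierPairing_sq {σ r : ℝ} (h0 : 0 < σ) (h : σ ≤ r)
    {Φ : E → E} (hΦ : Integrable Φ) :
    Integrable fun k => heatWeight σ r k * ‖fourierPairing Φ k‖ ^ 2 := by
  refine ((integrable_exp_neg_mul_norm_sq (E := E) h0).mul_const ((∫ x, ‖Φ x‖) ^ 2)).mono'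
    ((continuous_heatWeight σ r).mul
      ((continuous_fourierPairing hΦ).norm.pow 2)).aestronglyMeasurable
    (Filter.Eventually.of_forall fun k => ?_)
  have hw := heatWeight_nonneg h k
  rw [Real.norm_of_nonneg (by positivity)]
  calc _ ≤ heatWeight σ r k * (‖k‖ * ∫ x, ‖Φ x‖) ^ 2 := by
        gcongr; exact norm_fourierPairing_le hΦ k
    _ = (heatWeight σ r k * ‖k‖ ^ 2) * (∫ x, ‖Φ x‖) ^ 2 := by ring
    _ ≤ _ := by gcongr; exact heatWeight_mul_norm_sq_le_exp σ r k

theorem integral_heatWeight_mul_norm_fourierPairing_sq_le_of_memLp {σ r : ℝ} (h0 : 0 < σ)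
    (h : σ ≤ r) {G : E → E} (hG : Integrable G) (hG2 : MemLp G 2) :
    ∫ k, heatWeight σ r k * ‖fourierPairing G k‖ ^ 2 ≤ ∫ x, ‖G x‖ ^ 2 := by
  set b := stdOrthonormalBasis ℝ E
  set g : _ → E → ℂ := fun i x => ((⟪b i, G x⟫ : ℝ) : ℂ) with hg
  have hgi : ∀ i, Integrable (g i) := fun i => (hG.const_inner _).ofReal
  have hg2 : ∀ i, MemLp (g i) 2 := fun i => (hG2.const_inner (b i)).ofReal
  have hs : ∀ x, ∑ i, ‖g i x‖ ^ 2 = ‖G x‖ ^ 2 := fun x => by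
    simp only [hg, Complex.norm_real, Real.norm_eq_abs, sq_abs]
    exact b.sum_sq_inner_right (G x)
  have hI : ∀ i, Integrable fun k => ‖𝓕 (g i) k‖ ^ 2 := fun i =>
    (memLp_fourier (hgi i) (hg2 i)).integrable_norm_pow (by norm_num)
  calc ∫ k, heatWeight σ r k * ‖fourierPairing G k‖ ^ 2
      ≤ ∫ k, ∑ i, ‖𝓕 (g i) k‖ ^ 2 := by
        refine integral_mono_of_nonneg (Filter.Eventually.of_forall fun k => ?_)
          (integrable_finsetSum _ fun i _ => hI i) (Filter.Eventually.of_forall fun k => ?_)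
        · exact mul_nonneg (heatWeight_nonneg h k) (sq_nonneg _)
        · have hn : ‖fourierPairing G k‖ ≤ ∑ i, |⟪k, b i⟫| * ‖𝓕 (g i) k‖ := by
            rw [fourierPairing_eq_sum hG]
            refine (norm_sum_le _ _).trans_eq (Finset.sum_congr rfl fun i _ => ?_)
            rw [norm_mul, Complex.norm_real, Real.norm_eq_abs]
          have h1 : ‖fourierPairing G k‖ ^ 2 ≤ ‖k‖ ^ 2 * ∑ i, ‖𝓕 (g i) k‖ ^ 2 := by
            have h2 := Finset.sum_mul_sq_le_sq_mul_sq Finset.univ (fun i => |⟪k, b i⟫|)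
              (fun i => ‖𝓕 (g i) k‖)
            simp only [sq_abs] at h2
            rw [b.sum_sq_inner_left k] at h2
            exact (pow_le_pow_left₀ (norm_nonneg _) hn 2).trans h2
          have h3 : 0 ≤ ∑ i, ‖𝓕 (g i) k‖ ^ 2 := Finset.sum_nonneg fun i _ => sq_nonneg _
          calc _ ≤ heatWeight σ r k * (‖k‖ ^ 2 * ∑ i, ‖𝓕 (g i) k‖ ^ 2) :=
                mul_le_mul_of_nonneg_left h1 (heatWeight_nonneg h k)
            _ = (heatWeight σ r k * ‖k‖ ^ 2) * ∑ i, ‖𝓕 (g i) k‖ ^ 2 := by ring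
            _ ≤ _ := mul_le_of_le_one_left h3 (heatWeight_mul_norm_sq_le h0.le k)
    _ = ∑ i, ∫ x, ‖g i x‖ ^ 2 := by
        rw [integral_finsetSum _ fun i _ => hI i]
        exact Finset.sum_congr rfl fun i _ => integral_norm_sq_fourier (hgi i) (hg2 i)
    _ = ∫ x, ‖G x‖ ^ 2 := by
        rw [← integral_finsetSum _ fun i _ => (hg2 i).integrable_norm_pow (by norm_num)]
        simp_rw [hs]

end HeatWeight

section DivergenceEstimate

open FourierTransform Real
open scoped RealInnerProductSpace ComplexConjugate

variable {E : Type*} [NormedAddCommGroup E] [InnerProductSpace ℝ E] [FiniteDimensional ℝ E]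
  [MeasurableSpace E] [BorelSpace E]

theorem norm_integral_heatWeight_mul_conj_fourierPairing_mul_fourier_le {σ r C : ℝ} (h0 : 0 < σ)
    (h : σ ≤ r) {Φ : E → E} (hΦ : Integrable Φ) (hC : ∀ x, ‖Φ x‖ ≤ C) {M : E → ℂ}
    (hM : Integrable M) :
    ‖∫ k, (heatWeight σ r k : ℂ) * conj (fourierPairing Φ k) * 𝓕 M k‖
      ≤ 2 * √r * (C * (∫ z : E, gaussGradKernel 1 z) * ∫ y, ‖M y‖) := by
  have hP := Complex.continuous_conj.comp (continuous_fourierPairing hΦ)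
  have hF := continuous_fourier_of_integrable hM
  set F : E → ℝ → ℂ := fun k s =>
    ((exp (-s * ‖k‖ ^ 2) : ℝ) : ℂ) * conj (fourierPairing Φ k) * 𝓕 M k with hFdef
  have hcont : Continuous (Function.uncurry F) := by
    refine Continuous.mul (Continuous.mul (by fun_prop) (hP.comp continuous_fst))
      (hF.comp continuous_fst)
  have e1 : ∀ k, (heatWeight σ r k : ℂ) * conj (fourierPairing Φ k) * 𝓕 M k
      = ∫ s in Ioc σ r, F k s := fun k => by
    simp only [hFdef]
    rw [integral_mul_const, integral_mul_const, integral_complex_ofReal, heatWeight,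
      intervalIntegral.integral_of_le h]
  have hint : Integrable (Function.uncurry F)
      ((volume : Measure E).prod (volume.restrict (Ioc σ r))) := by
    have hd := ((integrable_norm_mul_exp_neg_mul_norm_sq (E := E) h0).mul_const
      ((∫ x, ‖Φ x‖) * ∫ y, ‖M y‖)).mul_prod
      (integrable_const (1 : ℝ) : Integrable _ (volume.restrict (Ioc σ r)))
    refine hd.mono' hcont.aestronglyMeasurable ?_
    have hae : ∀ᵐ p ∂(volume : Measure E).prod (volume.restrict (Ioc σ r)), p.2 ∈ Ioc σ r :=
      Measure.quasiMeasurePreserving_snd.ae (ae_restrict_mem measurableSet_Ioc)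
    filter_upwards [hae] with p hp
    obtain ⟨k, s⟩ := p
    simp only [Function.uncurry_apply_pair, hFdef, norm_mul, RCLike.norm_conj, Complex.norm_real,
      mul_one]
    rw [Real.norm_of_nonneg (exp_pos _).le]
    have h1 : exp (-s * ‖k‖ ^ 2) ≤ exp (-σ * ‖k‖ ^ 2) :=
      exp_le_exp.2 (by nlinarith [hp.1, sq_nonneg ‖k‖])
    calc exp (-s * ‖k‖ ^ 2) * ‖fourierPairing Φ k‖ * ‖𝓕 M k‖
        ≤ exp (-σ * ‖k‖ ^ 2) * (‖k‖ * ∫ x, ‖Φ x‖) * ∫ y, ‖M y‖ := by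
          gcongr
          · exact norm_fourierPairing_le hΦ k
          · exact norm_fourier_le_integral_norm M k
      _ = _ := by ring
  simp_rw [e1]
  rw [integral_integral_swap hint, ← intervalIntegral.integral_of_le h]
  set K := C * (∫ z : E, gaussGradKernel 1 z) * ∫ y, ‖M y‖ with hK
  have hK0 : 0 ≤ K := by
    have : 0 ≤ C := (norm_nonneg _).trans (hC 0)
    have h1 : 0 ≤ ∫ z : E, gaussGradKernel 1 z :=
      integral_nonneg fun z => gaussGradKernel_nonneg one_pos z
    have h2 : 0 ≤ ∫ y, ‖M y‖ := integral_nonneg fun y => norm_nonneg _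
    positivity
  have hsq : ContinuousOn (fun s : ℝ => (√s)⁻¹) (uIcc σ r) := by
    refine ContinuousOn.inv₀ (by fun_prop) fun s hs => ?_
    rw [uIcc_of_le h] at hs
    exact (Real.sqrt_pos.2 (h0.trans_le hs.1)).ne'
  calc _ ≤ ∫ s in σ..r, (√s)⁻¹ * K := by
        refine intervalIntegral.norm_integral_le_of_norm_le h
          (Filter.Eventually.of_forall fun s hs => ?_) (hsq.mul_const K).intervalIntegrable
        refine (norm_integral_gauss_mul_conj_fourierPairing_mul_fourier_le
          (h0.trans hs.1) hΦ hC hM).trans_eq ?_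
        rw [hK]; ring
    _ = (2 * √r - 2 * √σ) * K := by
        rw [intervalIntegral.integral_mul_const]
        congr 1
        refine intervalIntegral.integral_eq_sub_of_hasDerivAt (f := fun s => 2 * √s)
          (fun s hs => ?_) hsq.intervalIntegrable
        rw [uIcc_of_le h] at hs
        have := (Real.hasDerivAt_sqrt (h0.trans_le hs.1).ne').const_mul 2
        convert! this using 1
        field_simp
    _ ≤ 2 * √r * K := by
        refine mul_le_mul_of_nonneg_right ?_ hK0
        have := Real.sqrt_nonneg σ
        linarith

/-- If the divergence of a bounded field `Φ` is the divergence of an `L²` field `G` plus an `L¹`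
function `M`, then the `H⁻¹` norm of the divergence of `Φ` at frequencies `≳ r^{-1/2}` is controlled
by the `L²` norm of `G`, up to an error of order `√r`. -/
theorem integral_heatWeight_mul_norm_fourierPairing_sq_le {σ r C : ℝ} (h0 : 0 < σ)
    (h : σ ≤ r) {Φ G : E → E} (hΦ : Integrable Φ) (hC : ∀ x, ‖Φ x‖ ≤ C) (hG : Integrable G)
    (hG2 : MemLp G 2) {M : E → ℂ} (hM : Integrable M)
    (heq : ∀ k, fourierPairing Φ k = fourierPairing G k + 𝓕 M k) :
    ∫ k, heatWeight σ r k * ‖fourierPairing Φ k‖ ^ 2 ≤ (∫ x, ‖G x‖ ^ 2)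
      + 4 * √r * (C * (∫ z : E, gaussGradKernel 1 z) * ∫ y, ‖M y‖) := by
  have hcross := norm_integral_heatWeight_mul_conj_fourierPairing_mul_fourier_le h0 h hΦ hC hM
  set W : E → ℂ := fun k => (heatWeight σ r k : ℂ) * conj (fourierPairing Φ k) * 𝓕 M k with hW
  have hWi : Integrable W := by
    refine ((integrable_norm_mul_exp_neg_mul_norm_sq (E := E) h0).mul_const
      (r * (∫ x, ‖Φ x‖) * ∫ y, ‖M y‖)).mono' ?_ (Filter.Eventually.of_forall fun k => ?_)
    · have hP := Complex.continuous_conj.comp (continuous_fourierPairing hΦ)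
      have hF := continuous_fourier_of_integrable hM
      exact (((Complex.continuous_ofReal.comp (continuous_heatWeight σ r)).mul hP).mul
        hF).aestronglyMeasurable
    · have hw := heatWeight_nonneg h k
      simp only [hW, norm_mul, RCLike.norm_conj, Complex.norm_real]
      rw [Real.norm_of_nonneg hw]
      have hr : 0 ≤ r := h0.le.trans h
      calc heatWeight σ r k * ‖fourierPairing Φ k‖ * ‖𝓕 M k‖
          ≤ (r * exp (-σ * ‖k‖ ^ 2)) * (‖k‖ * ∫ x, ‖Φ x‖) * ∫ y, ‖M y‖ := by
            gcongr
            · exact heatWeight_le h0 h k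
            · exact norm_fourierPairing_le hΦ k
            · exact norm_fourier_le_integral_norm M k
        _ = _ := by ring
  have hWre : Integrable fun k => (W k).re := hWi.re
  calc ∫ k, heatWeight σ r k * ‖fourierPairing Φ k‖ ^ 2
      ≤ ∫ k, (heatWeight σ r k * ‖fourierPairing G k‖ ^ 2 + 2 * (W k).re) := by
        refine integral_mono (integrable_heatWeight_mul_norm_fourierPairing_sq h0 h hΦ)
          ((integrable_heatWeight_mul_norm_fourierPairing_sq h0 h hG).add
            (hWre.const_mul 2)) fun k => ?_
        have hw := heatWeight_nonneg h k
        have e2 : (W k).re = heatWeight σ r k * (conj (fourierPairing Φ k) * 𝓕 M k).re := by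
          simp only [hW]
          rw [mul_assoc, Complex.re_ofReal_mul]
        have e3 : fourierPairing G k = fourierPairing Φ k - 𝓕 M k := by rw [heq k]; ring
        dsimp only
        rw [e2, e3, ← Complex.normSq_eq_norm_sq, ← Complex.normSq_eq_norm_sq]
        have e4 : Complex.normSq (fourierPairing Φ k)
            ≤ Complex.normSq (fourierPairing Φ k - 𝓕 M k)
              + 2 * (conj (fourierPairing Φ k) * 𝓕 M k).re := by
          simp only [Complex.normSq_apply, Complex.sub_re, Complex.sub_im, Complex.mul_re,
            Complex.conj_re, Complex.conj_im]
          nlinarith [sq_nonneg (𝓕 M k).re, sq_nonneg (𝓕 M k).im]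
        calc _ ≤ heatWeight σ r k * _ := mul_le_mul_of_nonneg_left e4 hw
          _ = _ := by ring
    _ = (∫ k, heatWeight σ r k * ‖fourierPairing G k‖ ^ 2) + 2 * (∫ k, W k).re := by
        rw [integral_add (integrable_heatWeight_mul_norm_fourierPairing_sq h0 h hG)
          (hWre.const_mul 2), integral_const_mul]
        congr 2
        exact integral_re hWi
    _ ≤ _ := by
        have h1 := integral_heatWeight_mul_norm_fourierPairing_sq_le_of_memLp h0 h hG hG2
        have h2 := (Complex.re_le_norm _).trans hcross
        linarith

end DivergenceEstimate

section Nondegeneracy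

open scoped RealInnerProductSpace

variable {E : Type*} [NormedAddCommGroup E] [InnerProductSpace ℝ E]

/-- A regularisation of `1 / b`, with `b c = ⟪v, a c⟫`. -/
theorem exists_contDiff_integral_sq_one_sub_mul_inner_lt {A : ℝ} (hA : 0 < A) {a : ℝ → E}
    (ha : ContDiff ℝ 1 a) {v : E} (hv : volume {c ∈ Icc (-A) A | ⟪v, a c⟫ = 0} = 0) {η : ℝ}
    (hη : 0 < η) :
    ∃ g : ℝ → ℝ, ContDiff ℝ 1 g ∧ ∫ c in (-A)..A, (1 - g c * ⟪v, a c⟫) ^ 2 < η := by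
  have hb : ContDiff ℝ 1 fun c => ⟪v, a c⟫ := contDiff_const.inner ℝ ha
  have hpos : ∀ (n : ℕ) (c : ℝ), 0 < ⟪v, a c⟫ ^ 2 + 1 / ((n : ℝ) + 1) := fun n c => by positivity
  set g : ℕ → ℝ → ℝ := fun n c => ⟪v, a c⟫ / (⟪v, a c⟫ ^ 2 + 1 / ((n : ℝ) + 1)) with hg
  have hgc : ∀ n, ContDiff ℝ 1 (g n) := fun n =>
    hb.div ((hb.pow 2).add contDiff_const) fun c => (hpos n c).ne'
  have hform : ∀ n c, (1 - g n c * ⟪v, a c⟫)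
      = (1 / ((n : ℝ) + 1)) / (⟪v, a c⟫ ^ 2 + 1 / ((n : ℝ) + 1)) := fun n c => by
    have := (hpos n c).ne'
    simp only [hg]
    rw [eq_div_iff this, sub_mul, div_mul_eq_mul_div, div_mul_cancel₀ _ this]
    ring
  have hle : -A ≤ A := by linarith
  have hlim : Filter.Tendsto (fun n => ∫ c in (-A)..A, (1 - g n c * ⟪v, a c⟫) ^ 2) Filter.atTop
      (nhds (∫ c in (-A)..A, (0 : ℝ))) := by
    refine intervalIntegral.tendsto_integral_filter_of_dominated_convergence (fun _ => (1 : ℝ))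
      (Filter.Eventually.of_forall fun n => ?_) (Filter.Eventually.of_forall fun n =>
        Filter.Eventually.of_forall fun c _ => ?_) (by simp) ?_
    · exact ((continuous_const.sub ((hgc n).continuous.mul hb.continuous)).pow
        2).aestronglyMeasurable
    · rw [hform, Real.norm_of_nonneg (by positivity)]
      have : (1 / ((n : ℝ) + 1)) / (⟪v, a c⟫ ^ 2 + 1 / ((n : ℝ) + 1)) ≤ 1 := by
        rw [div_le_one (hpos n c)]
        nlinarith [sq_nonneg ⟪v, a c⟫]
      exact pow_le_one₀ (by have := hpos n c; positivity) this
    · have hae : ∀ᵐ c : ℝ, c ∉ {c ∈ Icc (-A) A | ⟪v, a c⟫ = 0} := by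
        rw [ae_iff]; simpa only [not_not, ofPred_mem_eq] using hv
      filter_upwards [hae] with c hc hcm
      rw [uIoc_of_le hle] at hcm
      have hne : ⟪v, a c⟫ ≠ 0 := fun h => hc ⟨Ioc_subset_Icc_self hcm, h⟩
      simp_rw [hform]
      have h1 := tendsto_one_div_add_atTop_nhds_zero_nat (𝕜 := ℝ)
      have h2 := (h1.div (h1.const_add (⟪v, a c⟫ ^ 2)) (by simpa using hne)).pow 2
      simpa using h2
  rw [intervalIntegral.integral_zero] at hlim
  obtain ⟨n, hn⟩ := (hlim.eventually_lt_const hη).exists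
  exact ⟨g n, hgc n, hn⟩

theorem exists_finset_contDiff_integral_sq_one_sub_mul_inner_le [FiniteDimensional ℝ E] {A : ℝ}
    (hA : 0 < A) {a : ℝ → E} (ha : ContDiff ℝ 1 a)
    (hnd : ∀ v : E, ‖v‖ = 1 → volume {c ∈ Icc (-A) A | ⟪v, a c⟫ = 0} = 0) {η : ℝ}
    (hη : 0 < η) :
    ∃ (s : Finset E) (g : E → ℝ → ℝ), (∀ v, ContDiff ℝ 1 (g v)) ∧
      ∀ ω : E, ‖ω‖ = 1 → ∃ v ∈ s, ∫ c in (-A)..A, (1 - g v c * ⟪ω, a c⟫) ^ 2 ≤ η := by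
  have hex : ∀ v : E, ∃ g : ℝ → ℝ, ContDiff ℝ 1 g ∧
      (‖v‖ = 1 → ∫ c in (-A)..A, (1 - g c * ⟪v, a c⟫) ^ 2 < η) := fun v => by
    by_cases hv : ‖v‖ = 1
    · obtain ⟨g, hg, h⟩ := exists_contDiff_integral_sq_one_sub_mul_inner_lt hA ha (hnd v hv) hη
      exact ⟨g, hg, fun _ => h⟩
    · exact ⟨0, contDiff_const, fun h => absurd h hv⟩
  choose g hg hlt using hex
  have hcont : ∀ v, Continuous fun ω : E => ∫ c in (-A)..A, (1 - g v c * ⟪ω, a c⟫) ^ 2 := by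
    intro v
    refine intervalIntegral.continuous_parametric_intervalIntegral_of_continuous' ?_ _ _
    have h1 := (hg v).continuous
    have h2 := ha.continuous
    simp only [Function.uncurry_def]
    fun_prop
  obtain ⟨t, hts, ht⟩ := (isCompact_sphere (0 : E) 1).elim_nhds_subcover
    (fun v => {ω : E | ‖v‖ = 1 → ∫ c in (-A)..A, (1 - g v c * ⟪ω, a c⟫) ^ 2 < η})
    (fun v hv => by
      filter_upwards [(hcont v).tendsto v |>.eventually_lt_const
        (hlt v (by simpa using hv))] with ω hω _ using hω)
  refine ⟨t, g, hg, fun ω hω => ?_⟩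
  obtain ⟨v, hv, hlt⟩ := mem_iUnion₂.1 (ht (by simpa using hω))
  exact ⟨v, hv, (hlt (by simpa using hts v hv)).le⟩

end Nondegeneracy

section Kinetic

open FourierTransform Real
open scoped RealInnerProductSpace ComplexConjugate

variable {E : Type*}

/-- The localised kinetic function `φ(x) 1_{c ≤ w(x)}`. -/
def kineticFn (φ w : E → ℝ) (c : ℝ) (x : E) : ℂ := ((Iic (w x)).indicator (fun _ => φ x) c : ℝ)

theorem norm_kineticFn_le (φ w : E → ℝ) (c : ℝ) (x : E) : ‖kineticFn φ w c x‖ ≤ ‖φ x‖ := by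
  unfold kineticFn
  rw [Complex.norm_real]
  exact norm_indicator_le_norm_self (fun _ => φ x) c

theorem measurable_kineticFn [MeasurableSpace E] {φ w : E → ℝ} (hφ : Measurable φ)
    (hw : Measurable w) : Measurable fun p : ℝ × E => kineticFn φ w p.1 p.2 := by
  have hs : MeasurableSet {p : ℝ × E | p.1 ≤ w p.2} :=
    measurableSet_le measurable_fst (hw.comp measurable_snd)
  have h : Measurable ({p : ℝ × E | p.1 ≤ w p.2}.indicator fun p => φ p.2) :=
    (hφ.comp measurable_snd).indicator hs
  exact Complex.measurable_ofReal.comp h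

theorem intervalIntegral_eq_setIntegral_indicator_Iic {A y : ℝ} (h1 : -A ≤ y) (h2 : y ≤ A)
    (b : ℝ → ℝ) : ∫ c in (-A)..y, b c = ∫ c in Ioc (-A) A, (Iic y).indicator b c := by
  rw [intervalIntegral.integral_of_le h1, setIntegral_indicator measurableSet_Iic, Ioc_inter_Iic,
    min_eq_right h2]

variable [NormedAddCommGroup E] [InnerProductSpace ℝ E] [FiniteDimensional ℝ E]
  [MeasurableSpace E] [BorelSpace E]

theorem integrable_kineticFn {φ w : E → ℝ} (hφ : Continuous φ) (hφi : Integrable φ)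
    (hw : Measurable w) (c : ℝ) : Integrable (kineticFn φ w c) :=
  hφi.norm.mono' ((measurable_kineticFn hφ.measurable hw).comp
    measurable_prodMk_left).aestronglyMeasurable
    (Filter.Eventually.of_forall fun x => norm_kineticFn_le φ w c x)

theorem memLp_kineticFn {φ w : E → ℝ} (hφ : Continuous φ) (hφ2 : MemLp φ 2)
    (hw : Measurable w) (c : ℝ) : MemLp (kineticFn φ w c) 2 :=
  hφ2.mono ((measurable_kineticFn hφ.measurable hw).comp
    measurable_prodMk_left).aestronglyMeasurable
    (Filter.Eventually.of_forall fun x => norm_kineticFn_le φ w c x)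

theorem fourier_mul_intervalIntegral {A : ℝ} {φ w : E → ℝ} (hφ : Continuous φ)
    (hφi : Integrable φ) (hw : Measurable w) (hwA : ∀ x, |w x| ≤ A) {b : ℝ → ℝ}
    (hb : Continuous b) (k : E) :
    𝓕 (fun x => ((φ x * ∫ c in (-A)..w x, b c : ℝ) : ℂ)) k
      = ∫ c in Ioc (-A) A, (b c : ℂ) * 𝓕 (kineticFn φ w c) k := by
  have e1 : ∀ x, ((φ x * ∫ c in (-A)..w x, b c : ℝ) : ℂ)
      = ∫ c in Ioc (-A) A, (b c : ℂ) * kineticFn φ w c x := fun x => by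
    rw [intervalIntegral_eq_setIntegral_indicator_Iic (abs_le.1 (hwA x)).1 (abs_le.1 (hwA x)).2,
      ← integral_const_mul, ← integral_complex_ofReal]
    congr 1; ext c
    by_cases hc : c ≤ w x <;> simp [kineticFn, indicator, hc, mul_comm]
  have hmeas : Measurable fun p : E × ℝ => kineticFn φ w p.2 p.1 :=
    (measurable_kineticFn hφ.measurable hw).comp measurable_swap
  have hint : Integrable (Function.uncurry fun (x : E) (c : ℝ) =>
      𝐞 (-⟪x, k⟫) • ((b c : ℂ) * kineticFn φ w c x))
      ((volume : Measure E).prod (volume.restrict (Ioc (-A) A))) := by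
    have hbi : Integrable b (volume.restrict (Ioc (-A) A)) :=
      (hb.integrableOn_Icc).mono_set Ioc_subset_Icc_self
    refine (hφi.norm.mul_prod hbi.norm).mono' ?_ (Filter.Eventually.of_forall fun p => ?_)
    · have hc : Continuous fun p : E × ℝ => (((𝐞 (-⟪p.1, k⟫)) : Circle) : ℂ) :=
        continuous_subtype_val.comp (Real.continuous_fourierChar.comp (by fun_prop))
      have h2 : Measurable fun p : E × ℝ => (b p.2 : ℂ) * kineticFn φ w p.2 p.1 :=
        (Complex.measurable_ofReal.comp (hb.measurable.comp measurable_snd)).mul hmeas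
      exact (hc.measurable.mul h2).aestronglyMeasurable
    · obtain ⟨x, c⟩ := p
      simp only [Function.uncurry_apply_pair, Circle.norm_smul, norm_mul, Complex.norm_real]
      rw [mul_comm]
      exact mul_le_mul_of_nonneg_right (norm_kineticFn_le φ w c x) (norm_nonneg _)
  rw [Real.fourier_eq]
  have e2 : ∀ x, 𝐞 (-⟪x, k⟫) • ((φ x * ∫ c in (-A)..w x, b c : ℝ) : ℂ)
      = ∫ c in Ioc (-A) A, 𝐞 (-⟪x, k⟫) • ((b c : ℂ) * kineticFn φ w c x) := fun x => by
    rw [e1 x]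
    simp only [Circle.smul_def, smul_eq_mul]
    rw [integral_const_mul]
  simp_rw [e2]
  rw [integral_integral_swap hint]
  congr 1; ext c
  rw [Real.fourier_eq, ← integral_const_mul]
  congr 1; ext x
  simp only [Circle.smul_def, smul_eq_mul]
  ring

theorem stronglyMeasurable_fourier_kineticFn {φ w : E → ℝ} (hφ : Continuous φ)
    (hw : Measurable w) :
    StronglyMeasurable fun p : E × ℝ => 𝓕 (kineticFn φ w p.2) p.1 := by
  simp_rw [Real.fourier_eq]
  refine StronglyMeasurable.integral_prod_right
    (f := fun (p : E × ℝ) (x : E) => 𝐞 (-⟪x, p.1⟫) • kineticFn φ w p.2 x) ?_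
  have hc : Continuous fun p : (E × ℝ) × E => (((𝐞 (-⟪p.2, p.1.1⟫)) : Circle) : ℂ) :=
    continuous_subtype_val.comp (Real.continuous_fourierChar.comp (by fun_prop))
  have h2 : Measurable fun p : (E × ℝ) × E => kineticFn φ w p.1.2 p.2 :=
    (measurable_kineticFn hφ.measurable hw).comp
      ((measurable_snd.comp measurable_fst).prodMk measurable_snd)
  exact (hc.measurable.mul h2).stronglyMeasurable

theorem integrable_norm_sq_fourier_kineticFn_prod {A : ℝ} {φ w : E → ℝ} (hφ : Continuous φ)
    (hφi : Integrable φ) (hφ2 : MemLp φ 2) (hw : Measurable w) :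
    Integrable (fun p : E × ℝ => ‖𝓕 (kineticFn φ w p.2) p.1‖ ^ 2)
      ((volume : Measure E).prod (volume.restrict (Ioc (-A) A))) := by
  have hm : StronglyMeasurable fun p : E × ℝ => ‖𝓕 (kineticFn φ w p.2) p.1‖ ^ 2 :=
    (stronglyMeasurable_fourier_kineticFn hφ hw).norm.pow 2
  rw [integrable_prod_iff' hm.aestronglyMeasurable]
  refine ⟨Filter.Eventually.of_forall fun c => ?_, ?_⟩
  · exact (memLp_fourier (integrable_kineticFn hφ hφi hw c)
      (memLp_kineticFn hφ hφ2 hw c)).integrable_norm_pow (by norm_num)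
  · have hi : Integrable (fun _ : ℝ => ∫ x, ‖φ x‖ ^ 2) (volume.restrict (Ioc (-A) A)) :=
      integrable_const _
    refine hi.mono' ?_ (Filter.Eventually.of_forall fun c => ?_)
    · exact (StronglyMeasurable.integral_prod_left hm.norm).aestronglyMeasurable
    · rw [Real.norm_of_nonneg (integral_nonneg fun _ => norm_nonneg _)]
      simp only [norm_pow, norm_norm]
      rw [integral_norm_sq_fourier (integrable_kineticFn hφ hφi hw c)
        (memLp_kineticFn hφ hφ2 hw c)]
      refine integral_mono_of_nonneg (Filter.Eventually.of_forall fun x => sq_nonneg _)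
        (hφ2.integrable_norm_pow (by norm_num)) (Filter.Eventually.of_forall fun x => ?_)
      exact pow_le_pow_left₀ (norm_nonneg _) (norm_kineticFn_le φ w c x) 2

theorem integral_integral_norm_sq_fourier_kineticFn_le {A : ℝ} (hA : 0 < A) {φ w : E → ℝ}
    (hφ : Continuous φ) (hφi : Integrable φ) (hφ2 : MemLp φ 2) (hw : Measurable w) :
    ∫ k, ∫ c in Ioc (-A) A, ‖𝓕 (kineticFn φ w c) k‖ ^ 2 ≤ 2 * A * ∫ x, ‖φ x‖ ^ 2 := by
  rw [integral_integral_swap (integrable_norm_sq_fourier_kineticFn_prod hφ hφi hφ2 hw)]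
  have hle : ∀ c, ∫ k, ‖𝓕 (kineticFn φ w c) k‖ ^ 2 ≤ ∫ x, ‖φ x‖ ^ 2 := fun c => by
    rw [integral_norm_sq_fourier (integrable_kineticFn hφ hφi hw c)
        (memLp_kineticFn hφ hφ2 hw c)]
    refine integral_mono_of_nonneg (Filter.Eventually.of_forall fun x => sq_nonneg _)
      (hφ2.integrable_norm_pow (by norm_num)) (Filter.Eventually.of_forall fun x => ?_)
    exact pow_le_pow_left₀ (norm_nonneg _) (norm_kineticFn_le φ w c x) 2
  calc _ ≤ ∫ c in Ioc (-A) A, ∫ x, ‖φ x‖ ^ 2 := by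
        refine integral_mono_of_nonneg (Filter.Eventually.of_forall fun c =>
          integral_nonneg fun _ => sq_nonneg _) (integrable_const _)
          (Filter.Eventually.of_forall hle)
    _ = _ := by
        rw [setIntegral_const, smul_eq_mul, Real.volume_real_Ioc_of_le (by linarith)]
        ring

end Kinetic

section VelocityAveraging

open FourierTransform Real
open scoped RealInnerProductSpace ComplexConjugate

theorem norm_integral_mul_sq_le {α : Type*} [MeasurableSpace α] {μ : Measure α} {b : α → ℝ}
    {F : α → ℂ} (hb : MemLp b 2 μ) (hF : MemLp F 2 μ) :
    ‖∫ c, (b c : ℂ) * F c ∂μ‖ ^ 2 ≤ (∫ c, b c ^ 2 ∂μ) * ∫ c, ‖F c‖ ^ 2 ∂μ := by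
  have h1 : ‖∫ c, (b c : ℂ) * F c ∂μ‖ ≤ ∫ c, ‖b c‖ * ‖F c‖ ∂μ := by
    refine (norm_integral_le_integral_norm _).trans_eq ?_
    simp
  have h2 := integral_mul_le_Lp_mul_Lq_of_nonneg (μ := μ) (p := 2) (q := 2)
    (by constructor <;> norm_num) (f := fun c => ‖b c‖) (g := fun c => ‖F c‖)
    (Filter.Eventually.of_forall fun _ => norm_nonneg _)
    (Filter.Eventually.of_forall fun _ => norm_nonneg _)
    (by simpa using hb.norm) (by simpa using hF.norm)
  have h3 := pow_le_pow_left₀ (norm_nonneg _) (h1.trans h2) 2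
  refine h3.trans_eq ?_
  have e : ∀ x : ℝ, 0 ≤ x → (x ^ (1 / (2 : ℝ))) ^ 2 = x := fun x hx => by
    rw [← Real.sqrt_eq_rpow, Real.sq_sqrt hx]
  rw [mul_pow, e _ (integral_nonneg fun _ => by positivity),
    e _ (integral_nonneg fun _ => by positivity)]
  simp

variable {E : Type*} [NormedAddCommGroup E] [InnerProductSpace ℝ E] [FiniteDimensional ℝ E]
  [MeasurableSpace E] [BorelSpace E]

/-- The localised primitive `φ ∫_{-A}^w g a`. -/
def entropyFlux (A : ℝ) (φ w : E → ℝ) (g : ℝ → ℝ) (a : ℝ → E) (x : E) : E :=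
  φ x • ∫ c in (-A)..w x, g c • a c

theorem fourierPairing_entropyFlux {A : ℝ} {φ w : E → ℝ} (hφ : Continuous φ)
    (hφi : Integrable φ) (hw : Measurable w) (hwA : ∀ x, |w x| ≤ A) {g : ℝ → ℝ} {a : ℝ → E}
    (hg : Continuous g) (ha : Continuous a) (k : E) :
    fourierPairing (entropyFlux A φ w g a) k
      = ∫ c in Ioc (-A) A, ((g c * ⟪k, a c⟫ : ℝ) : ℂ) * 𝓕 (kineticFn φ w c) k := by
  rw [← fourier_mul_intervalIntegral hφ hφi hw hwA (b := fun c => g c * ⟪k, a c⟫) (by fun_prop)]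
  unfold fourierPairing entropyFlux
  refine congrFun (congrArg 𝓕 (funext fun x => ?_)) k
  rw [inner_smul_right]
  have := (innerSL ℝ k).intervalIntegral_comp_comm
    ((by fun_prop : Continuous fun c => g c • a c).intervalIntegrable (-A) (w x) (μ := volume))
  simp only [innerSL_apply_apply, inner_smul_right] at this
  rw [this]

theorem norm_fourier_kineticFn_le {φ w : E → ℝ} (hφi : Integrable φ) (c : ℝ) (k : E) :
    ‖𝓕 (kineticFn φ w c) k‖ ≤ ∫ x, ‖φ x‖ :=
  (norm_fourier_le_integral_norm _ _).trans <| integral_mono_of_nonneg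
    (Filter.Eventually.of_forall fun _ => norm_nonneg _) hφi.norm
    (Filter.Eventually.of_forall fun x => norm_kineticFn_le φ w c x)

theorem memLp_fourier_kineticFn {φ w : E → ℝ} (hφ : Continuous φ)
    (hφi : Integrable φ) (hw : Measurable w) (k : E) (μ : Measure ℝ) [IsFiniteMeasure μ]
    (p : ENNReal) : MemLp (fun c => 𝓕 (kineticFn φ w c) k) p μ := by
  have h1 := stronglyMeasurable_fourier_kineticFn hφ hw
  have h2 : Measurable fun c : ℝ => (k, c) := measurable_prodMk_left
  have hsm : StronglyMeasurable fun c => 𝓕 (kineticFn φ w c) k :=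
    StronglyMeasurable.comp_measurable (g := fun c : ℝ => (k, c)) h1 h2
  exact MemLp.of_bound hsm.aestronglyMeasurable (∫ x, ‖φ x‖)
    (Filter.Eventually.of_forall fun c => norm_fourier_kineticFn_le hφi c k)

theorem norm_sq_fourier_le_of_direction {A η : ℝ} {φ w : E → ℝ} (hφ : Continuous φ)
    (hφi : Integrable φ) (hw : Measurable w) (hwA : ∀ x, |w x| ≤ A)
    {g : ℝ → ℝ} {a : ℝ → E} (hg : Continuous g) (ha : Continuous a) {k : E} (hk : k ≠ 0)
    (hη : ∫ c in (-A)..A, (1 - g c * ⟪‖k‖⁻¹ • k, a c⟫) ^ 2 ≤ η) :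
    ‖k‖ ^ 2 * ‖𝓕 (fun x => ((φ x * (w x + A) : ℝ) : ℂ)) k‖ ^ 2
      ≤ 2 * ‖fourierPairing (entropyFlux A φ w g a) k‖ ^ 2
        + 2 * η * (‖k‖ ^ 2 * ∫ c in Ioc (-A) A, ‖𝓕 (kineticFn φ w c) k‖ ^ 2) := by
  have hA : 0 ≤ A := (abs_nonneg _).trans (hwA 0)
  have hk' : 0 < ‖k‖ := norm_pos_iff.2 hk
  have hF := memLp_fourier_kineticFn hφ hφi hw k (volume.restrict (Ioc (-A) A)) 2
  have hbm : ∀ b : ℝ → ℝ, Continuous b → MemLp b 2 (volume.restrict (Ioc (-A) A)) :=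
    fun b hb => (memLp_two_iff_integrable_sq hb.aestronglyMeasurable).2
      ((hb.pow 2).integrableOn_Icc.mono_set Ioc_subset_Icc_self)
  set b : ℝ → ℝ := fun c => ‖k‖ * (1 - g c * ⟪‖k‖⁻¹ • k, a c⟫) with hbdef
  have hbc : Continuous b := by fun_prop
  have hi : ∀ b : ℝ → ℝ, Continuous b →
      Integrable (fun c => (b c : ℂ) * 𝓕 (kineticFn φ w c) k) (volume.restrict (Ioc (-A) A)) :=
    fun b hb => MemLp.integrable_mul (hbm b hb).ofReal hF
  have e1 : 𝓕 (fun x => ((φ x * (w x + A) : ℝ) : ℂ)) k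
      = ∫ c in Ioc (-A) A, ((1 : ℝ) : ℂ) * 𝓕 (kineticFn φ w c) k := by
    rw [← fourier_mul_intervalIntegral hφ hφi hw hwA (b := fun _ => 1) continuous_const]
    simp
  have e2 : (‖k‖ : ℂ) * 𝓕 (fun x => ((φ x * (w x + A) : ℝ) : ℂ)) k
      = fourierPairing (entropyFlux A φ w g a) k
        + ∫ c in Ioc (-A) A, (b c : ℂ) * 𝓕 (kineticFn φ w c) k := by
    rw [fourierPairing_entropyFlux hφ hφi hw hwA hg ha, e1, ← integral_const_mul,
      ← integral_add (hi _ (by fun_prop)) (hi b hbc)]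
    congr 1; ext c
    simp only [hbdef, inner_smul_left, conj_trivial]
    push_cast
    have : (‖k‖ : ℂ) ≠ 0 := by exact_mod_cast hk'.ne'
    field_simp
    ring
  have e3 := norm_integral_mul_sq_le (hbm b hbc) hF
  have e4 : ∫ c in Ioc (-A) A, b c ^ 2 ≤ ‖k‖ ^ 2 * η := by
    rw [intervalIntegral.integral_of_le (by linarith)] at hη
    simp only [hbdef, mul_pow]
    rw [integral_const_mul]
    gcongr
  have e5 : 0 ≤ ∫ c in Ioc (-A) A, ‖𝓕 (kineticFn φ w c) k‖ ^ 2 :=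
    integral_nonneg fun _ => sq_nonneg _
  set P := fourierPairing (entropyFlux A φ w g a) k
  set D := ∫ c in Ioc (-A) A, (b c : ℂ) * 𝓕 (kineticFn φ w c) k
  have e6 : ‖P + D‖ ^ 2 ≤ 2 * ‖P‖ ^ 2 + 2 * ‖D‖ ^ 2 := by
    have := pow_le_pow_left₀ (norm_nonneg _) (norm_add_le P D) 2
    nlinarith [sq_nonneg (‖P‖ - ‖D‖)]
  have e7 := congrArg (fun z => ‖z‖ ^ 2) e2
  simp only [norm_mul, Complex.norm_real, norm_norm, mul_pow] at e7
  rw [e7]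
  have e8 := mul_le_mul_of_nonneg_right e4 e5
  linarith

end VelocityAveraging

section HighFrequency

open FourierTransform Real
open scoped RealInnerProductSpace ComplexConjugate

variable {E : Type*} [NormedAddCommGroup E] [InnerProductSpace ℝ E]

theorem norm_entropyFlux_le {A : ℝ} {φ w : E → ℝ} (hwA : ∀ x, |w x| ≤ A) {g : ℝ → ℝ} {a : ℝ → E}
    (hg : Continuous g) (ha : Continuous a) (x : E) :
    ‖entropyFlux A φ w g a x‖ ≤ ‖φ x‖ * ∫ c in (-A)..A, ‖g c • a c‖ := by
  have h1 := (abs_le.1 (hwA x)).1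
  have h2 := (abs_le.1 (hwA x)).2
  have hc : Continuous fun c => g c • a c := hg.smul ha
  unfold entropyFlux
  rw [norm_smul]
  gcongr
  refine (intervalIntegral.norm_integral_le_integral_norm h1).trans ?_
  rw [intervalIntegral.integral_of_le h1, intervalIntegral.integral_of_le (h1.trans h2)]
  exact setIntegral_mono_set (hc.norm.integrableOn_Icc.mono_set Ioc_subset_Icc_self)
    (Filter.Eventually.of_forall fun _ => norm_nonneg _) (Ioc_subset_Ioc_right h2).eventuallyLE

variable [FiniteDimensional ℝ E] [MeasurableSpace E] [BorelSpace E]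

theorem measurable_entropyFlux (A : ℝ) {φ w : E → ℝ} (hφ : Continuous φ) (hw : Measurable w)
    {g : ℝ → ℝ} {a : ℝ → E} (hg : Continuous g) (ha : Continuous a) :
    Measurable (entropyFlux A φ w g a) := by
  have h : Continuous fun y => ∫ c in (-A)..y, g c • a c :=
    intervalIntegral.continuous_primitive
      (fun u v => (hg.smul ha).intervalIntegrable u v) _
  exact hφ.measurable.smul (h.measurable.comp hw)

theorem integrable_entropyFlux {A : ℝ} {φ w : E → ℝ} (hφ : Continuous φ) (hφi : Integrable φ)
    (hw : Measurable w) (hwA : ∀ x, |w x| ≤ A) {g : ℝ → ℝ} {a : ℝ → E}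
    (hg : Continuous g) (ha : Continuous a) : Integrable (entropyFlux A φ w g a) :=
  (hφi.norm.mul_const _).mono' (measurable_entropyFlux A hφ hw hg ha).aestronglyMeasurable
    (Filter.Eventually.of_forall fun x => norm_entropyFlux_le hwA hg ha x)

theorem integral_exp_sub_exp_mul_norm_sq_fourier_le {ι : Type*} {A η β σ r : ℝ} (hA : 0 < A)
    (hσ : 0 < σ) (hr : σ ≤ r) (hη : 0 ≤ η) {φ w : E → ℝ} (hφ : Continuous φ) (hφi : Integrable φ)
    (hφ2 : MemLp φ 2) (hw : Measurable w) (hwA : ∀ x, |w x| ≤ A) {a : ℝ → E} (ha : Continuous a)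
    {s : Finset ι} {g : ι → ℝ → ℝ} (hg : ∀ v, Continuous (g v))
    (hdir : ∀ ω : E, ‖ω‖ = 1 → ∃ v ∈ s, ∫ c in (-A)..A, (1 - g v c * ⟪ω, a c⟫) ^ 2 ≤ η)
    (hβ : ∀ v ∈ s, ∫ k, heatWeight σ r k * ‖fourierPairing (entropyFlux A φ w (g v) a) k‖ ^ 2 ≤ β) :
    ∫ k, (exp (-σ * ‖k‖ ^ 2) - exp (-r * ‖k‖ ^ 2))
        * ‖𝓕 (fun x => ((φ x * (w x + A) : ℝ) : ℂ)) k‖ ^ 2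
      ≤ 2 * (s.card * β) + 2 * η * (2 * A * ∫ x, ‖φ x‖ ^ 2) := by
  have hI : ∀ v, Integrable fun k => heatWeight σ r k *
      ‖fourierPairing (entropyFlux A φ w (g v) a) k‖ ^ 2 := fun v =>
    integrable_heatWeight_mul_norm_fourierPairing_sq hσ hr
      (integrable_entropyFlux hφ hφi hw hwA (hg v) ha)
  have hN : Integrable fun k => ∫ c in Ioc (-A) A, ‖𝓕 (kineticFn φ w c) k‖ ^ 2 :=
    (integrable_norm_sq_fourier_kineticFn_prod (A := A) hφ hφi hφ2 hw).integral_prod_left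
  have hsumI : Integrable fun k => ∑ v ∈ s, heatWeight σ r k *
      ‖fourierPairing (entropyFlux A φ w (g v) a) k‖ ^ 2 := integrable_finsetSum _ fun v _ => hI v
  calc _ ≤ ∫ k, (2 * ∑ v ∈ s, heatWeight σ r k *
          ‖fourierPairing (entropyFlux A φ w (g v) a) k‖ ^ 2
        + 2 * η * ∫ c in Ioc (-A) A, ‖𝓕 (kineticFn φ w c) k‖ ^ 2) := by
        refine integral_mono_of_nonneg (Filter.Eventually.of_forall fun k => ?_)
          ((hsumI.const_mul 2).add (hN.const_mul _)) (Filter.Eventually.of_forall fun k => ?_)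
        · dsimp only
          rw [← heatWeight_mul_norm_sq]
          have := heatWeight_nonneg hr k
          positivity
        · dsimp only
          rw [← heatWeight_mul_norm_sq]
          have hw0 := heatWeight_nonneg hr k
          have hw1 := heatWeight_mul_norm_sq_le (r := r) hσ.le k
          have hN0 : 0 ≤ ∫ c in Ioc (-A) A, ‖𝓕 (kineticFn φ w c) k‖ ^ 2 :=
            integral_nonneg fun _ => sq_nonneg _
          have hs0 : ∀ v ∈ s, 0 ≤ heatWeight σ r k *
              ‖fourierPairing (entropyFlux A φ w (g v) a) k‖ ^ 2 := fun v _ => by positivity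
          rcases eq_or_ne k 0 with hk | hk
          · have := Finset.sum_nonneg hs0
            have h2 : heatWeight σ r k * ‖k‖ ^ 2 = 0 := by simp [hk]
            rw [h2, zero_mul]
            positivity
          · have hk1 : ‖(‖k‖⁻¹ • k)‖ = 1 := by
              rw [norm_smul, norm_inv, norm_norm, inv_mul_cancel₀ (norm_ne_zero_iff.2 hk)]
            obtain ⟨v, hv, hle⟩ := hdir _ hk1
            have h1 := norm_sq_fourier_le_of_direction hφ hφi hw hwA (hg v) ha hk hle
            have h2 := Finset.single_le_sum hs0 hv
            have h3 := mul_le_mul_of_nonneg_left h1 hw0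
            have h4 : heatWeight σ r k * ‖k‖ ^ 2 *
                (η * ∫ c in Ioc (-A) A, ‖𝓕 (kineticFn φ w c) k‖ ^ 2)
                ≤ η * ∫ c in Ioc (-A) A, ‖𝓕 (kineticFn φ w c) k‖ ^ 2 :=
              mul_le_of_le_one_left (mul_nonneg hη hN0) hw1
            linarith
    _ = 2 * ∑ v ∈ s, (∫ k, heatWeight σ r k *
          ‖fourierPairing (entropyFlux A φ w (g v) a) k‖ ^ 2)
        + 2 * η * ∫ k, ∫ c in Ioc (-A) A, ‖𝓕 (kineticFn φ w c) k‖ ^ 2 := by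
        rw [integral_add (hsumI.const_mul 2) (hN.const_mul _), integral_const_mul,
          integral_const_mul, integral_finsetSum _ fun v _ => hI v]
    _ ≤ _ := by
        have h1 := Finset.sum_le_card_nsmul s _ β hβ
        rw [nsmul_eq_mul] at h1
        have h2 := integral_integral_norm_sq_fourier_kineticFn_le hA hφ hφi hφ2 hw
        gcongr

/-- High-frequency estimate for velocity averages. -/
theorem integral_one_sub_exp_mul_norm_sq_fourier_le {ι : Type*} {A η β r : ℝ} (hA : 0 < A)
    (hr : 0 < r) (hη : 0 ≤ η) {φ w : E → ℝ} (hφ : Continuous φ) (hφi : Integrable φ)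
    (hφ2 : MemLp φ 2) (hw : Measurable w) (hwA : ∀ x, |w x| ≤ A) {a : ℝ → E} (ha : Continuous a)
    {s : Finset ι} {g : ι → ℝ → ℝ} (hg : ∀ v, Continuous (g v))
    (hdir : ∀ ω : E, ‖ω‖ = 1 → ∃ v ∈ s, ∫ c in (-A)..A, (1 - g v c * ⟪ω, a c⟫) ^ 2 ≤ η)
    (hβ : ∀ v ∈ s, ∀ σ, 0 < σ → σ ≤ r →
      ∫ k, heatWeight σ r k * ‖fourierPairing (entropyFlux A φ w (g v) a) k‖ ^ 2 ≤ β) :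
    ∫ k, (1 - exp (-r * ‖k‖ ^ 2)) * ‖𝓕 (fun x => ((φ x * (w x + A) : ℝ) : ℂ)) k‖ ^ 2
      ≤ 2 * (s.card * β) + 2 * η * (2 * A * ∫ x, ‖φ x‖ ^ 2) := by
  set h : E → ℂ := fun x => ((φ x * (w x + A) : ℝ) : ℂ) with hh
  have hm : AEStronglyMeasurable h :=
    (Complex.measurable_ofReal.comp
      (hφ.measurable.mul (hw.add_const A))).aestronglyMeasurable
  have hb : ∀ x, ‖h x‖ ≤ ‖2 * A * φ x‖ := fun x => by
    rw [hh, Complex.norm_real, norm_mul, norm_mul, mul_comm, Real.norm_of_nonneg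
      (by positivity : 0 ≤ 2 * A)]
    gcongr
    rw [Real.norm_eq_abs, abs_le]
    have := abs_le.1 (hwA x)
    constructor <;> linarith
  have hi : Integrable h := (hφi.const_mul (2 * A)).mono hm (Filter.Eventually.of_forall hb)
  have h2 : MemLp h 2 := (hφ2.const_mul (2 * A)).mono hm (Filter.Eventually.of_forall hb)
  have hF := (memLp_fourier hi h2).integrable_norm_pow (by norm_num : (2 : ℕ) ≠ 0)
  have hFc := continuous_fourier_of_integrable hi
  set τ : ℕ → ℝ := fun n => r * (1 / ((n : ℝ) + 1)) with hτ
  have hτpos : ∀ n, 0 < τ n := fun n => by positivity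
  have hτle : ∀ n, τ n ≤ r := fun n => mul_le_of_le_one_right hr.le
    (by rw [div_le_one (by positivity)]; linarith [(Nat.cast_nonneg n : (0 : ℝ) ≤ n)])
  have hτ0 : Filter.Tendsto τ Filter.atTop (nhds 0) := by
    simpa [hτ] using tendsto_one_div_add_atTop_nhds_zero_nat.const_mul r
  have hlim : Filter.Tendsto (fun n => ∫ k, (exp (-τ n * ‖k‖ ^ 2) - exp (-r * ‖k‖ ^ 2))
      * ‖𝓕 h k‖ ^ 2) Filter.atTop
      (nhds (∫ k, (1 - exp (-r * ‖k‖ ^ 2)) * ‖𝓕 h k‖ ^ 2)) := by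
    refine tendsto_integral_of_dominated_convergence (fun k => ‖𝓕 h k‖ ^ 2)
      (fun n => ?_) hF (fun n => Filter.Eventually.of_forall fun k => ?_)
      (Filter.Eventually.of_forall fun k => ?_)
    · exact (Continuous.mul (by fun_prop) (hFc.norm.pow 2)).aestronglyMeasurable
    · rw [← heatWeight_mul_norm_sq, norm_mul, norm_pow, norm_norm]
      have h0 := heatWeight_nonneg (hτle n) k
      rw [Real.norm_of_nonneg (by positivity)]
      exact mul_le_of_le_one_left (sq_nonneg _) (heatWeight_mul_norm_sq_le (hτpos n).le k)
    · refine Filter.Tendsto.mul_const _ (Filter.Tendsto.sub_const ?_ _)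
      have h1 : Filter.Tendsto (fun n => -τ n * ‖k‖ ^ 2) Filter.atTop (nhds 0) := by
        simpa using hτ0.neg.mul_const (‖k‖ ^ 2)
      simpa [Function.comp_def] using (Real.continuous_exp.tendsto 0).comp h1
  exact le_of_tendsto' hlim fun n =>
    integral_exp_sub_exp_mul_norm_sq_fourier_le hA (hτpos n) (hτle n) hη hφ hφi hφ2 hw hwA ha hg
      hdir fun v hv => hβ v hv _ (hτpos n) (hτle n)

end HighFrequency

section AveragingCompactness

open FourierTransform Real
open scoped RealInnerProductSpace ComplexConjugate

variable {E : Type*} [NormedAddCommGroup E] [InnerProductSpace ℝ E] [FiniteDimensional ℝ E]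
  [MeasurableSpace E] [BorelSpace E]

/-- A sequence bounded in `L¹` whose Fourier transforms converge pointwise is Cauchy in `L²` as soon
as the high frequencies are uniformly small. -/
theorem eventually_integral_norm_sq_sub_le {h : ℕ → E → ℂ} {L r ρ : ℝ} (hr : 0 < r) (hρ : 0 < ρ)
    (hi : ∀ n, Integrable (h n)) (h2 : ∀ n, MemLp (h n) 2) (hL : ∀ n, ∫ x, ‖h n x‖ ≤ L)
    (hconv : ∀ k, CauchySeq fun n => 𝓕 (h n) k)
    (hhigh : ∀ᶠ n in Filter.atTop, ∫ k, (1 - exp (-r * ‖k‖ ^ 2)) * ‖𝓕 (h n) k‖ ^ 2 ≤ ρ) :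
    ∃ N, ∀ n ≥ N, ∀ m ≥ N, ∫ x, ‖h n x - h m x‖ ^ 2 ≤ 5 * ρ := by
  have hFc := fun n => continuous_fourier_of_integrable (hi n)
  have hFi : ∀ n, Integrable fun k => ‖𝓕 (h n) k‖ ^ 2 := fun n =>
    (memLp_fourier (hi n) (h2 n)).integrable_norm_pow (by norm_num)
  have hbd : ∀ n k, ‖𝓕 (h n) k‖ ≤ L := fun n k =>
    (norm_fourier_le_integral_norm _ _).trans (hL n)
  have hlow : Filter.Tendsto (fun p : ℕ × ℕ =>
      ∫ k, exp (-r * ‖k‖ ^ 2) * ‖𝓕 (h p.1) k - 𝓕 (h p.2) k‖ ^ 2) Filter.atTop (nhds 0) := by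
    have := tendsto_integral_filter_of_dominated_convergence (μ := (volume : Measure E))
      (l := (Filter.atTop : Filter (ℕ × ℕ)))
      (F := fun p k => exp (-r * ‖k‖ ^ 2) * ‖𝓕 (h p.1) k - 𝓕 (h p.2) k‖ ^ 2) (f := fun _ => 0)
      (fun k => exp (-r * ‖k‖ ^ 2) * (L + L) ^ 2)
      (Filter.Eventually.of_forall fun p => by
        have h1 := hFc p.1
        have h2 := hFc p.2
        exact (Continuous.mul (by fun_prop) ((h1.sub h2).norm.pow 2)).aestronglyMeasurable)
      (Filter.Eventually.of_forall fun p => Filter.Eventually.of_forall fun k => by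
        rw [Real.norm_of_nonneg (by positivity)]
        gcongr
        exact (norm_sub_le _ _).trans (add_le_add (hbd _ _) (hbd _ _)))
      ((integrable_exp_neg_mul_norm_sq hr).mul_const _)
      (Filter.Eventually.of_forall fun k => by
        have h1 := (cauchySeq_iff_tendsto_dist_atTop_0.1 (hconv k)).pow 2
        have h3 := h1.const_mul (exp (-r * ‖k‖ ^ 2))
        simpa [dist_eq_norm] using h3)
    simpa using this
  obtain ⟨N₁, hN₁⟩ := Filter.eventually_atTop.1 hhigh
  obtain ⟨N₂, hN₂⟩ := Filter.eventually_atTop.1 (hlow.eventually_lt_const hρ)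
  refine ⟨max N₁ (max N₂.1 N₂.2), fun n hn m hm => ?_⟩
  simp only [ge_iff_le, max_le_iff] at hn hm
  have hlo := hN₂ (n, m) ⟨hn.2.1, hm.2.2⟩
  have hsub : ∀ k, 𝓕 (fun x => h n x - h m x) k = 𝓕 (h n) k - 𝓕 (h m) k := fun k => by
    simp only [Real.fourier_eq, smul_sub]
    exact integral_sub ((Real.fourierIntegral_convergent_iff k).2 (hi n))
      ((Real.fourierIntegral_convergent_iff k).2 (hi m))
  have hpl : ∫ k, ‖𝓕 (fun x => h n x - h m x) k‖ ^ 2 = ∫ x, ‖h n x - h m x‖ ^ 2 :=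
    integral_norm_sq_fourier ((hi n).sub (hi m)) ((h2 n).sub (h2 m))
  rw [← hpl]
  have hle1 : ∀ k : E, 0 ≤ 1 - exp (-r * ‖k‖ ^ 2) := fun k => by
    have : exp (-r * ‖k‖ ^ 2) ≤ 1 := exp_le_one_iff.2 (by nlinarith [sq_nonneg ‖k‖])
    linarith
  have hhi : ∀ n, Integrable fun k => (1 - exp (-r * ‖k‖ ^ 2)) * ‖𝓕 (h n) k‖ ^ 2 := fun n => by
    refine (hFi n).mono' (Continuous.aestronglyMeasurable
      (Continuous.mul (by fun_prop) ((hFc n).norm.pow 2))) (Filter.Eventually.of_forall fun k => ?_)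
    rw [Real.norm_of_nonneg (mul_nonneg (hle1 k) (sq_nonneg _))]
    refine mul_le_of_le_one_left (sq_nonneg _) ?_
    have := exp_pos (-r * ‖k‖ ^ 2)
    linarith
  have hli : Integrable fun k => exp (-r * ‖k‖ ^ 2) * ‖𝓕 (h n) k - 𝓕 (h m) k‖ ^ 2 := by
    refine ((integrable_exp_neg_mul_norm_sq (E := E) hr).mul_const ((L + L) ^ 2)).mono'
      (Continuous.aestronglyMeasurable
        (Continuous.mul (by fun_prop) (((hFc n).sub (hFc m)).norm.pow 2)))
      (Filter.Eventually.of_forall fun k => ?_)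
    rw [Real.norm_of_nonneg (by positivity)]
    gcongr
    exact (norm_sub_le _ _).trans (add_le_add (hbd _ _) (hbd _ _))
  calc ∫ k, ‖𝓕 (fun x => h n x - h m x) k‖ ^ 2
      ≤ ∫ k, (exp (-r * ‖k‖ ^ 2) * ‖𝓕 (h n) k - 𝓕 (h m) k‖ ^ 2
          + (2 * ((1 - exp (-r * ‖k‖ ^ 2)) * ‖𝓕 (h n) k‖ ^ 2)
            + 2 * ((1 - exp (-r * ‖k‖ ^ 2)) * ‖𝓕 (h m) k‖ ^ 2))) := by
        refine integral_mono_of_nonneg (Filter.Eventually.of_forall fun k => sq_nonneg _)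
          (hli.add (((hhi n).const_mul 2).add ((hhi m).const_mul 2)))
          (Filter.Eventually.of_forall fun k => ?_)
        dsimp only
        rw [hsub k]
        have h1 : ‖𝓕 (h n) k - 𝓕 (h m) k‖ ^ 2 ≤ 2 * ‖𝓕 (h n) k‖ ^ 2 + 2 * ‖𝓕 (h m) k‖ ^ 2 := by
          have := pow_le_pow_left₀ (norm_nonneg _) (norm_sub_le (𝓕 (h n) k) (𝓕 (h m) k)) 2
          nlinarith [sq_nonneg (‖𝓕 (h n) k‖ - ‖𝓕 (h m) k‖)]
        have h3 := mul_le_mul_of_nonneg_left h1 (hle1 k)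
        linarith
    _ = (∫ k, exp (-r * ‖k‖ ^ 2) * ‖𝓕 (h n) k - 𝓕 (h m) k‖ ^ 2)
          + (2 * (∫ k, (1 - exp (-r * ‖k‖ ^ 2)) * ‖𝓕 (h n) k‖ ^ 2)
            + 2 * ∫ k, (1 - exp (-r * ‖k‖ ^ 2)) * ‖𝓕 (h m) k‖ ^ 2) := by
        have i1 := (hhi n).const_mul 2
        have i2 := (hhi m).const_mul 2
        have e1 := integral_add hli (i1.add i2)
        have e2 := integral_add i1 i2
        simp only [Pi.add_apply] at e1
        rw [e1, e2, integral_const_mul, integral_const_mul]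
    _ ≤ 5 * ρ := by
        have h1 := hN₁ n hn.1
        have h3 := hN₁ m hm.1
        simp only at hlo
        linarith

/-- Compactness of localised velocity averages. -/
theorem exists_integral_sq_mul_sub_le {A : ℝ} (hA : 0 < A) {a : ℝ → E} (ha : ContDiff ℝ 1 a)
    (hnd : ∀ v : E, ‖v‖ = 1 → volume {c ∈ Icc (-A) A | ⟪v, a c⟫ = 0} = 0)
    {φ : E → ℝ} (hφ : Continuous φ) (hφs : HasCompactSupport φ)
    {w : ℕ → E → ℝ} (hw : ∀ n, Measurable (w n)) (hwA : ∀ n x, |w n x| ≤ A)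
    (hconv : ∀ k, CauchySeq fun n => 𝓕 (fun x => ((φ x * w n x : ℝ) : ℂ)) k)
    (hdiv : ∀ g : ℝ → ℝ, ContDiff ℝ 1 g → ∃ (C : ℝ) (M : ℕ → E → ℂ) (G : ℕ → E → E),
      (∀ n, Integrable (M n)) ∧ (∀ n, ∫ x, ‖M n x‖ ≤ C) ∧ (∀ n, Integrable (G n)) ∧
      (∀ n, MemLp (G n) 2) ∧ Filter.Tendsto (fun n => ∫ x, ‖G n x‖ ^ 2) Filter.atTop (nhds 0) ∧
      ∀ n k, fourierPairing (entropyFlux A φ (w n) g a) k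
        = fourierPairing (G n) k + 𝓕 (M n) k)
    {η : ℝ} (hη : 0 < η) :
    ∃ N, ∀ n ≥ N, ∀ m ≥ N, ∫ x, (φ x * (w n x - w m x)) ^ 2 ≤ η := by
  have hφi : Integrable φ := hφ.integrable_of_hasCompactSupport hφs
  have hφ2 : MemLp φ 2 := hφ.memLp_of_hasCompactSupport hφs
  obtain ⟨Cφ, hCφ⟩ := hφs.exists_bound_of_continuous hφ
  set S := ∫ x, ‖φ x‖ ^ 2 with hS
  have hS0 : 0 ≤ S := integral_nonneg fun _ => sq_nonneg _
  obtain ⟨s, g, hg, hdir⟩ := exists_finset_contDiff_integral_sq_one_sub_mul_inner_le hA ha hnd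
    (η := η / (40 * A * (S + 1))) (by positivity)
  choose C M G hM hMC hG hG2 hG0 heq using fun v => hdiv (g v) (hg v)
  set K := ∫ z : E, gaussGradKernel 1 z
  set D : E → ℝ := fun v => (Cφ * ∫ c in (-A)..A, ‖g v c • a c‖) * K * C v with hD
  set β := η / (40 * (s.card + 1)) with hβ
  have hβ0 : 0 < β := by positivity
  set Dt := ∑ v ∈ s, |D v| with hDt
  have hDt0 : 0 ≤ Dt := Finset.sum_nonneg fun _ _ => abs_nonneg _
  set ρ := β / (8 * (Dt + 1)) with hρ
  have hρ0 : 0 < ρ := by positivity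
  have hev : ∀ᶠ n in Filter.atTop, ∀ v ∈ s, ∫ x, ‖G v n x‖ ^ 2 < β / 2 :=
    (Filter.eventually_all_finset s).2 fun v _ => (hG0 v).eventually_lt_const (by positivity)
  set h : ℕ → E → ℂ := fun n x => ((φ x * (w n x + A) : ℝ) : ℂ) with hh
  have hm : ∀ n, AEStronglyMeasurable (h n) := fun n =>
    (Complex.measurable_ofReal.comp
      (hφ.measurable.mul ((hw n).add_const A))).aestronglyMeasurable
  have hb : ∀ n x, ‖h n x‖ ≤ 2 * A * ‖φ x‖ := fun n x => by
    rw [hh, Complex.norm_real, norm_mul, mul_comm]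
    gcongr
    rw [Real.norm_eq_abs, abs_le]
    have := abs_le.1 (hwA n x)
    constructor <;> linarith
  have hi : ∀ n, Integrable (h n) := fun n =>
    (hφi.norm.const_mul (2 * A)).mono' (hm n) (Filter.Eventually.of_forall (hb n))
  have h2 : ∀ n, MemLp (h n) 2 := fun n =>
    (hφ2.norm.const_mul (2 * A)).mono (hm n) (Filter.Eventually.of_forall fun x =>
      (hb n x).trans (le_abs_self _))
  have hL : ∀ n, ∫ x, ‖h n x‖ ≤ ∫ x, 2 * A * ‖φ x‖ := fun n =>
    integral_mono (hi n).norm (hφi.norm.const_mul (2 * A)) (hb n)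
  have hcv : ∀ k, CauchySeq fun n => 𝓕 (h n) k := fun k => by
    have e : ∀ n, 𝓕 (h n) k = 𝓕 (fun x => ((φ x * w n x : ℝ) : ℂ)) k
        + 𝓕 (fun x => ((φ x * A : ℝ) : ℂ)) k := fun n => by
      have hwi : Integrable fun x => ((φ x * w n x : ℝ) : ℂ) :=
        (hφi.mul_bdd (c := A) (hw n).aestronglyMeasurable (Filter.Eventually.of_forall fun x => by
          simpa using hwA n x)).ofReal
      have hAi : Integrable fun x => ((φ x * A : ℝ) : ℂ) := (hφi.mul_const A).ofReal
      simp only [Real.fourier_eq]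
      rw [← integral_add ((Real.fourierIntegral_convergent_iff k).2 hwi)
        ((Real.fourierIntegral_convergent_iff k).2 hAi)]
      congr 1; ext x
      rw [← smul_add, hh]
      push_cast
      ring_nf
    simp_rw [e]
    exact (hconv k).add_const
  have hhigh : ∀ᶠ n in Filter.atTop,
      ∫ k, (1 - exp (-ρ ^ 2 * ‖k‖ ^ 2)) * ‖𝓕 (h n) k‖ ^ 2 ≤ η / 5 := by
    filter_upwards [hev] with n hn
    have key := integral_one_sub_exp_mul_norm_sq_fourier_le hA (pow_pos hρ0 2)
      (by positivity : 0 ≤ η / (40 * A * (S + 1))) hφ hφi hφ2 (hw n) (hwA n) ha.continuous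
      (fun v => (hg v).continuous) hdir (β := β) (fun v hv σ hσ hσr => by
        have hΦ : ∀ x, ‖entropyFlux A φ (w n) (g v) a x‖ ≤ Cφ * ∫ c in (-A)..A, ‖g v c • a c‖ :=
          fun x => (norm_entropyFlux_le (hwA n) (hg v).continuous ha.continuous x).trans
            (mul_le_mul_of_nonneg_right (hCφ x) (intervalIntegral.integral_nonneg
              (by linarith) fun _ _ => norm_nonneg _))
        refine (integral_heatWeight_mul_norm_fourierPairing_sq_le hσ hσr
          (integrable_entropyFlux hφ hφi (hw n) (hwA n) (hg v).continuous ha.continuous) hΦ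
          (hG v n) (hG2 v n) (hM v n) (heq v n)).trans ?_
        rw [Real.sqrt_sq hρ0.le]
        have i1 := (hn v hv).le
        have i2 : Cφ * (∫ c in (-A)..A, ‖g v c • a c‖) * K * ∫ y, ‖M v n y‖ ≤ Dt := by
          have hC0 : 0 ≤ Cφ * ∫ c in (-A)..A, ‖g v c • a c‖ := (norm_nonneg _).trans (hΦ 0)
          have hK0 : 0 ≤ K := integral_nonneg fun z => gaussGradKernel_nonneg one_pos z
          calc _ ≤ D v := mul_le_mul_of_nonneg_left (hMC v n) (mul_nonneg hC0 hK0)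
            _ ≤ |D v| := le_abs_self _
            _ ≤ Dt := Finset.single_le_sum (f := fun v => |D v|) (fun _ _ => abs_nonneg _) hv
        have i3 : 4 * ρ * (Cφ * (∫ c in (-A)..A, ‖g v c • a c‖) * K * ∫ y, ‖M v n y‖)
            ≤ β / 2 := by
          calc _ ≤ 4 * ρ * (Dt + 1) := by gcongr; linarith
            _ = β / 2 := by rw [hρ]; field_simp; norm_num
        linarith)
    refine key.trans ?_
    have j1 : 2 * (s.card * β) ≤ η / 20 := by
      rw [hβ, show (2 : ℝ) * (s.card * (η / (40 * (s.card + 1))))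
        = (η / 20) * (s.card / (s.card + 1)) by field_simp; ring]
      refine mul_le_of_le_one_right (by positivity) ?_
      rw [div_le_one (by positivity)]; linarith
    have j2 : 2 * (η / (40 * A * (S + 1))) * (2 * A * S) ≤ η / 10 := by
      rw [show 2 * (η / (40 * A * (S + 1))) * (2 * A * S) = (η / 10) * (S / (S + 1)) by
        field_simp; ring]
      refine mul_le_of_le_one_right (by positivity) ?_
      rw [div_le_one (by positivity)]; linarith
    linarith
  obtain ⟨N, hN⟩ := eventually_integral_norm_sq_sub_le (pow_pos hρ0 2)
    (by positivity : 0 < η / 5) hi h2 hL hcv hhigh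
  refine ⟨N, fun n hn m hm => ?_⟩
  have := hN n hn m hm
  rw [mul_div_cancel₀ _ (by norm_num)] at this
  refine Eq.trans_le ?_ this
  congr 1; ext x
  rw [hh, ← Complex.ofReal_sub, Complex.norm_real, Real.norm_eq_abs, sq_abs]
  ring

end AveragingCompactness

section MaximumPrinciple

theorem IsLocalMax.deriv_deriv_nonpos {h : ℝ → ℝ} {x : ℝ} (hm : IsLocalMax h x)
    (hc : ContinuousAt h x) : deriv (deriv h) x ≤ 0 := by
  by_contra! hpos
  have hmin := isLocalMin_of_deriv_deriv_pos hpos hm.deriv_eq_zero hc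
  have heq : h =ᶠ[nhds x] fun _ => h x := by
    filter_upwards [hm, hmin] with y h1 h2 using le_antisymm h1 h2
  have h2 : deriv h =ᶠ[nhds x] fun _ => 0 := by
    filter_upwards [heq.deriv] with y hy
    rw [hy, deriv_const]
  rw [h2.deriv_eq, deriv_const] at hpos
  exact lt_irrefl _ hpos

variable {d : ℕ}

theorem hasDerivAt_comp_add_smul_single {v : (Fin d → ℝ) → ℝ} {x : Fin d → ℝ} (j : Fin d)
    {s : ℝ} (hv : DifferentiableAt ℝ v (x + s • Pi.single j 1)) :
    HasDerivAt (fun r : ℝ => v (x + r • Pi.single j 1)) (pderiv' v j (x + s • Pi.single j 1))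
      s := by
  have h1 : HasDerivAt (fun r : ℝ => x + r • (Pi.single j 1 : Fin d → ℝ)) (Pi.single j 1) s := by
    simpa using ((hasDerivAt_id s).smul_const (Pi.single j (1 : ℝ) : Fin d → ℝ)).const_add x
  exact hv.hasFDerivAt.comp_hasDerivAt s h1

theorem pderiv'_pderiv'_nonpos_of_isLocalMax {v : (Fin d → ℝ) → ℝ} {x : Fin d → ℝ} (j : Fin d)
    (hv : ∀ᶠ y in nhds x, DifferentiableAt ℝ v y) (hv2 : DifferentiableAt ℝ (pderiv' v j) x)
    (hm : IsLocalMax v x) : pderiv' (pderiv' v j) j x ≤ 0 := by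
  have hcont : Filter.Tendsto (fun s : ℝ => x + s • (Pi.single j 1 : Fin d → ℝ)) (nhds 0)
      (nhds x) := by
    have : Continuous fun s : ℝ => x + s • (Pi.single j 1 : Fin d → ℝ) := by fun_prop
    simpa using this.tendsto 0
  set h : ℝ → ℝ := fun s => v (x + s • Pi.single j 1) with hh
  have hmax : IsLocalMax h 0 := by
    have := hcont.eventually hm
    simpa [IsLocalMax, IsMaxFilter, hh] using this
  have hd : ∀ᶠ s in nhds (0 : ℝ), deriv h s = pderiv' v j (x + s • Pi.single j 1) := by
    filter_upwards [hcont.eventually hv] with s hs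
    exact (hasDerivAt_comp_add_smul_single j hs).deriv
  have hd2 : deriv (deriv h) 0 = pderiv' (pderiv' v j) j x := by
    rw [Filter.EventuallyEq.deriv_eq hd]
    have := hasDerivAt_comp_add_smul_single (v := pderiv' v j) (x := x) j (s := 0)
      (by simpa using hv2)
    simpa using this.deriv
  rw [← hd2]
  refine hmax.deriv_deriv_nonpos ?_
  have := hasDerivAt_comp_add_smul_single (v := v) (x := x) j (s := 0)
      (by simpa using hv.self_of_nhds)
  exact this.continuousAt

theorem le_of_parabolic_maximum {Ω : Set (Fin d → ℝ)} (hΩ : IsOpen Ω)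
    (hbd : Bornology.IsBounded Ω) {T A : ℝ} {v : (Fin d → ℝ) → ℝ → ℝ}
    (hc : ContinuousOn (fun p : (Fin d → ℝ) × ℝ => v p.1 p.2) (closure Ω ×ˢ Icc 0 T))
    (hdt : ∀ x ∈ Ω, ∀ t ∈ Ioo 0 T, DifferentiableAt ℝ (v x) t)
    (hmax : ∀ x ∈ Ω, ∀ t ∈ Ioo 0 T, IsLocalMax (fun y => v y t) x → deriv (v x) t ≤ 0)
    (hbc : ∀ x ∈ frontier Ω, ∀ t ∈ Ioo 0 T, v x t ≤ A) (hic : ∀ x ∈ Ω, v x 0 ≤ A)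
    {x : Fin d → ℝ} (hx : x ∈ Ω) {t : ℝ} (ht : t ∈ Ioo 0 T) : v x t ≤ A := by
  by_contra! hlt
  obtain ⟨κ, hκ, hκ2⟩ : ∃ κ > 0, A < v x t - κ * t := by
    refine ⟨(v x t - A) / (2 * t), div_pos (by linarith) (by linarith [ht.1]), ?_⟩
    have : (v x t - A) / (2 * t) * t = (v x t - A) / 2 := by
      have := ht.1.ne'
      field_simp
    linarith
  have hK : IsCompact (closure Ω ×ˢ Icc 0 t) := hbd.isCompact_closure.prod isCompact_Icc
  have hsub : closure Ω ×ˢ Icc 0 t ⊆ closure Ω ×ˢ Icc 0 T :=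
    prod_mono le_rfl (Icc_subset_Icc_right ht.2.le)
  obtain ⟨⟨y, s⟩, ⟨hy, hs⟩, hys⟩ := hK.exists_isMaxOn
    ⟨(x, t), subset_closure hx, ⟨ht.1.le, le_rfl⟩⟩
    (f := fun p : (Fin d → ℝ) × ℝ => v p.1 p.2 - κ * p.2)
    ((hc.mono hsub).sub (by fun_prop))
  replace hys : ∀ z ∈ closure Ω, ∀ r ∈ Icc 0 t, v z r - κ * r ≤ v y s - κ * s :=
    fun z hz r hr => isMaxOn_iff.1 hys (z, r) ⟨hz, hr⟩
  have hval : A < v y s - κ * s :=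
    hκ2.trans_le (hys x (subset_closure hx) t ⟨ht.1.le, le_rfl⟩)
  have hκs : 0 ≤ κ * s := mul_nonneg hκ.le hs.1
  have hvA : A < v y s := by linarith
  rcases hs.1.eq_or_lt with h0 | h0
  · have hcl : ContinuousOn (fun z => v z 0) (closure Ω) :=
      hc.comp (f := fun z => (z, (0 : ℝ))) (by fun_prop)
        fun z hz => ⟨hz, le_rfl, (ht.1.trans ht.2).le⟩
    have := le_on_closure hic hcl continuousOn_const hy
    rw [h0] at this
    linarith
  · have hsT : s ∈ Ioo 0 T := ⟨h0, hs.2.trans_lt ht.2⟩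
    by_cases hyΩ : y ∈ Ω
    · have hloc : IsLocalMax (fun z => v z s) y := by
        filter_upwards [hΩ.mem_nhds hyΩ] with z hz
        have : v z s - κ * s ≤ v y s - κ * s := hys z (subset_closure hz) s hs
        linarith
      have h1 := hmax y hyΩ s hsT hloc
      have h2 : HasDerivAt (fun r => v y r - κ * r) (deriv (v y) s - κ) s := by
        simpa using (hdt y hyΩ s hsT).hasDerivAt.fun_sub ((hasDerivAt_id' s).const_mul κ)
      have h3 : 0 ≤ deriv (v y) s - κ := by
        have h4 := h2.hasDerivWithinAt (s := Iio s)
        have h5 := (hasDerivWithinAt_iff_tendsto_slope' (by simp)).1 h4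
        refine ge_of_tendsto h5 ?_
        have h6 : ∀ᶠ r in nhdsWithin s (Iio s), 0 < r :=
          mem_nhdsWithin_of_mem_nhds (lt_mem_nhds h0)
        filter_upwards [h6, self_mem_nhdsWithin] with r hr hrs
        have h7 : v y r - κ * r ≤ v y s - κ * s := hys y hy r ⟨hr.le, (le_of_lt hrs).trans hs.2⟩
        have hrs' : r < s := hrs
        rw [slope_def_field]
        exact div_nonneg_of_nonpos (by linarith) (by linarith)
      linarith
    · have := hbc y ⟨hy, fun h => hyΩ (interior_subset h)⟩ s hsT
      linarith

theorem pderiv'_comp {g : ℝ → ℝ} {v : (Fin d → ℝ) → ℝ} {x : Fin d → ℝ} (j : Fin d)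
    (hg : DifferentiableAt ℝ g (v x)) (hv : DifferentiableAt ℝ v x) :
    pderiv' (fun y => g (v y)) j x = deriv g (v x) * pderiv' v j x := by
  have h := (hg.hasDerivAt.comp_hasFDerivAt x hv.hasFDerivAt).fderiv
  have h' : fderiv ℝ (fun y => g (v y)) x = deriv g (v x) • fderiv ℝ v x := h
  simp [pderiv', h']

theorem pderiv'_mul {v w : (Fin d → ℝ) → ℝ} {x : Fin d → ℝ} (j : Fin d)
    (hv : DifferentiableAt ℝ v x) (hw : DifferentiableAt ℝ w x) :
    pderiv' (fun y => v y * w y) j x = v x * pderiv' w j x + w x * pderiv' v j x := by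
  simp [pderiv', fderiv_fun_mul hv hw]

variable {Ω : Set (Fin d → ℝ)} {T ε δ : ℝ} {f : Fin d → ℝ → ℝ} {B : ℝ → ℝ}
  {u₀ : (Fin d → ℝ) → ℝ} {u : (Fin d → ℝ) → ℝ → ℝ}

theorem IsClassicalSolution.deriv_eq (hu : IsClassicalSolution Ω T ε δ f B u₀ u)
    (hf : ∀ j, Differentiable ℝ (f j)) (hB : Differentiable ℝ B)
    {x : Fin d → ℝ} (hx : x ∈ Ω) {t : ℝ} (ht : t ∈ Ioo 0 T) :
    deriv (u x) t + ∑ j, deriv (f j) (u x t) * pderiv' (fun y => u y t) j x =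
      ε * ∑ j, ((B (u x t) + δ) * pderiv' (pderiv' (fun y => u y t) j) j x +
        deriv B (u x t) * pderiv' (fun y => u y t) j x ^ 2) := by
  have hd := hu.diff_x x hx t ht
  have h := hu.pde x hx t ht
  simp only [pderiv'_comp _ (hf _ _) hd] at h
  rw [h]
  congr 1
  refine Finset.sum_congr rfl fun j _ => ?_
  have hBd : DifferentiableAt ℝ (fun y => B (u y t) + δ) x :=
    ((hB _).comp x hd).add_const δ
  rw [pderiv'_mul j hBd (hu.diff_xx j x hx t ht),
    pderiv'_comp (g := fun r => B r + δ) j ((hB _).add_const δ) hd]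
  simp only [deriv_add_const]
  change _ + _ * (_ * _) = _
  ring

theorem IsClassicalSolution.le_of_initial_le (hu : IsClassicalSolution Ω T ε δ f B u₀ u)
    (hΩ : IsOpen Ω) (hbd : Bornology.IsBounded Ω)
    (hf : ∀ j, Differentiable ℝ (f j)) (hB : Differentiable ℝ B) (hB0 : ∀ y, 0 ≤ B y)
    (hε : 0 < ε) (hδ : 0 < δ) {A : ℝ} (hA : 0 ≤ A) (h0 : ∀ x, u₀ x ≤ A)
    {x : Fin d → ℝ} (hx : x ∈ Ω) {t : ℝ} (ht : t ∈ Ioo 0 T) : u x t ≤ A := by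
  refine le_of_parabolic_maximum hΩ hbd hu.cont hu.diff_t ?_ ?_ ?_ hx ht
  · intro y hy s hs hm
    have h := hu.deriv_eq hf hB hy hs
    have hg : ∀ j, pderiv' (fun y => u y s) j y = 0 := fun j => by
      rw [pderiv', hm.fderiv_eq_zero]; rfl
    simp only [hg, mul_zero, Finset.sum_const_zero, add_zero, ne_eq, OfNat.ofNat_ne_zero,
      not_false_eq_true, zero_pow] at h
    rw [h]
    refine mul_nonpos_of_nonneg_of_nonpos hε.le (Finset.sum_nonpos fun j _ => ?_)
    refine mul_nonpos_of_nonneg_of_nonpos (by linarith [hB0 (u y s)]) ?_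
    refine pderiv'_pderiv'_nonpos_of_isLocalMax j ?_ (hu.diff_xx j y hy s hs) hm
    filter_upwards [hΩ.mem_nhds hy] with z hz using hu.diff_x z hz s hs
  · intro y hy s hs
    rw [hu.bc y hy s hs]
    exact hA
  · intro y hy
    rw [hu.ic y hy]
    exact h0 y

theorem pderiv'_neg (v : (Fin d → ℝ) → ℝ) (j : Fin d) (x : Fin d → ℝ) :
    pderiv' (fun y => -v y) j x = -pderiv' v j x := by
  simp [pderiv', fderiv_fun_neg]

/-- Reflecting a solution yields a solution of the reflected equation. -/
theorem IsClassicalSolution.neg (hu : IsClassicalSolution Ω T ε δ f B u₀ u) :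
    IsClassicalSolution Ω T ε δ (fun j y => -f j (-y)) (fun y => B (-y)) (fun x => -u₀ x)
      (fun x t => -u x t) where
  cont := hu.cont.neg
  diff_t x hx t ht := (hu.diff_t x hx t ht).neg
  diff_x x hx t ht := (hu.diff_x x hx t ht).neg
  diff_xx j x hx t ht := by
    simp only [pderiv'_neg]
    exact (hu.diff_xx j x hx t ht).neg
  cont_dt := by
    simp only [deriv.fun_neg]
    exact hu.cont_dt.neg
  cont_dx j := by
    simp only [pderiv'_neg]
    exact (hu.cont_dx j).neg
  cont_dxx i j := by
    have h : ∀ t, pderiv' (fun y => -u y t) j = fun y => -pderiv' (fun y => u y t) j y :=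
      fun t => funext fun y => pderiv'_neg _ j y
    simp only [h, pderiv'_neg]
    exact (hu.cont_dxx i j).neg
  pde x hx t ht := by
    have h := hu.pde x hx t ht
    simp only [neg_neg, deriv.fun_neg, pderiv'_neg, mul_neg, Finset.sum_neg_distrib]
    linarith
  bc x hx t ht := by simp [hu.bc x hx t ht]
  ic x hx := by simp [hu.ic x hx]

theorem IsClassicalSolution.abs_le (hu : IsClassicalSolution Ω T ε δ f B u₀ u)
    (hΩ : IsOpen Ω) (hbd : Bornology.IsBounded Ω)
    (hf : ∀ j, Differentiable ℝ (f j)) (hB : Differentiable ℝ B) (hB0 : ∀ y, 0 ≤ B y)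
    (hε : 0 < ε) (hδ : 0 < δ) {A : ℝ} (hA : 0 ≤ A) (h0 : ∀ x, |u₀ x| ≤ A)
    {x : Fin d → ℝ} (hx : x ∈ Ω) {t : ℝ} (ht : t ∈ Ioo 0 T) : |u x t| ≤ A := by
  refine _root_.abs_le.2 ⟨?_, hu.le_of_initial_le hΩ hbd hf hB hB0 hε hδ hA
    (fun x => (_root_.abs_le.1 (h0 x)).2) hx ht⟩
  have := hu.neg.le_of_initial_le hΩ hbd (fun j => ((hf j).comp differentiable_neg).neg)
    (hB.comp differentiable_neg) (fun y => hB0 _) hε hδ hA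
    (fun x => by linarith [(_root_.abs_le.1 (h0 x)).1]) hx ht
  linarith

end MaximumPrinciple

section WeakFormulation

open scoped RealInnerProductSpace

section IntegrationByParts

variable {V F : Type*} [NormedAddCommGroup V] [NormedAddCommGroup F] [NormedSpace ℝ F]

theorem Continuous.continuous_smul_of_tsupport_subset {O : Set V} (hO : IsOpen O) {g : V → ℝ}
    (hg : ContinuousOn g O) {ψ : V → F} (hψ : Continuous ψ) (hψO : tsupport ψ ⊆ O) :
    Continuous fun x => g x • ψ x := by
  refine continuous_of_tsupport fun x hx => ?_
  have hx' : x ∈ O := hψO (tsupport_smul_subset_right g ψ hx)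
  exact (hg.continuousAt (hO.mem_nhds hx')).smul hψ.continuousAt

variable [MeasurableSpace V] [BorelSpace V] {μ : Measure V}

theorem Continuous.integrable_smul_of_tsupport_subset [IsFiniteMeasureOnCompacts μ] {O : Set V}
    (hO : IsOpen O) {g : V → ℝ} (hg : ContinuousOn g O) {ψ : V → F} (hψ : Continuous ψ)
    (hψs : HasCompactSupport ψ) (hψO : tsupport ψ ⊆ O) : Integrable (fun x => g x • ψ x) μ :=
  (hψ.continuous_smul_of_tsupport_subset hO hg hψO).integrable_of_hasCompactSupport
    hψs.smul_left

theorem integral_smul_fderiv_eq_neg_of_hasLineDerivAt [NormedSpace ℝ V] [FiniteDimensional ℝ V]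
    [μ.IsAddHaarMeasure] {O : Set V} (hO : IsOpen O) {g g' : V → ℝ} {v : V}
    (hg : ContinuousOn g O) (hg' : ContinuousOn g' O)
    (hgg : ∀ x ∈ O, HasLineDerivAt ℝ g (g' x) x v) {ψ : V → F} (hψ : ContDiff ℝ 1 ψ)
    (hψs : HasCompactSupport ψ) (hψO : tsupport ψ ⊆ O) :
    ∫ x, g x • fderiv ℝ ψ x v ∂μ = -∫ x, g' x • ψ x ∂μ := by
  have hc : Continuous fun x => fderiv ℝ ψ x v :=
    (hψ.continuous_fderiv one_ne_zero).clm_apply continuous_const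
  have hs : tsupport (fun x => fderiv ℝ ψ x v) ⊆ tsupport ψ := tsupport_fderiv_apply_subset ℝ v
  have hcs : HasCompactSupport fun x => fderiv ℝ ψ x v := hψs.fderiv_apply ℝ v
  have := integral_bilinear_hasLineDerivAt_right_eq_neg_left_of_integrable (μ := μ) (f := g)
    (f' := g') (g := ψ) (g' := fun x => fderiv ℝ ψ x v) (v := v)
    (B := ContinuousLinearMap.lsmul ℝ ℝ)
    (hψ.continuous.integrable_smul_of_tsupport_subset hO hg' hψs hψO)
    (hc.integrable_smul_of_tsupport_subset hO hg hcs (hs.trans hψO))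
    (hψ.continuous.integrable_smul_of_tsupport_subset hO hg hψs hψO)
    (fun x hx => hgg x (hψO hx))
    (fun x _ => ((hψ.differentiable one_ne_zero x).hasFDerivAt).hasLineDerivAt v)
  simpa using this

end IntegrationByParts

variable {E ι : Type*} [NormedAddCommGroup E] [InnerProductSpace ℝ E] [Fintype ι]

/-- `w` solves `∑ᵢ aᵢ(w) ∂ᵢw = ε ∑_{i ∈ S} ∂ᵢ(β(w) ∂ᵢw)` pointwise on `O`, where `D i` and `H i`
are the first and second partial derivatives of `w` along `b i`. -/
structure IsViscousSolution (b : OrthonormalBasis ι ℝ E) (S : Finset ι) (O : Set E) (a : ℝ → E)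
    (ε : ℝ) (β : ℝ → ℝ) (w : E → ℝ) (D H : ι → E → ℝ) : Prop where
  cont : ContinuousOn w O
  cont_fst : ∀ i, ContinuousOn (D i) O
  cont_snd : ∀ i ∈ S, ContinuousOn (H i) O
  hasLineDerivAt_fst : ∀ i, ∀ x ∈ O, HasLineDerivAt ℝ w (D i x) x (b i)
  hasLineDerivAt_snd : ∀ i ∈ S, ∀ x ∈ O, HasLineDerivAt ℝ (D i) (H i x) x (b i)
  eqn : ∀ x ∈ O, ∑ i, ⟪b i, a (w x)⟫ * D i x =
    ε * ∑ i ∈ S, (β (w x) * H i x + deriv β (w x) * D i x ^ 2)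

/-- The part of the gradient with components `D i` along the diffusive directions `S`. -/
def partialGradient (b : OrthonormalBasis ι ℝ E) (S : Finset ι) (D : ι → E → ℝ) (x : E) : E :=
  ∑ i ∈ S, D i x • b i

theorem norm_sq_partialGradient (b : OrthonormalBasis ι ℝ E) (S : Finset ι) (D : ι → E → ℝ)
    (x : E) : ‖partialGradient b S D x‖ ^ 2 = ∑ i ∈ S, D i x ^ 2 := by
  rw [← real_inner_self_eq_norm_sq, partialGradient, b.orthonormal.inner_sum]
  simp [sq]

namespace IsViscousSolution

variable {b : OrthonormalBasis ι ℝ E} {S : Finset ι} {O : Set E} {a : ℝ → E} {ε : ℝ} {β : ℝ → ℝ}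
  {w : E → ℝ} {D H : ι → E → ℝ}

theorem congr (h : IsViscousSolution b S O a ε β w D H) (hO : IsOpen O) {w' : E → ℝ}
    (hw : EqOn w' w O) : IsViscousSolution b S O a ε β w' D H where
  cont := h.cont.congr hw
  cont_fst := h.cont_fst
  cont_snd := h.cont_snd
  hasLineDerivAt_fst i x hx := (h.hasLineDerivAt_fst i x hx).congr_of_eventuallyEq
    (hw.eventuallyEq_of_mem (hO.mem_nhds hx))
  hasLineDerivAt_snd := h.hasLineDerivAt_snd
  eqn x hx := by rw [hw hx]; exact h.eqn x hx

theorem continuousOn_partialGradient (h : IsViscousSolution b S O a ε β w D H) :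
    ContinuousOn (partialGradient b S D) O := by
  unfold partialGradient
  exact continuousOn_finsetSum _ fun i _ => (h.cont_fst i).smul continuousOn_const

theorem hasLineDerivAt_comp (h : IsViscousSolution b S O a ε β w D H) {x : E} (hx : x ∈ O) (i : ι)
    {q : ℝ → ℝ} {q' : ℝ} (hq : HasDerivAt q q' (w x)) :
    HasLineDerivAt ℝ (fun y => q (w y)) (q' * D i x) x (b i) := by
  have h1 := h.hasLineDerivAt_fst i x hx
  unfold HasLineDerivAt at h1 ⊢
  exact HasDerivAt.comp (h₂ := q) 0 (by simpa using hq) h1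

variable {F : Type*} [NormedAddCommGroup F] [NormedSpace ℝ F]
  [MeasurableSpace E] [BorelSpace E] [FiniteDimensional ℝ E]

/-- The weak form of the entropy balance for the entropy with derivative `g`. -/
theorem integral_fderiv_entropyFlux (h : IsViscousSolution b S O a ε β w D H) (hO : IsOpen O)
    (ha : Continuous a) (hβ : ContDiff ℝ 1 β) {g : ℝ → ℝ} (hg : ContDiff ℝ 1 g) (A : ℝ)
    {ψ : E → F} (hψ : ContDiff ℝ 1 ψ) (hψs : HasCompactSupport ψ) (hψO : tsupport ψ ⊆ O) :
    ∫ x, fderiv ℝ ψ x (∫ c in (-A)..w x, g c • a c) =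
      (∫ x, fderiv ℝ ψ x ((ε * (β (w x) * g (w x))) • partialGradient b S D x)) +
        ∫ x, (ε * (deriv g (w x) * β (w x) * ‖partialGradient b S D x‖ ^ 2)) • ψ x := by
  have hgc := hg.continuous
  have hβc := hβ.continuous
  have hg'c : Continuous (deriv g) := hg.continuous_deriv le_rfl
  have hβ'c : Continuous (deriv β) := hβ.continuous_deriv le_rfl
  have hcd : ∀ i, Continuous fun x => fderiv ℝ ψ x (b i) := fun i =>
    (hψ.continuous_fderiv one_ne_zero).clm_apply continuous_const
  have hsd : ∀ i, tsupport (fun x => fderiv ℝ ψ x (b i)) ⊆ O := fun i =>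
    (tsupport_fderiv_apply_subset ℝ _).trans hψO
  have hcsd : ∀ i, HasCompactSupport fun x => fderiv ℝ ψ x (b i) := fun i =>
    hψs.fderiv_apply ℝ _
  have hint : ∀ i {q : E → ℝ}, ContinuousOn q O → Integrable fun x => q x • fderiv ℝ ψ x (b i) :=
    fun i q hq => (hcd i).integrable_smul_of_tsupport_subset hO hq (hcsd i) (hsd i)
  have hintψ : ∀ {q : E → ℝ}, ContinuousOn q O → Integrable fun x => q x • ψ x :=
    fun hq => hψ.continuous.integrable_smul_of_tsupport_subset hO hq hψs hψO
  set Q : ι → ℝ → ℝ := fun i y => ∫ c in (-A)..y, g c * ⟪b i, a c⟫ with hQ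
  have hQc : ∀ i, Continuous fun c => g c * ⟪b i, a c⟫ := fun i =>
    hgc.mul (continuous_const.inner ha)
  have hQd : ∀ i y, HasDerivAt (Q i) (g y * ⟪b i, a y⟫) y := fun i y =>
    ((hQc i).integral_hasStrictDerivAt _ _).hasDerivAt
  have hQcont : ∀ i, ContinuousOn (fun x => Q i (w x)) O := fun i =>
    (continuous_iff_continuousAt.2 fun y => (hQd i y).continuousAt).comp_continuousOn h.cont
  have hexp : ∀ x, fderiv ℝ ψ x (∫ c in (-A)..w x, g c • a c) =
      ∑ i, Q i (w x) • fderiv ℝ ψ x (b i) := fun x => by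
    have h1 : (∫ c in (-A)..w x, g c • a c) = ∑ i, Q i (w x) • b i := by
      rw [← b.sum_repr' (∫ c in (-A)..w x, g c • a c)]
      refine Finset.sum_congr rfl fun i _ => ?_
      congr 1
      have := (innerSL ℝ (b i)).intervalIntegral_comp_comm (f := fun c => g c • a c)
        ((hgc.smul ha).intervalIntegrable (-A) (w x) (μ := volume))
      simp only [innerSL_apply_apply, inner_smul_right] at this
      exact this.symm
    rw [h1, map_sum]
    simp only [map_smul]
  have hexp2 : ∀ x, fderiv ℝ ψ x ((ε * (β (w x) * g (w x))) • partialGradient b S D x) =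
      ∑ i ∈ S, (ε * (β (w x) * g (w x) * D i x)) • fderiv ℝ ψ x (b i) := fun x => by
    rw [partialGradient, Finset.smul_sum, map_sum]
    refine Finset.sum_congr rfl fun i _ => ?_
    rw [smul_smul, map_smul]
    ring_nf
  have hβgc : ∀ i, ContinuousOn (fun x => β (w x) * g (w x) * D i x) O := fun i =>
    ((hβc.comp_continuousOn h.cont).mul (hgc.comp_continuousOn h.cont)).mul (h.cont_fst i)
  have hfirst : ∀ i, ∫ x, Q i (w x) • fderiv ℝ ψ x (b i) =
      -∫ x, (g (w x) * ⟪b i, a (w x)⟫ * D i x) • ψ x := fun i => by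
    refine integral_smul_fderiv_eq_neg_of_hasLineDerivAt hO (hQcont i) ?_
      (fun x hx => h.hasLineDerivAt_comp hx i (hQd i _)) hψ hψs hψO
    exact ((hQc i).comp_continuousOn h.cont).mul (h.cont_fst i)
  have hD1 : ∀ i, ContinuousOn (fun x => g (w x) * ⟪b i, a (w x)⟫ * D i x) O := fun i =>
    ((hQc i).comp_continuousOn h.cont).mul (h.cont_fst i)
  have hD2 : ∀ i ∈ S, ContinuousOn (fun x => ε * ((deriv β (w x) * g (w x) +
      β (w x) * deriv g (w x)) * D i x * D i x + β (w x) * g (w x) * H i x)) O := fun i hi => by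
    have h1 := hβc.comp_continuousOn h.cont
    have h2 := hgc.comp_continuousOn h.cont
    have h3 := hβ'c.comp_continuousOn h.cont
    have h4 := hg'c.comp_continuousOn h.cont
    have h5 := h.cont_fst i
    have h6 := h.cont_snd i hi
    exact continuousOn_const.fun_mul
      (((((h3.mul h2).add (h1.mul h4)).mul h5).mul h5).add ((h1.mul h2).mul h6))
  have hsecond : ∀ i ∈ S, ∫ x, (ε * (β (w x) * g (w x) * D i x)) • fderiv ℝ ψ x (b i) =
      -∫ x, (ε * ((deriv β (w x) * g (w x) + β (w x) * deriv g (w x)) * D i x * D i x +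
        β (w x) * g (w x) * H i x)) • ψ x := fun i hi => by
    refine integral_smul_fderiv_eq_neg_of_hasLineDerivAt hO (continuousOn_const.mul (hβgc i))
      (hD2 i hi) (fun x hx => ?_) hψ hψs hψO
    have h1 := h.hasLineDerivAt_comp hx i
      (((hβ.differentiable one_ne_zero (w x)).hasDerivAt).mul
        (hg.differentiable one_ne_zero (w x)).hasDerivAt)
    have h2 := h.hasLineDerivAt_snd i hi x hx
    unfold HasLineDerivAt at h1 h2 ⊢
    have h3 := (HasDerivAt.fun_mul h1 h2).const_mul ε
    simp only [zero_smul, add_zero, Pi.mul_apply] at h3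
    exact h3
  simp_rw [hexp, hexp2]
  rw [integral_finsetSum _ fun i _ => hint i (hQcont i),
    integral_finsetSum _ fun i _ => hint i (continuousOn_const.fun_mul (hβgc i)),
    Finset.sum_congr rfl fun i _ => hfirst i, Finset.sum_congr rfl fun i hi => hsecond i hi,
    Finset.sum_neg_distrib, Finset.sum_neg_distrib,
    ← integral_finsetSum _ fun i _ => hintψ (hD1 i),
    ← integral_finsetSum _ fun i hi => hintψ (hD2 i hi), neg_eq_iff_eq_neg, neg_add, neg_neg,
    ← sub_eq_add_neg, ← integral_sub]
  · refine integral_congr_ae (Filter.Eventually.of_forall fun x => ?_)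
    by_cases hx : x ∈ O
    · simp only
      rw [← Finset.sum_smul, ← Finset.sum_smul, ← sub_smul]
      congr 1
      have := h.eqn x hx
      rw [norm_sq_partialGradient]
      have e1 : ∑ i, g (w x) * ⟪b i, a (w x)⟫ * D i x =
          g (w x) * ∑ i, ⟪b i, a (w x)⟫ * D i x := by
        rw [Finset.mul_sum]
        exact Finset.sum_congr rfl fun i _ => by ring
      rw [e1, this, Finset.mul_sum, Finset.mul_sum, Finset.mul_sum, Finset.mul_sum,
        ← Finset.sum_sub_distrib]
      exact Finset.sum_congr rfl fun i _ => by ring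
    · have : ψ x = 0 := image_eq_zero_of_notMem_tsupport fun hx' => hx (hψO hx')
      simp [this]
  · exact integrable_finsetSum _ fun i hi => hintψ (hD2 i hi)
  · refine hintψ (continuousOn_const.mul ?_)
    exact ((hg'c.comp_continuousOn h.cont).mul (hβc.comp_continuousOn h.cont)).mul
      (h.continuousOn_partialGradient.norm.pow 2)

end IsViscousSolution

end WeakFormulation

section ViscousEstimates

open FourierTransform Real
open scoped RealInnerProductSpace

section

variable {V F : Type*} [NormedAddCommGroup V] [NormedSpace ℝ V] [NormedAddCommGroup F]
  [NormedSpace ℝ F]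

theorem support_clm_apply_subset (L : V → V →L[ℝ] F) (v : V → V) :
    Function.support (fun x => L x (v x)) ⊆ Function.support L := fun x hx h0 => hx (by simp [h0])

theorem Continuous.continuous_clm_apply_of_tsupport_subset {O : Set V} (hO : IsOpen O) {v : V → V}
    (hv : ContinuousOn v O) {L : V → V →L[ℝ] F} (hL : Continuous L) (hLO : tsupport L ⊆ O) :
    Continuous fun x => L x (v x) := by
  refine continuous_of_tsupport fun x hx => ?_
  exact hL.continuousAt.clm_apply
    (hv.continuousAt (hO.mem_nhds (hLO (closure_mono (support_clm_apply_subset L v) hx))))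

theorem Continuous.integrable_clm_apply_of_tsupport_subset [MeasurableSpace V] [BorelSpace V]
    {μ : Measure V} [IsFiniteMeasureOnCompacts μ] {O : Set V} (hO : IsOpen O) {v : V → V}
    (hv : ContinuousOn v O) {L : V → V →L[ℝ] F} (hL : Continuous L) (hLs : HasCompactSupport L)
    (hLO : tsupport L ⊆ O) : Integrable (fun x => L x (v x)) μ :=
  (hL.continuous_clm_apply_of_tsupport_subset hO hv hLO).integrable_of_hasCompactSupport
    (hLs.mono (support_clm_apply_subset L v))

end

variable {E ι : Type*} [NormedAddCommGroup E] [InnerProductSpace ℝ E] [Fintype ι]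

theorem norm_integral_smul_le {A Cg Ca : ℝ} {g : ℝ → ℝ} {a : ℝ → E} (hA : 0 ≤ A)
    (hg : ∀ c, |c| ≤ A → |g c| ≤ Cg) (ha : ∀ c, ‖a c‖ ≤ Ca) {y : ℝ} (hy : |y| ≤ A) :
    ‖∫ c in (-A)..y, g c • a c‖ ≤ Cg * Ca * (2 * A) := by
  have hCg : 0 ≤ Cg := (abs_nonneg _).trans (hg 0 (by simpa using hA))
  have hCa : 0 ≤ Ca := (norm_nonneg _).trans (ha 0)
  have hy' := abs_le.1 hy
  refine (intervalIntegral.norm_integral_le_of_norm_le_const (C := Cg * Ca) fun c hc => ?_).trans ?_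
  · rw [uIoc_of_le hy'.1] at hc
    rw [norm_smul, Real.norm_eq_abs]
    exact mul_le_mul (hg c (abs_le.2 ⟨hc.1.le, hc.2.trans hy'.2⟩)) (ha c) (norm_nonneg _) hCg
  · refine mul_le_mul_of_nonneg_left ?_ (mul_nonneg hCg hCa)
    rw [abs_of_nonneg (by linarith)]
    linarith

namespace IsViscousSolution

variable {b : OrthonormalBasis ι ℝ E} {S : Finset ι} {O : Set E} {a : ℝ → E} {ε : ℝ} {β : ℝ → ℝ}
  {w : E → ℝ} {D H : ι → E → ℝ}

theorem continuousOn_entropyFlux [FiniteDimensional ℝ E] (h : IsViscousSolution b S O a ε β w D H)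
    (ha : Continuous a) {g : ℝ → ℝ} (hg : Continuous g) (A : ℝ) :
    ContinuousOn (fun x => ∫ c in (-A)..w x, g c • a c) O :=
  (continuous_iff_continuousAt.2 fun y =>
    ((hg.smul ha).integral_hasStrictDerivAt (-A) y).hasDerivAt.continuousAt).comp_continuousOn
      h.cont

theorem continuousOn_dissipation (h : IsViscousSolution b S O a ε β w D H)
    (hβ : Continuous β) {g : ℝ → ℝ} (hg : Continuous g) :
    ContinuousOn (fun x => ε * (g (w x) * β (w x) * ‖partialGradient b S D x‖ ^ 2)) O :=
  continuousOn_const.mul (((hg.comp_continuousOn h.cont).mul (hβ.comp_continuousOn h.cont)).mul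
    (h.continuousOn_partialGradient.norm.pow 2))

theorem continuousOn_viscousFlux (h : IsViscousSolution b S O a ε β w D H)
    (hβ : Continuous β) {g : ℝ → ℝ} (hg : Continuous g) :
    ContinuousOn (fun x => (ε * (β (w x) * g (w x))) • partialGradient b S D x) O :=
  (continuousOn_const.mul ((hβ.comp_continuousOn h.cont).mul (hg.comp_continuousOn h.cont))).smul
    h.continuousOn_partialGradient

variable [MeasurableSpace E] [BorelSpace E] [FiniteDimensional ℝ E]

theorem integral_dissipation_le (h : IsViscousSolution b S O a ε β w D H) (hO : IsOpen O)
    (ha : Continuous a) (hβ : ContDiff ℝ 1 β) {A Ca Cβ : ℝ} (hA : 0 ≤ A) (hCa : ∀ c, ‖a c‖ ≤ Ca)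
    (hβ0 : ∀ y, 0 ≤ β y) (hCβ : ∀ y, β y ≤ Cβ) (hε : 0 ≤ ε) (hε1 : ε ≤ 1)
    (hw : ∀ x ∈ O, |w x| ≤ A) {θ : E → ℝ} (hθ : ContDiff ℝ 1 θ) (hθs : HasCompactSupport θ)
    (hθO : tsupport θ ⊆ O) :
    ∫ x, (ε * (β (w x) * ‖partialGradient b S D x‖ ^ 2)) * θ x ^ 2 ≤
      2 * ∫ x, (2 * |θ x| * ‖fderiv ℝ θ x‖ * (A * Ca * (2 * A)) +
        2 * Cβ * A ^ 2 * ‖fderiv ℝ θ x‖ ^ 2) := by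
  have hψ : ContDiff ℝ 1 fun x => θ x ^ 2 := hθ.pow 2
  have hsup : Function.support (fun x => θ x ^ 2) ⊆ Function.support θ := fun x hx h0 =>
    hx (by simp [h0])
  have hψs : HasCompactSupport fun x => θ x ^ 2 := hθs.mono hsup
  have hψO : tsupport (fun x => θ x ^ 2) ⊆ O := (closure_mono hsup).trans hθO
  have hψd : ∀ x v, fderiv ℝ (fun x => θ x ^ 2) x v = 2 * θ x * fderiv ℝ θ x v := fun x v => by
    rw [fderiv_fun_pow 2 (hθ.differentiable one_ne_zero x)]
    simp
  have hdc : Continuous (fderiv ℝ fun x => θ x ^ 2) := hψ.continuous_fderiv one_ne_zero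
  have hdO : tsupport (fderiv ℝ fun x => θ x ^ 2) ⊆ O := (tsupport_fderiv_subset ℝ).trans hψO
  have hid := h.integral_fderiv_entropyFlux hO ha hβ (g := fun y => y) contDiff_id A hψ hψs hψO
  have i1 := hdc.integrable_clm_apply_of_tsupport_subset (μ := volume) hO
    (h.continuousOn_entropyFlux ha continuous_id A) (hψs.fderiv ℝ) hdO
  have i2 := hdc.integrable_clm_apply_of_tsupport_subset (μ := volume) hO
    (h.continuousOn_viscousFlux hβ.continuous continuous_id) (hψs.fderiv ℝ) hdO
  have i3 := hψ.continuous.integrable_smul_of_tsupport_subset (μ := volume) hO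
    (h.continuousOn_dissipation hβ.continuous (g := fun _ => 1) continuous_const) hψs hψO
  have hθc := hθ.continuous
  have hθ'c := hθ.continuous_fderiv one_ne_zero
  have i4 : Integrable fun x => 2 * |θ x| * ‖fderiv ℝ θ x‖ * (A * Ca * (2 * A)) +
      2 * Cβ * A ^ 2 * ‖fderiv ℝ θ x‖ ^ 2 := by
    refine Continuous.integrable_of_hasCompactSupport (by fun_prop)
      ((hθs.fderiv ℝ).mono fun x hx h0 => hx (by simp [h0]))
  simp only [smul_eq_mul, one_mul, id] at i1 i2 i3
  simp only [deriv_id'', one_mul, smul_eq_mul] at hid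
  have hkey : ∫ x, (ε * (β (w x) * ‖partialGradient b S D x‖ ^ 2)) * θ x ^ 2 =
      ∫ x, (fderiv ℝ (fun x => θ x ^ 2) x (∫ c in (-A)..w x, c • a c) -
        fderiv ℝ (fun x => θ x ^ 2) x ((ε * (β (w x) * w x)) • partialGradient b S D x)) := by
    rw [integral_sub i1 i2]
    linarith
  have hle : ∫ x, (ε * (β (w x) * ‖partialGradient b S D x‖ ^ 2)) * θ x ^ 2 ≤
      ∫ x, ((2 * |θ x| * ‖fderiv ℝ θ x‖ * (A * Ca * (2 * A)) +
        2 * Cβ * A ^ 2 * ‖fderiv ℝ θ x‖ ^ 2) +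
        1 / 2 * ((ε * (β (w x) * ‖partialGradient b S D x‖ ^ 2)) * θ x ^ 2)) := by
    rw [hkey]
    refine integral_mono (i1.sub i2) (i4.add (i3.const_mul _)) fun x => ?_
    simp only [hψd]
    by_cases hx : x ∈ O
    · have hQ := norm_integral_smul_le (g := fun y => y) hA (fun c hc => hc) hCa (hw x hx)
      set Q := ∫ c in (-A)..w x, c • a c
      set P := partialGradient b S D x
      set L := fderiv ℝ θ x
      have h1 : 2 * θ x * L Q ≤ 2 * |θ x| * ‖L‖ * (A * Ca * (2 * A)) := by
        calc 2 * θ x * L Q ≤ |2 * θ x * L Q| := le_abs_self _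
          _ = 2 * |θ x| * ‖L Q‖ := by rw [abs_mul, abs_mul, Real.norm_eq_abs]; simp
          _ ≤ 2 * |θ x| * (‖L‖ * (A * Ca * (2 * A))) := by
            gcongr
            exact (L.le_opNorm Q).trans (by gcongr)
          _ = _ := by ring
      have h2 : -(2 * θ x * L ((ε * (β (w x) * w x)) • P)) ≤
          2 * Cβ * A ^ 2 * ‖L‖ ^ 2 + 1 / 2 * (ε * (β (w x) * ‖P‖ ^ 2) * θ x ^ 2) := by
        have hεβ : 0 ≤ ε * β (w x) := mul_nonneg hε (hβ0 _)
        have hεβ' : ε * β (w x) ≤ Cβ := by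
          nlinarith [hβ0 (w x), hCβ (w x)]
        have h3 : |L P| ≤ ‖L‖ * ‖P‖ := L.le_opNorm P
        have h4 : -(2 * θ x * (w x * L P)) ≤ 2 * A ^ 2 * ‖L‖ ^ 2 + 1 / 2 * (‖P‖ * θ x) ^ 2 := by
          have h5 : -(2 * θ x * (w x * L P)) ≤ 2 * |θ x| * (A * (‖L‖ * ‖P‖)) := by
            calc -(2 * θ x * (w x * L P)) ≤ |-(2 * θ x * (w x * L P))| := le_abs_self _
              _ = 2 * |θ x| * (|w x| * |L P|) := by
                rw [abs_neg, abs_mul, abs_mul, abs_mul]; simp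
              _ ≤ _ := by
                have := hw x hx
                gcongr
          have h6 : (‖P‖ * θ x) ^ 2 = (‖P‖ * |θ x|) ^ 2 := by rw [mul_pow, mul_pow, sq_abs]
          rw [h6]
          nlinarith [sq_nonneg (2 * A * ‖L‖ - ‖P‖ * |θ x|)]
        have h7 := mul_le_mul_of_nonneg_left h4 hεβ
        have h8 : ε * β (w x) * (2 * A ^ 2 * ‖L‖ ^ 2) ≤ Cβ * (2 * A ^ 2 * ‖L‖ ^ 2) :=
          mul_le_mul_of_nonneg_right hεβ' (by positivity)
        rw [map_smul, smul_eq_mul]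
        linarith
      linarith
    · have h1 : θ x = 0 := image_eq_zero_of_notMem_tsupport fun hx' => hx (hθO hx')
      have h2 : fderiv ℝ θ x = 0 := image_eq_zero_of_notMem_tsupport
        fun hx' => hx (hθO (tsupport_fderiv_subset ℝ hx'))
      simp [h1, h2]
  rw [integral_add i4 (i3.const_mul _), integral_const_mul] at hle
  linarith

end IsViscousSolution

end ViscousEstimates

section ViscousFourier

open FourierTransform Real
open scoped RealInnerProductSpace

variable {E ι : Type*} [NormedAddCommGroup E] [InnerProductSpace ℝ E]

theorem contDiff_cexp_inner (k : E) :
    ContDiff ℝ 1 fun x : E => Complex.exp (-(2 * π * ⟪x, k⟫ : ℝ) * Complex.I) := by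
  have : ContDiff ℝ 1 fun x : E => -(2 * π * ⟪x, k⟫ : ℝ) :=
    (contDiff_const.mul (contDiff_id.inner ℝ contDiff_const)).neg
  have h2 : ContDiff ℝ 1 fun x : E => ((-(2 * π * ⟪x, k⟫ : ℝ) : ℝ) : ℂ) :=
    Complex.ofRealCLM.contDiff.comp this
  simp only [Complex.ofReal_neg] at h2
  exact Complex.contDiff_exp.comp (h2.mul contDiff_const)

theorem hasFDerivAt_mul_cexp_inner_apply {φ : E → ℝ} (hφ : ContDiff ℝ 1 φ) (k x v : E) :
    fderiv ℝ (fun x : E => Complex.exp (-(2 * π * ⟪x, k⟫ : ℝ) * Complex.I) * (φ x : ℂ)) x v =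
      Complex.exp (-(2 * π * ⟪x, k⟫ : ℝ) * Complex.I) * (fderiv ℝ φ x v : ℂ) +
        (-(2 * π * Complex.I)) *
          (Complex.exp (-(2 * π * ⟪x, k⟫ : ℝ) * Complex.I) * ((φ x * ⟪k, v⟫ : ℝ) : ℂ)) := by
  have hd := (((contDiff_cexp_inner k).mul (Complex.ofRealCLM.contDiff.comp hφ)).differentiable
    one_ne_zero x).hasFDerivAt.hasLineDerivAt v
  refine hd.lineDeriv.symm.trans (HasLineDerivAt.lineDeriv ?_)
  have h1 : HasDerivAt (fun t : ℝ => φ (x + t • v)) (fderiv ℝ φ x v) 0 :=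
    (hφ.differentiable one_ne_zero x).hasFDerivAt.hasLineDerivAt v
  have h2 : HasDerivAt (fun t : ℝ => -(2 * π * ⟪x + t • v, k⟫ : ℝ)) (-(2 * π * ⟪v, k⟫)) 0 := by
    simp only [inner_add_left, inner_smul_left]
    have := (((hasDerivAt_id' (0 : ℝ)).mul_const ⟪v, k⟫).const_add ⟪x, k⟫).const_mul (2 * π)
    simpa using this.fun_neg
  have h3 := ((h2.ofReal_comp.mul_const Complex.I).cexp).fun_mul h1.ofReal_comp
  unfold HasLineDerivAt
  simp only [Complex.ofReal_neg] at h3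
  refine h3.congr_deriv ?_
  simp only [zero_smul, add_zero, real_inner_comm k v]
  push_cast
  ring

theorem integrable_cexp_inner_mul [MeasurableSpace E] [BorelSpace E] {μ : Measure E} {h : E → ℝ}
    (hh : Integrable h μ) (k : E) :
    Integrable (fun x => Complex.exp (-(2 * π * ⟪x, k⟫ : ℝ) * Complex.I) * (h x : ℂ)) μ := by
  refine hh.ofReal.bdd_mul (c := 1) ?_ (Filter.Eventually.of_forall fun x => ?_)
  · have := (contDiff_cexp_inner k).continuous
    exact (by simpa using this : Continuous _).aestronglyMeasurable
  · rw [← Complex.ofReal_neg, Complex.norm_exp_ofReal_mul_I]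

theorem fourier_ofReal_eq [MeasurableSpace E] [BorelSpace E] [FiniteDimensional ℝ E] (h : E → ℝ)
    (k : E) : 𝓕 (fun x => (h x : ℂ)) k =
      ∫ x, Complex.exp (-(2 * π * ⟪x, k⟫ : ℝ) * Complex.I) * (h x : ℂ) := by
  rw [Real.fourier_eq']
  refine integral_congr_ae (Filter.Eventually.of_forall fun x => ?_)
  simp

variable [Fintype ι]

/-- The `L¹` part of the entropy production localized by `φ`. -/
def viscousRemainder (b : OrthonormalBasis ι ℝ E) (S : Finset ι) (a : ℝ → E) (ε : ℝ) (β : ℝ → ℝ)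
    (w : E → ℝ) (D : ι → E → ℝ) (A : ℝ) (φ : E → ℝ) (g : ℝ → ℝ) (x : E) : ℝ :=
  fderiv ℝ φ x ((ε * (β (w x) * g (w x))) • partialGradient b S D x) +
    (ε * (deriv g (w x) * β (w x) * ‖partialGradient b S D x‖ ^ 2)) * φ x -
    fderiv ℝ φ x (∫ c in (-A)..w x, g c • a c)

/-- The viscous flux localized by `φ`. -/
def viscousFlux (b : OrthonormalBasis ι ℝ E) (S : Finset ι) (ε : ℝ) (β : ℝ → ℝ)
    (w : E → ℝ) (D : ι → E → ℝ) (φ : E → ℝ) (g : ℝ → ℝ) (x : E) : E :=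
  φ x • (ε * (β (w x) * g (w x))) • partialGradient b S D x

theorem hasCompactSupport_viscousFlux {b : OrthonormalBasis ι ℝ E} {S : Finset ι} {ε : ℝ}
    {β : ℝ → ℝ} {w : E → ℝ} {D : ι → E → ℝ} {φ : E → ℝ} (hφs : HasCompactSupport φ) (g : ℝ → ℝ) :
    HasCompactSupport (viscousFlux b S ε β w D φ g) :=
  hφs.smul_right

namespace IsViscousSolution

variable {b : OrthonormalBasis ι ℝ E} {S : Finset ι} {O : Set E} {a : ℝ → E} {ε : ℝ} {β : ℝ → ℝ}
  {w : E → ℝ} {D H : ι → E → ℝ}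

theorem continuous_viscousFlux (h : IsViscousSolution b S O a ε β w D H) (hO : IsOpen O)
    (hβ : Continuous β) {g : ℝ → ℝ} (hg : Continuous g) {φ : E → ℝ} (hφ : Continuous φ)
    (hφO : tsupport φ ⊆ O) : Continuous (viscousFlux b S ε β w D φ g) := by
  have := (ContinuousLinearMap.continuous (ContinuousLinearMap.lsmul ℝ ℝ : ℝ →L[ℝ] E →L[ℝ] E)).comp
    hφ
  refine this.continuous_clm_apply_of_tsupport_subset hO (h.continuousOn_viscousFlux hβ hg) ?_
  exact (closure_mono (Function.support_comp_subset (map_zero _) φ)).trans hφO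

variable [MeasurableSpace E] [BorelSpace E] [FiniteDimensional ℝ E]

theorem integrable_viscousRemainder (h : IsViscousSolution b S O a ε β w D H) (hO : IsOpen O)
    (ha : Continuous a) (hβ : Continuous β) {g : ℝ → ℝ} (hg : ContDiff ℝ 1 g) (A : ℝ)
    {φ : E → ℝ} (hφ : ContDiff ℝ 1 φ) (hφs : HasCompactSupport φ) (hφO : tsupport φ ⊆ O) :
    Integrable (viscousRemainder b S a ε β w D A φ g) := by
  have hdc := hφ.continuous_fderiv one_ne_zero
  have hdO := (tsupport_fderiv_subset ℝ (f := φ)).trans hφO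
  exact ((hdc.integrable_clm_apply_of_tsupport_subset (μ := volume) hO
    (h.continuousOn_viscousFlux hβ hg.continuous) (hφs.fderiv ℝ) hdO).add
    (hφ.continuous.integrable_smul_of_tsupport_subset (μ := volume) hO
      (h.continuousOn_dissipation hβ (hg.continuous_deriv le_rfl)) hφs hφO)).sub
    (hdc.integrable_clm_apply_of_tsupport_subset (μ := volume) hO
      (h.continuousOn_entropyFlux ha hg.continuous A) (hφs.fderiv ℝ) hdO)

theorem fourierPairing_entropyFlux_eq (h : IsViscousSolution b S O a ε β w D H) (hO : IsOpen O)
    (ha : Continuous a) (hβ : ContDiff ℝ 1 β) {g : ℝ → ℝ} (hg : ContDiff ℝ 1 g) (A : ℝ)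
    {φ : E → ℝ} (hφ : ContDiff ℝ 1 φ) (hφs : HasCompactSupport φ) (hφO : tsupport φ ⊆ O) (k : E) :
    fourierPairing (entropyFlux A φ w g a) k = fourierPairing (viscousFlux b S ε β w D φ g) k +
      𝓕 (fun x => (2 * π * Complex.I)⁻¹ * (-viscousRemainder b S a ε β w D A φ g x : ℝ)) k := by
  set e : E → ℂ := fun x => Complex.exp (-(2 * π * ⟪x, k⟫ : ℝ) * Complex.I) with he
  have hec : ContDiff ℝ 1 e := contDiff_cexp_inner k
  have hψ : ContDiff ℝ 1 fun x => e x * (φ x : ℂ) :=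
    hec.mul (Complex.ofRealCLM.contDiff.comp hφ)
  have hsup : Function.support (fun x => e x * (φ x : ℂ)) ⊆ Function.support φ := fun x hx h0 =>
    hx (by simp [h0])
  have hψO : tsupport (fun x => e x * (φ x : ℂ)) ⊆ O := (closure_mono hsup).trans hφO
  have hid := h.integral_fderiv_entropyFlux hO ha hβ hg A hψ (hφs.mono hsup) hψO
  have hdc := hφ.continuous_fderiv one_ne_zero
  have hdO := (tsupport_fderiv_subset ℝ (f := φ)).trans hφO
  have hsplit : ∀ V : E → E, ContinuousOn V O →
      ∫ x, fderiv ℝ (fun x => e x * (φ x : ℂ)) x (V x) =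
        (∫ x, e x * (fderiv ℝ φ x (V x) : ℂ)) +
          -(2 * π * Complex.I) * fourierPairing (fun x => φ x • V x) k := fun V hV => by
    have i1 := hdc.integrable_clm_apply_of_tsupport_subset (μ := volume) hO hV (hφs.fderiv ℝ) hdO
    have i2 : Integrable fun x => φ x * ⟪k, V x⟫ := by
      have := hφ.continuous.integrable_smul_of_tsupport_subset (μ := volume) hO
        (g := fun x => ⟪k, V x⟫) (continuousOn_const.inner hV) hφs hφO
      simpa [mul_comm] using this
    unfold fourierPairing
    rw [fourier_ofReal_eq, ← integral_const_mul, ← integral_add (integrable_cexp_inner_mul i1 k)]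
    · refine integral_congr_ae (Filter.Eventually.of_forall fun x => ?_)
      simp only [he, inner_smul_right]
      exact hasFDerivAt_mul_cexp_inner_apply hφ k x (V x)
    · simp only [inner_smul_right]
      exact (integrable_cexp_inner_mul i2 k).const_mul _
  rw [hsplit _ (h.continuousOn_entropyFlux ha hg.continuous A),
    hsplit _ (h.continuousOn_viscousFlux hβ.continuous hg.continuous)] at hid
  have hR : 𝓕 (fun x => (2 * π * Complex.I)⁻¹ *
      (-viscousRemainder b S a ε β w D A φ g x : ℝ)) k = -(2 * π * Complex.I)⁻¹ *
      ((∫ x, e x * (fderiv ℝ φ x ((ε * (β (w x) * g (w x))) • partialGradient b S D x) : ℂ)) +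
        (∫ x, (ε * (deriv g (w x) * β (w x) * ‖partialGradient b S D x‖ ^ 2)) •
          (e x * (φ x : ℂ))) -
        ∫ x, e x * (fderiv ℝ φ x (∫ c in (-A)..w x, g c • a c) : ℂ)) := by
    have i1 := integrable_cexp_inner_mul (hdc.integrable_clm_apply_of_tsupport_subset
      (μ := volume) hO (h.continuousOn_viscousFlux hβ.continuous hg.continuous)
      (hφs.fderiv ℝ) hdO) k
    have i2 := hψ.continuous.integrable_smul_of_tsupport_subset (μ := volume) hO
      (h.continuousOn_dissipation hβ.continuous (hg.continuous_deriv le_rfl)) (hφs.mono hsup) hψO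
    have i3 := integrable_cexp_inner_mul (hdc.integrable_clm_apply_of_tsupport_subset
      (μ := volume) hO (h.continuousOn_entropyFlux ha hg.continuous A) (hφs.fderiv ℝ) hdO) k
    rw [← integral_add i1 i2, ← integral_sub (i1.fun_add i2) i3, ← integral_const_mul,
      Real.fourier_eq']
    refine integral_congr_ae (Filter.Eventually.of_forall fun x => ?_)
    simp only [viscousRemainder, he, smul_eq_mul, Complex.real_smul]
    push_cast
    ring_nf
  rw [hR]
  have hpi : (2 * π * Complex.I : ℂ) ≠ 0 := Complex.two_pi_I_ne_zero
  have e1 : fourierPairing (fun x => φ x • ∫ c in (-A)..w x, g c • a c) k =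
    fourierPairing (entropyFlux A φ w g a) k := rfl
  have e2 : fourierPairing
      (fun x => φ x • (ε * (β (w x) * g (w x))) • partialGradient b S D x) k =
    fourierPairing (viscousFlux b S ε β w D φ g) k := rfl
  rw [e1, e2] at hid
  refine mul_left_cancel₀ hpi ?_
  rw [mul_add, ← mul_assoc, mul_neg, mul_inv_cancel₀ hpi]
  linear_combination -hid

end IsViscousSolution

end ViscousFourier

section ViscousCompactness

open FourierTransform Real
open scoped RealInnerProductSpace

variable {E ι : Type*} [NormedAddCommGroup E] [InnerProductSpace ℝ E] [Fintype ι]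
  [MeasurableSpace E] [BorelSpace E] [FiniteDimensional ℝ E]

namespace IsViscousSolution

variable {b : OrthonormalBasis ι ℝ E} {S : Finset ι} {O : Set E} {a : ℝ → E} {ε : ℝ} {β : ℝ → ℝ}
  {w : E → ℝ} {D H : ι → E → ℝ}

theorem integral_norm_sq_viscousFlux_le (h : IsViscousSolution b S O a ε β w D H) (hO : IsOpen O)
    (hβ : Continuous β) {A Cβ Cg Cφ K : ℝ} {g : ℝ → ℝ}
    (hβ0 : ∀ y, 0 ≤ β y) (hCβ : ∀ y, β y ≤ Cβ) (hε : 0 ≤ ε) (hw : ∀ x ∈ O, |w x| ≤ A)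
    (hCg : ∀ c, |c| ≤ A → |g c| ≤ Cg) {φ θ : E → ℝ} (hCφ : ∀ x, |φ x| ≤ Cφ)
    (hφO : tsupport φ ⊆ O) (hθ : Continuous θ)
    (hθs : HasCompactSupport θ) (hθO : tsupport θ ⊆ O) (hθφ : ∀ x ∈ tsupport φ, θ x = 1)
    (hK : ∫ x, (ε * (β (w x) * ‖partialGradient b S D x‖ ^ 2)) * θ x ^ 2 ≤ K) :
    ∫ x, ‖viscousFlux b S ε β w D φ g x‖ ^ 2 ≤ ε * (Cφ ^ 2 * Cβ * Cg ^ 2 * K) := by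
  have hCβ0 : 0 ≤ Cβ := (hβ0 0).trans (hCβ 0)
  have hint : Integrable fun x => (ε * (β (w x) * ‖partialGradient b S D x‖ ^ 2)) * θ x ^ 2 := by
    have hs : Function.support (fun x => θ x ^ 2) ⊆ Function.support θ := fun x hx h0 =>
      hx (by simp [h0])
    have := (hθ.pow 2).integrable_smul_of_tsupport_subset (μ := volume) hO
      (h.continuousOn_dissipation hβ (g := fun _ => 1) continuous_const) (hθs.mono hs)
      ((closure_mono hs).trans hθO)
    simpa using this
  calc ∫ x, ‖viscousFlux b S ε β w D φ g x‖ ^ 2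
      ≤ ∫ x, (ε * (Cφ ^ 2 * Cβ * Cg ^ 2)) *
        ((ε * (β (w x) * ‖partialGradient b S D x‖ ^ 2)) * θ x ^ 2) := by
        refine integral_mono_of_nonneg (Filter.Eventually.of_forall fun x => by positivity)
          (hint.const_mul _) (Filter.Eventually.of_forall fun x => ?_)
        by_cases hx : x ∈ tsupport φ
        · have h1 : |g (w x)| ^ 2 ≤ Cg ^ 2 :=
            pow_le_pow_left₀ (abs_nonneg _) (hCg _ (hw x (hφO hx))) 2
          have h2 : |φ x| ^ 2 ≤ Cφ ^ 2 := pow_le_pow_left₀ (abs_nonneg _) (hCφ x) 2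
          have h3 := hβ0 (w x)
          simp only [viscousFlux, norm_smul, Real.norm_eq_abs, hθφ x hx, abs_mul, abs_of_nonneg hε,
            abs_of_nonneg h3]
          calc (|φ x| * (ε * (β (w x) * |g (w x)|) * ‖partialGradient b S D x‖)) ^ 2
              = (|φ x| ^ 2 * β (w x) * |g (w x)| ^ 2) *
                (ε * (ε * (β (w x) * ‖partialGradient b S D x‖ ^ 2))) := by ring
            _ ≤ (Cφ ^ 2 * Cβ * Cg ^ 2) *
                (ε * (ε * (β (w x) * ‖partialGradient b S D x‖ ^ 2))) := by
              gcongr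
              exact hCβ _
            _ = _ := by ring
        · have : φ x = 0 := image_eq_zero_of_notMem_tsupport hx
          have h3 := hβ0 (w x)
          simp only [viscousFlux, this, zero_smul, norm_zero, ne_eq, OfNat.ofNat_ne_zero,
            not_false_eq_true, zero_pow]
          positivity
    _ = (ε * (Cφ ^ 2 * Cβ * Cg ^ 2)) *
        ∫ x, (ε * (β (w x) * ‖partialGradient b S D x‖ ^ 2)) * θ x ^ 2 := integral_const_mul _ _
    _ ≤ (ε * (Cφ ^ 2 * Cβ * Cg ^ 2)) * K := by gcongr
    _ = _ := by ring

theorem integral_abs_viscousRemainder_le (h : IsViscousSolution b S O a ε β w D H) (hO : IsOpen O)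
    (hβ : Continuous β) {A Ca Cβ Cg Cg' Cφ K : ℝ} {g : ℝ → ℝ} (hA : 0 ≤ A)
    (hCa : ∀ c, ‖a c‖ ≤ Ca) (hβ0 : ∀ y, 0 ≤ β y) (hCβ : ∀ y, β y ≤ Cβ) (hε : 0 ≤ ε) (hε1 : ε ≤ 1)
    (hw : ∀ x ∈ O, |w x| ≤ A) (hCg : ∀ c, |c| ≤ A → |g c| ≤ Cg)
    (hCg' : ∀ c, |c| ≤ A → |deriv g c| ≤ Cg') {φ θ : E → ℝ} (hφ : ContDiff ℝ 1 φ)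
    (hφs : HasCompactSupport φ) (hCφ : ∀ x, |φ x| ≤ Cφ) (hφO : tsupport φ ⊆ O)
    (hθ : Continuous θ) (hθs : HasCompactSupport θ) (hθO : tsupport θ ⊆ O)
    (hθφ : ∀ x ∈ tsupport φ, θ x = 1)
    (hK : ∫ x, (ε * (β (w x) * ‖partialGradient b S D x‖ ^ 2)) * θ x ^ 2 ≤ K) :
    ∫ x, |viscousRemainder b S a ε β w D A φ g x| ≤
      (∫ x, (Cg * (1 / 2 * (Cβ * ‖fderiv ℝ φ x‖ ^ 2)) +
        ‖fderiv ℝ φ x‖ * (Cg * Ca * (2 * A)))) + (Cg / 2 + Cg' * Cφ) * K := by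
  have h0A : |(0 : ℝ)| ≤ A := by simpa using hA
  have hCg0 : 0 ≤ Cg := (abs_nonneg _).trans (hCg 0 h0A)
  have hCg'0 : 0 ≤ Cg' := (abs_nonneg _).trans (hCg' 0 h0A)
  have hCφ0 : 0 ≤ Cφ := (abs_nonneg _).trans (hCφ 0)
  have hCa0 : 0 ≤ Ca := (norm_nonneg _).trans (hCa 0)
  have hCβ0 : 0 ≤ Cβ := (hβ0 0).trans (hCβ 0)
  have hint : Integrable fun x => (ε * (β (w x) * ‖partialGradient b S D x‖ ^ 2)) * θ x ^ 2 := by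
    have hs : Function.support (fun x => θ x ^ 2) ⊆ Function.support θ := fun x hx h0 =>
      hx (by simp [h0])
    have := (hθ.pow 2).integrable_smul_of_tsupport_subset (μ := volume) hO
      (h.continuousOn_dissipation hβ (g := fun _ => 1) continuous_const) (hθs.mono hs)
      ((closure_mono hs).trans hθO)
    simpa using this
  have hφ'c := hφ.continuous_fderiv one_ne_zero
  have hint2 : Integrable fun x => Cg * (1 / 2 * (Cβ * ‖fderiv ℝ φ x‖ ^ 2)) +
        ‖fderiv ℝ φ x‖ * (Cg * Ca * (2 * A)) :=
    Continuous.integrable_of_hasCompactSupport (by fun_prop)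
      ((hφs.fderiv ℝ).mono fun x hx h0 => hx (by simp [h0]))
  calc ∫ x, |viscousRemainder b S a ε β w D A φ g x|
      ≤ ∫ x, ((Cg * (1 / 2 * (Cβ * ‖fderiv ℝ φ x‖ ^ 2)) +
        ‖fderiv ℝ φ x‖ * (Cg * Ca * (2 * A))) + (Cg / 2 + Cg' * Cφ) *
          ((ε * (β (w x) * ‖partialGradient b S D x‖ ^ 2)) * θ x ^ 2)) := by
        refine integral_mono_of_nonneg (Filter.Eventually.of_forall fun x => abs_nonneg _)
          (hint2.add (hint.const_mul _)) (Filter.Eventually.of_forall fun x => ?_)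
        have hβx := hβ0 (w x)
        by_cases hx : x ∈ tsupport φ
        · have hwx := hw x (hφO hx)
          have hQ := norm_integral_smul_le hA hCg hCa hwx
          have h1 := hCg _ hwx
          have h2 := hCg' _ hwx
          have h3 := hCφ x
          simp only [viscousRemainder, hθφ x hx]
          set Q := ∫ c in (-A)..w x, g c • a c
          set P := partialGradient b S D x
          set L := fderiv ℝ φ x
          have e1 : |L ((ε * (β (w x) * g (w x))) • P)| ≤
              Cg * (1 / 2 * (Cβ * ‖L‖ ^ 2) + 1 / 2 * (ε * (β (w x) * ‖P‖ ^ 2))) := by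
            have hεβ : ε * β (w x) ≤ Cβ := by nlinarith [hCβ (w x)]
            calc |L ((ε * (β (w x) * g (w x))) • P)| = |g (w x)| * (ε * β (w x) * |L P|) := by
                  rw [map_smul, smul_eq_mul, abs_mul, abs_mul, abs_mul, abs_of_nonneg hε,
                    abs_of_nonneg hβx]
                  ring
              _ ≤ Cg * (ε * β (w x) * (‖L‖ * ‖P‖)) := by
                gcongr
                exact L.le_opNorm P
              _ ≤ Cg * (ε * β (w x) * (1 / 2 * ‖L‖ ^ 2 + 1 / 2 * ‖P‖ ^ 2)) := by
                gcongr
                nlinarith [sq_nonneg (‖L‖ - ‖P‖)]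
              _ = Cg * (1 / 2 * ((ε * β (w x)) * ‖L‖ ^ 2) +
                  1 / 2 * (ε * (β (w x) * ‖P‖ ^ 2))) := by ring
              _ ≤ _ := by gcongr
          have e2 : |ε * (deriv g (w x) * β (w x) * ‖P‖ ^ 2) * φ x| ≤
              Cg' * Cφ * (ε * (β (w x) * ‖P‖ ^ 2)) := by
            calc |ε * (deriv g (w x) * β (w x) * ‖P‖ ^ 2) * φ x|
                = |deriv g (w x)| * |φ x| * (ε * (β (w x) * ‖P‖ ^ 2)) := by
                  simp only [abs_mul, abs_of_nonneg hε, abs_of_nonneg hβx, abs_pow, abs_norm]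
                  ring
              _ ≤ _ := by gcongr
          have e3 : |L Q| ≤ ‖L‖ * (Cg * Ca * (2 * A)) := (L.le_opNorm Q).trans (by gcongr)
          have e4 := abs_sub (L ((ε * (β (w x) * g (w x))) • P) +
            ε * (deriv g (w x) * β (w x) * ‖P‖ ^ 2) * φ x) (L Q)
          have e5 := abs_add_le (L ((ε * (β (w x) * g (w x))) • P))
            (ε * (deriv g (w x) * β (w x) * ‖P‖ ^ 2) * φ x)
          linarith
        · have h1 : φ x = 0 := image_eq_zero_of_notMem_tsupport hx
          have h2 : fderiv ℝ φ x = 0 := image_eq_zero_of_notMem_tsupport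
            fun hx' => hx (tsupport_fderiv_subset ℝ hx')
          simp only [viscousRemainder, h1, h2]
          simp only [zero_apply, mul_zero, add_zero, sub_zero, abs_zero,
            norm_zero]
          positivity
    _ = (∫ x, (Cg * (1 / 2 * (Cβ * ‖fderiv ℝ φ x‖ ^ 2)) +
          ‖fderiv ℝ φ x‖ * (Cg * Ca * (2 * A)))) + (Cg / 2 + Cg' * Cφ) *
          ∫ x, (ε * (β (w x) * ‖partialGradient b S D x‖ ^ 2)) * θ x ^ 2 := by
        rw [integral_add hint2 (hint.const_mul _), integral_const_mul]
    _ ≤ _ := by gcongr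

end IsViscousSolution

/-- Localized compactness in `L²` for viscous solutions with vanishing viscosity. -/
theorem exists_integral_sq_mul_sub_le_of_isViscousSolution {b : OrthonormalBasis ι ℝ E}
    {S : Finset ι} {O : Set E} (hO : IsOpen O) {a : ℝ → E} (ha : ContDiff ℝ 1 a) {A Ca Cβ : ℝ}
    (hA : 0 < A) (hCa : ∀ c, ‖a c‖ ≤ Ca)
    (hnd : ∀ v : E, ‖v‖ = 1 → volume {c ∈ Icc (-A) A | ⟪v, a c⟫ = 0} = 0)
    {ε : ℕ → ℝ} (hε : ∀ n, 0 ≤ ε n) (hε1 : ∀ n, ε n ≤ 1)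
    (hε0 : Filter.Tendsto ε Filter.atTop (nhds 0)) {β : ℕ → ℝ → ℝ} (hβ : ∀ n, ContDiff ℝ 1 (β n))
    (hβ0 : ∀ n y, 0 ≤ β n y) (hCβ : ∀ n y, β n y ≤ Cβ) {w : ℕ → E → ℝ} {D H : ℕ → ι → E → ℝ}
    (h : ∀ n, IsViscousSolution b S O a (ε n) (β n) (w n) (D n) (H n))
    (hw : ∀ n, Measurable (w n)) (hwA : ∀ n x, |w n x| ≤ A)
    {φ θ : E → ℝ} (hφ : ContDiff ℝ 1 φ) (hφs : HasCompactSupport φ) (hφO : tsupport φ ⊆ O)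
    (hθ : ContDiff ℝ 1 θ) (hθs : HasCompactSupport θ) (hθO : tsupport θ ⊆ O)
    (hθφ : ∀ x ∈ tsupport φ, θ x = 1)
    (hconv : ∀ k, CauchySeq fun n => 𝓕 (fun x => ((φ x * w n x : ℝ) : ℂ)) k)
    {η : ℝ} (hη : 0 < η) :
    ∃ N, ∀ n ≥ N, ∀ m ≥ N, ∫ x, (φ x * (w n x - w m x)) ^ 2 ≤ η := by
  refine exists_integral_sq_mul_sub_le hA ha hnd hφ.continuous hφs hw hwA hconv
    (fun g hg => ?_) hη
  obtain ⟨Cφ, hCφ⟩ := hφ.continuous.bounded_above_of_compact_support hφs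
  obtain ⟨Cg, hCg⟩ := (isCompact_Icc (a := -A) (b := A)).exists_bound_of_continuousOn
    hg.continuous.continuousOn
  obtain ⟨Cg', hCg'⟩ := (isCompact_Icc (a := -A) (b := A)).exists_bound_of_continuousOn
    (hg.continuous_deriv le_rfl).continuousOn
  replace hCg : ∀ c, |c| ≤ A → |g c| ≤ Cg := fun c hc => hCg c (abs_le.1 hc)
  replace hCg' : ∀ c, |c| ≤ A → |deriv g c| ≤ Cg' := fun c hc => hCg' c (abs_le.1 hc)
  have hK := fun n => (h n).integral_dissipation_le hO ha.continuous (hβ n) hA.le hCa (hβ0 n)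
    (hCβ n) (hε n) (hε1 n) (fun x _ => hwA n x) hθ hθs hθO
  set K := 2 * ∫ x, (2 * |θ x| * ‖fderiv ℝ θ x‖ * (A * Ca * (2 * A)) +
        2 * Cβ * A ^ 2 * ‖fderiv ℝ θ x‖ ^ 2)
  have hR := fun n => (h n).integral_abs_viscousRemainder_le hO (hβ n).continuous hA.le hCa (hβ0 n)
    (hCβ n) (hε n) (hε1 n) (fun x _ => hwA n x) hCg hCg' hφ hφs hCφ hφO hθ.continuous hθs hθO hθφ
    (hK n)
  obtain ⟨CR, hR⟩ : ∃ CR, ∀ n, ∫ x, |viscousRemainder b S a (ε n) (β n) (w n) (D n) A φ g x| ≤ CR :=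
    ⟨_, hR⟩
  have hG := fun n => (h n).integral_norm_sq_viscousFlux_le hO (hβ n).continuous
    (hβ0 n) (hCβ n) (hε n) (fun x _ => hwA n x) hCg hCφ hφO hθ.continuous hθs hθO hθφ (hK n)
  have hRi := fun n => (h n).integrable_viscousRemainder hO ha.continuous (hβ n).continuous hg A hφ
    hφs hφO
  have hGc := fun n => (h n).continuous_viscousFlux hO (hβ n).continuous hg.continuous
    hφ.continuous hφO
  refine ⟨‖(2 * π * Complex.I : ℂ)⁻¹‖ * CR, fun n x => (2 * π * Complex.I)⁻¹ *
      (-viscousRemainder b S a (ε n) (β n) (w n) (D n) A φ g x : ℝ),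
    fun n => viscousFlux b S (ε n) (β n) (w n) (D n) φ g,
    fun n => (hRi n).neg.ofReal.const_mul _, fun n => ?_,
    fun n => (hGc n).integrable_of_hasCompactSupport (hasCompactSupport_viscousFlux hφs g),
    fun n => (hGc n).memLp_of_hasCompactSupport (hasCompactSupport_viscousFlux hφs g), ?_,
    fun n k => (h n).fourierPairing_entropyFlux_eq hO ha.continuous (hβ n) hg A hφ hφs hφO k⟩
  · simp only [norm_mul, Complex.norm_real, norm_neg, Real.norm_eq_abs]
    rw [integral_const_mul]
    exact mul_le_mul_of_nonneg_left (hR n) (norm_nonneg _)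
  · refine squeeze_zero (fun n => integral_nonneg fun x => by positivity) hG ?_
    simpa using hε0.mul_const (Cφ ^ 2 * Cβ * Cg ^ 2 * K)

end ViscousCompactness

section WeakCompactness

open FourierTransform Real
open scoped RealInnerProductSpace

theorem exists_strictMono_cauchySeq_inner {H : Type*} [NormedAddCommGroup H]
    [InnerProductSpace ℂ H] [TopologicalSpace.SeparableSpace H] {x : ℕ → H} {C : ℝ}
    (hx : ∀ n, ‖x n‖ ≤ C) :
    ∃ σ : ℕ → ℕ, StrictMono σ ∧ ∀ y, CauchySeq fun n => inner ℂ (x (σ n)) y := by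
  have h := WeakDual.isSeqCompact_closedBall ℂ H 0 C
  obtain ⟨z, -, σ, hσ, hz⟩ := h (x := fun n => StrongDual.toWeakDual (innerSL ℂ (x n)))
    fun n => by simpa using hx n
  refine ⟨σ, hσ, fun y => ?_⟩
  have := (WeakDual.eval_continuous (𝕜 := ℂ) y).continuousAt.tendsto.comp hz
  exact this.cauchySeq

variable {E : Type*} [NormedAddCommGroup E] [InnerProductSpace ℝ E]
  [MeasurableSpace E] [BorelSpace E] [FiniteDimensional ℝ E]

theorem exists_strictMono_cauchySeq_fourier {O : Set E} (hO : MeasurableSet O)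
    (hOv : volume O ≠ ⊤) {A : ℝ} {w : ℕ → E → ℝ} (hw : ∀ n, Measurable (w n))
    (hwA : ∀ n x, |w n x| ≤ A) (hwO : ∀ n x, x ∉ O → w n x = 0) :
    ∃ σ : ℕ → ℕ, StrictMono σ ∧ ∀ φ : E → ℝ, Continuous φ → HasCompactSupport φ →
      ∀ k, CauchySeq fun n => 𝓕 (fun x => ((φ x * w (σ n) x : ℝ) : ℂ)) k := by
  have : Fact ((2 : ENNReal) ≠ ⊤) := ⟨ENNReal.ofNat_ne_top⟩
  have hind : MemLp (O.indicator fun _ => (A : ℂ)) 2 (volume : Measure E) :=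
    memLp_indicator_const 2 hO _ (Or.inr hOv)
  have hA : 0 ≤ A := (abs_nonneg _).trans (hwA 0 0)
  have hle : ∀ n x, ‖((w n x : ℝ) : ℂ)‖ ≤ ‖O.indicator (fun _ => (A : ℂ)) x‖ := fun n x => by
    by_cases hx : x ∈ O
    · simpa [hx, abs_of_nonneg hA] using hwA n x
    · simp [hwO n x hx]
  have hmem : ∀ n, MemLp (fun x => ((w n x : ℝ) : ℂ)) 2 (volume : Measure E) := fun n =>
    hind.mono (Complex.measurable_ofReal.comp (hw n)).aestronglyMeasurable
      (Filter.Eventually.of_forall (hle n))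
  obtain ⟨σ, hσ, hc⟩ := exists_strictMono_cauchySeq_inner (x := fun n => (hmem n).toLp)
    (C := (eLpNorm (O.indicator fun _ => (A : ℂ)) 2 (volume : Measure E)).toReal) fun n => by
      rw [Lp.norm_toLp]
      exact ENNReal.toReal_mono hind.2.ne (eLpNorm_mono (hle n))
  refine ⟨σ, hσ, fun φ hφ hφs k => ?_⟩
  have hy : MemLp (fun x => Complex.exp (-(2 * π * ⟪x, k⟫ : ℝ) * Complex.I) * (φ x : ℂ)) 2
      (volume : Measure E) := by
    refine Continuous.memLp_of_hasCompactSupport ?_ (hφs.mono fun x hx h0 => hx (by simp [h0]))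
    exact (contDiff_cexp_inner k).continuous.mul (Complex.continuous_ofReal.comp hφ)
  convert! hc hy.toLp using 2 with n
  rw [fourier_ofReal_eq, L2.inner_def]
  refine integral_congr_ae ?_
  filter_upwards [(hmem (σ n)).coeFn_toLp, hy.coeFn_toLp] with x h1 h2
  rw [h1, h2, RCLike.inner_apply, Complex.conj_ofReal]
  push_cast
  ring

end WeakCompactness

section GlobalCompactness

open FourierTransform Real Filter
open scoped RealInnerProductSpace

variable {E ι : Type*} [NormedAddCommGroup E] [InnerProductSpace ℝ E] [Fintype ι]
  [MeasurableSpace E] [BorelSpace E] [FiniteDimensional ℝ E]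

theorem exists_contDiff_eq_one_of_isCompact_subset {F : Type*} [NormedAddCommGroup F]
    [NormedSpace ℝ F] [FiniteDimensional ℝ F] {K O : Set F} (hK : IsCompact K) (hO : IsOpen O)
    (hKO : K ⊆ O) :
    ∃ φ : F → ℝ, ContDiff ℝ 1 φ ∧ HasCompactSupport φ ∧ tsupport φ ⊆ O ∧
      ∀ x ∈ K, φ x = 1 := by
  obtain ⟨K', hK', hKK', hK'O⟩ := exists_compact_between hK hO hKO
  obtain ⟨φ, hφ, -, hs, h1⟩ := exists_contMDiff_support_eq_eq_one_iff (n := 1)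
    (modelWithCornersSelf ℝ F) (isOpen_interior (s := K')) hK.isClosed hKK'
  have hts : tsupport φ ⊆ K' := by
    rw [tsupport, hs]
    exact closure_minimal interior_subset hK'.isClosed
  exact ⟨φ, contMDiff_iff_contDiff.1 hφ, hK'.of_isClosed_subset (isClosed_tsupport φ) hts,
    hts.trans hK'O, fun x hx => (h1 x).1 hx⟩

theorem integrable_sq_mul_sub {φ : E → ℝ} (hφ : Continuous φ) (hφs : HasCompactSupport φ)
    {A : ℝ} {v w : E → ℝ} (hv : Measurable v) (hw : Measurable w) (hvA : ∀ x, |v x| ≤ A)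
    (hwA : ∀ x, |w x| ≤ A) : Integrable (fun x => (φ x * (v x - w x)) ^ 2) := by
  have hφ2 : Integrable (fun x => φ x ^ 2) :=
    (hφ.pow 2).integrable_of_hasCompactSupport
      (hφs.mono fun x hx h0 => hx (by simp [h0]))
  have hm : AEStronglyMeasurable (fun x => (v x - w x) ^ 2) (volume : Measure E) :=
    ((hv.sub hw).pow_const 2).aestronglyMeasurable
  refine (hφ2.bdd_mul (c := (2 * A) ^ 2) hm (Eventually.of_forall fun x => ?_)).congr
    (Eventually.of_forall fun x => ?_)
  · rw [Real.norm_eq_abs, abs_of_nonneg (sq_nonneg _)]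
    refine sq_le_sq' ?_ ?_ <;> linarith [abs_le.1 (hvA x), abs_le.1 (hwA x)]
  · simp only
    ring

theorem exists_strictMono_integral_abs_sub_le_of_isViscousSolution
    {b : OrthonormalBasis ι ℝ E} {S : Finset ι} {O : Set E} (hO : IsOpen O)
    (hOv : volume O ≠ ⊤) {a : ℝ → E} (ha : ContDiff ℝ 1 a)
    {A Ca Cβ : ℝ} (hA : 0 < A) (hCa : ∀ c, ‖a c‖ ≤ Ca)
    (hnd : ∀ v : E, ‖v‖ = 1 → volume {c ∈ Icc (-A) A | ⟪v, a c⟫ = 0} = 0)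
    {ε : ℕ → ℝ} (hε : ∀ n, 0 ≤ ε n) (hε1 : ∀ n, ε n ≤ 1) (hε0 : Tendsto ε atTop (nhds 0))
    {β : ℕ → ℝ → ℝ} (hβ : ∀ n, ContDiff ℝ 1 (β n)) (hβ0 : ∀ n y, 0 ≤ β n y)
    (hCβ : ∀ n y, β n y ≤ Cβ) {w : ℕ → E → ℝ} {D H : ℕ → ι → E → ℝ}
    (h : ∀ n, IsViscousSolution b S O a (ε n) (β n) (w n) (D n) (H n))
    (hw : ∀ n, Measurable (w n)) (hwA : ∀ n x, |w n x| ≤ A)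
    (hwO : ∀ n x, x ∉ O → w n x = 0) :
    ∃ σ : ℕ → ℕ, StrictMono σ ∧ ∀ η > 0, ∃ N, ∀ n ≥ N, ∀ m ≥ N,
      ∫ x, |w (σ n) x - w (σ m) x| ≤ η := by
  obtain ⟨σ, hσ, hσc⟩ := exists_strictMono_cauchySeq_fourier hO.measurableSet hOv hw hwA hwO
  refine ⟨σ, hσ, fun η hη => ?_⟩
  obtain ⟨K, hKO, hK, hKv⟩ := hO.measurableSet.exists_isCompact_sdiff_lt hOv
    (ENNReal.ofReal_pos.2 (show 0 < η / (6 * A) by positivity)).ne'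
  obtain ⟨φ, hφ, hφs, hφO, hφK⟩ := exists_contDiff_eq_one_of_isCompact_subset hK hO hKO
  obtain ⟨θ, hθ, hθs, hθO, hθφ⟩ := exists_contDiff_eq_one_of_isCompact_subset hφs hO hφO
  set M := volume.real O with hM
  have hM0 : 0 ≤ M := measureReal_nonneg
  set ρ := η / (3 * (M + 1)) with hρ
  have hρ0 : 0 < ρ := by positivity
  obtain ⟨N, hN⟩ := exists_integral_sq_mul_sub_le_of_isViscousSolution hO ha hA hCa hnd
    (fun n => hε (σ n)) (fun n => hε1 (σ n)) (hε0.comp hσ.tendsto_atTop) (fun n => hβ (σ n))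
    (fun n => hβ0 (σ n)) (fun n => hCβ (σ n)) (fun n => h (σ n)) (fun n => hw (σ n))
    (fun n => hwA (σ n)) hφ hφs hφO hθ hθs hθO hθφ (hσc φ hφ.continuous hφs)
    (show 0 < 4 * ρ * η / 3 by positivity)
  refine ⟨N, fun n hn m hm => ?_⟩
  have hOK : MeasurableSet (O \ K) := hO.measurableSet.diff hK.measurableSet
  have hOKv : volume (O \ K) ≠ ⊤ := measure_ne_top_of_subset sdiff_subset hOv
  have hi1 : Integrable (O.indicator fun _ => ρ) (volume : Measure E) :=
    (integrable_indicator_iff hO.measurableSet).2 (integrableOn_const hOv)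
  have hi3 : Integrable ((O \ K).indicator fun _ => 2 * A) (volume : Measure E) :=
    (integrable_indicator_iff hOK).2 (integrableOn_const hOKv)
  have hi2 : Integrable (fun x => (φ x * (w (σ n) x - w (σ m) x)) ^ 2 / (4 * ρ))
      (volume : Measure E) :=
    (integrable_sq_mul_sub hφ.continuous hφs (hw _) (hw _) (hwA _) (hwA _)).div_const _
  have hle : ∀ x, |w (σ n) x - w (σ m) x| ≤ O.indicator (fun _ => ρ) x +
      (φ x * (w (σ n) x - w (σ m) x)) ^ 2 / (4 * ρ) + (O \ K).indicator (fun _ => 2 * A) x := by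
    intro x
    have hsq : 0 ≤ (φ x * (w (σ n) x - w (σ m) x)) ^ 2 / (4 * ρ) := by positivity
    by_cases hx : x ∈ O
    · by_cases hxK : x ∈ K
      · simp only [hx, hxK, indicator_of_mem, Set.mem_sdiff, not_true, and_false, not_false_eq_true,
          indicator_of_notMem, hφK x hxK, one_mul, add_zero]
        rw [← sub_nonneg, ← sq_abs]
        generalize |w (σ n) x - w (σ m) x| = y
        have : ρ + y ^ 2 / (4 * ρ) - y = (2 * ρ - y) ^ 2 / (4 * ρ) := by
          field_simp
          ring
        rw [this]
        positivity
      · rw [indicator_of_mem hx, indicator_of_mem (show x ∈ O \ K from ⟨hx, hxK⟩)]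
        have : |w (σ n) x - w (σ m) x| ≤ 2 * A := by
          rw [abs_le]
          constructor <;> linarith [abs_le.1 (hwA (σ n) x), abs_le.1 (hwA (σ m) x)]
        linarith
    · rw [indicator_of_notMem hx, indicator_of_notMem (fun h => hx h.1), hwO _ x hx, hwO _ x hx]
      simp
  calc ∫ x, |w (σ n) x - w (σ m) x|
      ≤ ∫ x, (O.indicator (fun _ => ρ) x +
        (φ x * (w (σ n) x - w (σ m) x)) ^ 2 / (4 * ρ) + (O \ K).indicator (fun _ => 2 * A) x) :=
        integral_mono_of_nonneg (Eventually.of_forall fun x => abs_nonneg _)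
          ((hi1.fun_add hi2).fun_add hi3) (Eventually.of_forall hle)
    _ = M * ρ + (∫ x, (φ x * (w (σ n) x - w (σ m) x)) ^ 2) / (4 * ρ) +
        volume.real (O \ K) * (2 * A) := by
        rw [integral_add (hi1.fun_add hi2) hi3, integral_add hi1 hi2,
          integral_indicator_const _ hO.measurableSet, integral_indicator_const _ hOK,
          integral_div, smul_eq_mul, smul_eq_mul]
    _ ≤ η / 3 + η / 3 + η / 3 := by
        have h1 : η / 3 = M * ρ + ρ := by
          rw [hρ]
          field_simp
        have h2 : (∫ x, (φ x * (w (σ n) x - w (σ m) x)) ^ 2) / (4 * ρ) ≤ η / 3 := by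
          rw [div_le_iff₀ (by positivity)]
          linarith [hN n hn m hm]
        have h3 : volume.real (O \ K) * (2 * A) ≤ η / 3 := by
          have : volume.real (O \ K) ≤ η / (6 * A) := by
            rw [measureReal_def]
            exact ENNReal.toReal_le_of_le_ofReal (by positivity) hKv.le
          calc volume.real (O \ K) * (2 * A) ≤ η / (6 * A) * (2 * A) := by gcongr
            _ = η / 3 := by field_simp; norm_num
        linarith
    _ = η := by ring

end GlobalCompactness

section SpaceTime

open Filter
open scoped RealInnerProductSpace

/-- Euclidean space-time, with time as coordinate zero, as the product of space and time. -/
def spaceTimeEquiv (d : ℕ) : EuclideanSpace ℝ (Fin (d + 1)) ≃ᵐ (Fin d → ℝ) × ℝ :=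
  (MeasurableEquiv.toLp 2 (Fin (d + 1) → ℝ)).symm.trans
    ((MeasurableEquiv.piFinSuccAbove (fun _ => ℝ) 0).trans MeasurableEquiv.prodComm)

variable {d : ℕ}

theorem spaceTimeEquiv_apply (y : EuclideanSpace ℝ (Fin (d + 1))) :
    spaceTimeEquiv d y = (fun j => y j.succ, y 0) := rfl

theorem measurePreserving_spaceTimeEquiv : MeasurePreserving (spaceTimeEquiv d) :=
  (EuclideanSpace.volume_preserving_symm_measurableEquiv_toLp (Fin (d + 1))).trans
    ((volume_preserving_piFinSuccAbove (fun _ : Fin (d + 1) => ℝ) 0).trans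
      Measure.measurePreserving_swap)

theorem continuous_spaceTimeEquiv : Continuous (spaceTimeEquiv d) := by
  have : ⇑(spaceTimeEquiv d) = fun y => (fun j => y j.succ, y 0) := funext spaceTimeEquiv_apply
  rw [this]
  fun_prop

theorem spaceTimeEquiv_add_smul_single_zero (y : EuclideanSpace ℝ (Fin (d + 1))) (s : ℝ) :
    spaceTimeEquiv d (y + s • EuclideanSpace.single 0 1) =
      ((spaceTimeEquiv d y).1, (spaceTimeEquiv d y).2 + s) := by
  simp [spaceTimeEquiv_apply]

theorem spaceTimeEquiv_add_smul_single_succ (y : EuclideanSpace ℝ (Fin (d + 1))) (j : Fin d)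
    (s : ℝ) : spaceTimeEquiv d (y + s • EuclideanSpace.single j.succ 1) =
      ((spaceTimeEquiv d y).1 + s • Pi.single j 1, (spaceTimeEquiv d y).2) := by
  simp [spaceTimeEquiv_apply, Prod.ext_iff, funext_iff, Pi.single_apply, eq_comm]

/-- The space-time velocity, with time component one and spatial components `deriv (f j)`. -/
def spaceTimeVelocity (f : Fin d → ℝ → ℝ) (c : ℝ) : EuclideanSpace ℝ (Fin (d + 1)) :=
  WithLp.toLp 2 (Fin.cons 1 fun j => deriv (f j) c)

theorem contDiff_spaceTimeVelocity {f : Fin d → ℝ → ℝ} (hf : ∀ j, ContDiff ℝ 2 (f j)) :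
    ContDiff ℝ 1 (spaceTimeVelocity f) := by
  refine contDiff_euclidean.2 (Fin.cases ?_ fun j => ?_)
  · simpa [spaceTimeVelocity] using contDiff_const
  · simpa [spaceTimeVelocity] using ((contDiff_succ_iff_deriv (n := 1)).1 (hf j)).2.2

theorem exists_norm_spaceTimeVelocity_le {f : Fin d → ℝ → ℝ}
    (hf : ∀ j, ∃ C, ∀ y : ℝ, |deriv (f j) y| ≤ C) : ∃ C, ∀ c, ‖spaceTimeVelocity f c‖ ≤ C := by
  choose C hC using hf
  refine ⟨√(1 + ∑ j, C j ^ 2), fun c => ?_⟩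
  rw [EuclideanSpace.norm_eq, Fin.sum_univ_succ]
  refine Real.sqrt_le_sqrt ?_
  simp only [spaceTimeVelocity, Fin.cons_zero, Fin.cons_succ, norm_one, one_pow, Real.norm_eq_abs]
  gcongr with j
  exact hC j c

theorem inner_spaceTimeVelocity (f : Fin d → ℝ → ℝ) (v : EuclideanSpace ℝ (Fin (d + 1))) (c : ℝ) :
    ⟪v, spaceTimeVelocity f c⟫ = v 0 + ∑ j : Fin d, deriv (f j) c * v j.succ := by
  simp [PiLp.inner_apply, Fin.sum_univ_succ, spaceTimeVelocity]

theorem volume_inner_spaceTimeVelocity_eq_zero {f : Fin d → ℝ → ℝ} {A : ℝ}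
    (h : ∀ τ : ℝ, ∀ ξ : Fin d → ℝ, τ ^ 2 + ∑ i, (ξ i) ^ 2 = 1 →
      volume {c ∈ Icc (-A) A | τ + ∑ j, deriv (f j) c * ξ j = 0} = 0)
    (v : EuclideanSpace ℝ (Fin (d + 1))) (hv : ‖v‖ = 1) :
    volume {c ∈ Icc (-A) A | ⟪v, spaceTimeVelocity f c⟫ = 0} = 0 := by
  simp only [inner_spaceTimeVelocity]
  refine h (v 0) (fun j => v j.succ) ?_
  have := EuclideanSpace.norm_sq_eq v
  rw [hv, Fin.sum_univ_succ] at this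
  simpa using this.symm

variable {Ω : Set (Fin d → ℝ)} {T ε δ : ℝ} {f : Fin d → ℝ → ℝ} {B : ℝ → ℝ}
  {u₀ : (Fin d → ℝ) → ℝ} {u : (Fin d → ℝ) → ℝ → ℝ}

theorem IsClassicalSolution.isViscousSolution (hu : IsClassicalSolution Ω T ε δ f B u₀ u)
    (hf : ∀ j, Differentiable ℝ (f j)) (hB : Differentiable ℝ B) :
    IsViscousSolution (EuclideanSpace.basisFun (Fin (d + 1)) ℝ) (Finset.univ.image Fin.succ)
      (spaceTimeEquiv d ⁻¹' (Ω ×ˢ Ioo 0 T)) (spaceTimeVelocity f) ε (fun y => B y + δ)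
      (fun y => u (spaceTimeEquiv d y).1 (spaceTimeEquiv d y).2)
      (Fin.cons (fun y => deriv (u (spaceTimeEquiv d y).1) (spaceTimeEquiv d y).2)
        fun j y => pderiv' (fun z => u z (spaceTimeEquiv d y).2) j (spaceTimeEquiv d y).1)
      (Fin.cons 0 fun j y => pderiv' (pderiv' (fun z => u z (spaceTimeEquiv d y).2) j) j
        (spaceTimeEquiv d y).1) where
  cont := (hu.cont.mono (prod_mono subset_closure Ioo_subset_Icc_self)).comp
    continuous_spaceTimeEquiv.continuousOn fun _ hy => hy
  cont_fst := Fin.cases (hu.cont_dt.comp continuous_spaceTimeEquiv.continuousOn fun _ hy => hy)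
    fun j => (hu.cont_dx j).comp continuous_spaceTimeEquiv.continuousOn fun _ hy => hy
  cont_snd i hi := by
    obtain ⟨j, -, rfl⟩ := Finset.mem_image.1 hi
    exact (hu.cont_dxx j j).comp continuous_spaceTimeEquiv.continuousOn fun _ hy => hy
  hasLineDerivAt_fst := by
    refine Fin.cases (fun y hy => ?_) fun j y hy => ?_
    · have := (hu.diff_t _ hy.1 _ hy.2).hasDerivAt
      rw [← add_zero (spaceTimeEquiv d y).2] at this
      have := HasDerivAt.comp_const_add _ _ this
      simpa [HasLineDerivAt, spaceTimeEquiv_add_smul_single_zero] using this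
    · have := hasDerivAt_comp_add_smul_single (v := fun z => u z (spaceTimeEquiv d y).2)
        (x := (spaceTimeEquiv d y).1) (s := 0) j (by simpa using hu.diff_x _ hy.1 _ hy.2)
      simpa [HasLineDerivAt, spaceTimeEquiv_add_smul_single_succ] using this
  hasLineDerivAt_snd i hi y hy := by
    obtain ⟨j, -, rfl⟩ := Finset.mem_image.1 hi
    have := hasDerivAt_comp_add_smul_single
      (v := pderiv' (fun z => u z (spaceTimeEquiv d y).2) j)
      (x := (spaceTimeEquiv d y).1) (s := 0) j (by simpa using hu.diff_xx j _ hy.1 _ hy.2)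
    simpa [HasLineDerivAt, spaceTimeEquiv_add_smul_single_succ] using this
  eqn y hy := by
    have := hu.deriv_eq hf hB hy.1 hy.2
    rw [Finset.sum_image (Fin.succ_injective d).injOn, Fin.sum_univ_succ]
    simpa [spaceTimeVelocity, PiLp.inner_apply] using this

theorem IsClassicalSolution.measurable_indicator (hu : IsClassicalSolution Ω T ε δ f B u₀ u)
    (hΩ : IsOpen Ω) :
    Measurable ((Ω ×ˢ Ioo 0 T).indicator fun p : (Fin d → ℝ) × ℝ => u p.1 p.2) := by
  have hm : MeasurableSet (Ω ×ˢ Ioo 0 T) := hΩ.measurableSet.prod measurableSet_Ioo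
  classical
  rw [← piecewise_eq_indicator]
  exact (hu.cont.mono (prod_mono subset_closure Ioo_subset_Icc_self)).measurable_piecewise
    continuousOn_const hm

theorem exists_strictMono_setIntegral_abs_sub_le_of_isClassicalSolution
    (hΩ : IsOpen Ω) (hbd : Bornology.IsBounded Ω) {A : ℝ} (hA : 0 < A)
    (hf : ∀ j, ContDiff ℝ 2 (f j)) (hf' : ∀ j, ∃ C, ∀ y : ℝ, |deriv (f j) y| ≤ C)
    (hnd : ∀ τ : ℝ, ∀ ξ : Fin d → ℝ, τ ^ 2 + ∑ i, (ξ i) ^ 2 = 1 →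
      volume {c ∈ Icc (-A) A | τ + ∑ j, deriv (f j) c * ξ j = 0} = 0)
    (hB : ContDiff ℝ 1 B) (hBbd : ∃ C, ∀ y : ℝ, |B y| ≤ C) (hB0 : ∀ y : ℝ, 0 ≤ B y)
    {ε δ : ℕ → ℝ} (hε : ∀ n, 0 < ε n) (hε1 : ∀ n, ε n ≤ 1) (hε0 : Tendsto ε atTop (nhds 0))
    (hδ : ∀ n, 0 < δ n) (hδ1 : ∀ n, δ n ≤ 1) {u₀ : ℕ → (Fin d → ℝ) → ℝ}
    (hu₀ : ∀ n x, |u₀ n x| ≤ A) {u : ℕ → (Fin d → ℝ) → ℝ → ℝ}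
    (hu : ∀ n, IsClassicalSolution Ω T (ε n) (δ n) f B (u₀ n) (u n)) :
    ∃ σ : ℕ → ℕ, StrictMono σ ∧ ∀ η > 0, ∃ N, ∀ n ≥ N, ∀ m ≥ N,
      ∫ q in Ω ×ˢ Ioo 0 T, |u (σ n) q.1 q.2 - u (σ m) q.1 q.2| ≤ η := by
  obtain ⟨Ca, hCa⟩ := exists_norm_spaceTimeVelocity_le hf'
  obtain ⟨CB, hCB⟩ := hBbd
  have hfd : ∀ j, Differentiable ℝ (f j) := fun j => (hf j).differentiable two_ne_zero
  have hBd : Differentiable ℝ B := hB.differentiable one_ne_zero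
  have hQ : IsOpen (Ω ×ˢ Ioo 0 T) := hΩ.prod isOpen_Ioo
  have hO : IsOpen (spaceTimeEquiv d ⁻¹' (Ω ×ˢ Ioo 0 T)) := hQ.preimage continuous_spaceTimeEquiv
  have hOv : volume (spaceTimeEquiv d ⁻¹' (Ω ×ˢ Ioo 0 T)) ≠ ⊤ := by
    rw [measurePreserving_spaceTimeEquiv.measure_preimage hQ.measurableSet.nullMeasurableSet]
    exact (hbd.prod (Metric.isBounded_Ioo 0 T)).measure_lt_top.ne
  set w : ℕ → (Fin d → ℝ) × ℝ → ℝ := fun n =>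
    (Ω ×ˢ Ioo 0 T).indicator fun p => u n p.1 p.2 with hw
  have hwm : ∀ n, Measurable (w n) := fun n => (hu n).measurable_indicator hΩ
  have hwA : ∀ n q, |w n q| ≤ A := fun n q => by
    by_cases hq : q ∈ Ω ×ˢ Ioo 0 T
    · simpa only [hw, indicator_of_mem hq] using
        (hu n).abs_le hΩ hbd hfd hBd hB0 (hε n) (hδ n) hA.le (hu₀ n) hq.1 hq.2
    · simpa only [hw, indicator_of_notMem hq, abs_zero] using hA.le
  obtain ⟨σ, hσ, h⟩ := exists_strictMono_integral_abs_sub_le_of_isViscousSolution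
    (w := fun n y => w n (spaceTimeEquiv d y)) (β := fun n y => B y + δ n) (Cβ := CB + 1)
    hO hOv (contDiff_spaceTimeVelocity hf) hA hCa
    (volume_inner_spaceTimeVelocity_eq_zero hnd) (fun n => (hε n).le) hε1 hε0
    (fun n => hB.add contDiff_const) (fun n y => add_nonneg (hB0 y) (hδ n).le)
    (fun n y => add_le_add ((le_abs_self _).trans (hCB y)) (hδ1 n))
    (fun n => ((hu n).isViscousSolution hfd hBd).congr hO fun y hy =>
      indicator_of_mem (show spaceTimeEquiv d y ∈ Ω ×ˢ Ioo 0 T from hy) _)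
    (fun n => (hwm n).comp (spaceTimeEquiv d).measurable) (fun n y => hwA n _)
    (fun n y hy => indicator_of_notMem (show spaceTimeEquiv d y ∉ Ω ×ˢ Ioo 0 T from hy) _)
  refine ⟨σ, hσ, fun η hη => (h η hη).imp fun N hN n hn m hm => (le_of_eq ?_).trans
    (hN n hn m hm)⟩
  rw [measurePreserving_spaceTimeEquiv.integral_comp (spaceTimeEquiv d).measurableEmbedding
    (fun q => |w (σ n) q - w (σ m) q|), ← integral_indicator hQ.measurableSet]
  congr 1 with q
  by_cases hq : q ∈ Ω ×ˢ Ioo 0 T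
  · simp only [hw, indicator_of_mem hq]
  · simp only [hw, indicator_of_notMem hq, sub_zero, abs_zero]

end SpaceTime

section Assembly

open Filter

theorem exists_strictMono_tendsto_of_integral_abs_sub_le {X : Type*} [MeasurableSpace X]
    {μ : Measure X} {g : ℕ → X → ℝ} (hg : ∀ n, Integrable (g n) μ)
    (hc : ∀ η > 0, ∃ N, ∀ n ≥ N, ∀ m ≥ N, ∫ x, |g n x - g m x| ∂μ ≤ η) :
    ∃ ψ : ℕ → ℕ, StrictMono ψ ∧ ∃ v : X → ℝ,
      Tendsto (fun k => eLpNorm (g (ψ k) - v) 1 μ) atTop (nhds 0) ∧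
      ∀ᵐ x ∂μ, Tendsto (fun k => g (ψ k) x) atTop (nhds (v x)) := by
  have hC : CauchySeq fun n => (hg n).toL1 (g n) := by
    refine Metric.cauchySeq_iff.2 fun η hη => ?_
    obtain ⟨N, hN⟩ := hc (η / 2) (by positivity)
    refine ⟨N, fun m hm n hn => ?_⟩
    rw [dist_eq_norm, ← Integrable.toL1_sub _ _ (hg m) (hg n), L1.norm_of_fun_eq_integral_norm]
    exact (hN m hm n hn).trans_lt (by linarith)
  obtain ⟨v, hv⟩ := cauchySeq_tendsto_of_complete hC
  have hv' : Tendsto (fun n => eLpNorm (g n - ⇑v) 1 μ) atTop (nhds 0) := by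
    refine ((Lp.tendsto_Lp_iff_tendsto_eLpNorm' _ _).1 hv).congr fun n => eLpNorm_congr_ae ?_
    exact (hg n).coeFn_toL1.sub (ae_eq_refl _)
  obtain ⟨ψ, hψ, hae⟩ := (tendstoInMeasure_of_tendsto_eLpNorm one_ne_zero
    (fun n => (hg n).aestronglyMeasurable) (Lp.aestronglyMeasurable v) hv').exists_seq_tendsto_ae
  exact ⟨ψ, hψ, v, hv'.comp hψ.tendsto_atTop, hae⟩

theorem tendsto_integral_abs_sub_of_tendsto_ae {X : Type*} [MeasurableSpace X] {μ : Measure X}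
    [IsFiniteMeasure μ] {A : ℝ} {F : ℝ → X → ℝ} {g : X → ℝ}
    (hF : ∀ δ > 0, AEStronglyMeasurable (F δ) μ) (hFA : ∀ δ > 0, ∀ᵐ x ∂μ, |F δ x| ≤ A)
    (h : ∀ᵐ x ∂μ, Tendsto (fun δ => F δ x) (nhdsWithin 0 (Ioi 0)) (nhds (g x))) :
    Integrable g μ ∧
      Tendsto (fun δ => ∫ x, |F δ x - g x| ∂μ) (nhdsWithin 0 (Ioi 0)) (nhds 0) := by
  have hs : Tendsto (fun n : ℕ => 1 / ((n : ℝ) + 1)) atTop (nhdsWithin 0 (Ioi 0)) :=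
    tendsto_nhdsWithin_iff.2 ⟨tendsto_one_div_add_atTop_nhds_zero_nat,
      Eventually.of_forall fun n => show (0 : ℝ) < 1 / ((n : ℝ) + 1) by positivity⟩
  have hgm : AEStronglyMeasurable g μ :=
    aestronglyMeasurable_of_tendsto_ae atTop (f := fun n : ℕ => F (1 / ((n : ℝ) + 1)))
      (fun n => hF _ (by positivity)) (h.mono fun x hx => hx.comp hs)
  have hgA : ∀ᵐ x ∂μ, |g x| ≤ A := by
    have := ae_all_iff.2 fun n : ℕ => hFA (1 / ((n : ℝ) + 1)) (by positivity)
    filter_upwards [h, this] with x hx hx'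
    exact le_of_tendsto (hx.comp hs).abs (Eventually.of_forall hx')
  refine ⟨Integrable.of_bound hgm A hgA, ?_⟩
  have := tendsto_integral_filter_of_dominated_convergence (μ := μ)
    (l := nhdsWithin (0 : ℝ) (Ioi 0)) (F := fun δ x => |F δ x - g x|) (f := fun _ => 0)
    (fun _ => 2 * A) ?_ ?_ (integrable_const _) ?_
  · simpa using this
  · filter_upwards [self_mem_nhdsWithin] with δ hδ
    exact ((hF δ hδ).sub hgm).norm
  · filter_upwards [self_mem_nhdsWithin] with δ hδ
    filter_upwards [hFA δ hδ, hgA] with x h1 h2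
    rw [Real.norm_eq_abs, abs_abs, abs_le]
    constructor <;> linarith [abs_le.1 h1, abs_le.1 h2]
  · filter_upwards [h] with x hx
    simpa using (hx.sub_const (g x)).abs

end Assembly

/-- **Compactness of the quasilinear viscous approximations in `ε`**: under the
nondegeneracy condition on the flux, the sequence `uⁿ` obtained as `δ → 0` limits of
classical solutions of the regularized problems with parameters `εₙ → 0` has a subsequence
converging in `L¹(Ω_T)` and almost everywhere in `Ω_T`. -/
theorem compactness_quasilinear_viscous_approximations
    (d : ℕ) (Ω : Set (Fin d → ℝ)) (hΩopen : IsOpen Ω) (hΩbd : Bornology.IsBounded Ω)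
    (T A : ℝ) (hT : 0 < T) (hA : 0 < A)
    (f : Fin d → ℝ → ℝ) (hf : ∀ j, ContDiff ℝ 2 (f j))
    (hf' : ∀ j, ∃ C, ∀ y : ℝ, |deriv (f j) y| ≤ C)
    (hnondeg : ∀ τ : ℝ, ∀ ξ : Fin d → ℝ, τ ^ 2 + ∑ i, (ξ i) ^ 2 = 1 →
      volume {c ∈ Set.Icc (-A) A | τ + ∑ j, deriv (f j) c * ξ j = 0} = 0)
    (B : ℝ → ℝ) (hB : ContDiff ℝ 1 B) (hBbd : ∃ C, ∀ y : ℝ, |B y| ≤ C)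
    (hBnonneg : ∀ y : ℝ, 0 ≤ B y)
    (ε : ℕ → ℝ) (hεpos : ∀ n, 0 < ε n) (hε0 : Filter.Tendsto ε Filter.atTop (nhds 0))
    (u₀nd : ℕ → ℝ → (Fin d → ℝ) → ℝ)
    (hu₀smooth : ∀ n, ∀ δ > (0:ℝ), ContDiff ℝ (⊤ : ℕ∞) (u₀nd n δ))
    (hu₀supp : ∀ n, ∀ δ > (0:ℝ), HasCompactSupport (u₀nd n δ))
    (hu₀Ω : ∀ n, ∀ δ > (0:ℝ), tsupport (u₀nd n δ) ⊆ Ω)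
    (hu₀A : ∀ n, ∀ δ > (0:ℝ), ∀ x, |u₀nd n δ x| ≤ A)
    (U : ℕ → ℝ → (Fin d → ℝ) → ℝ → ℝ)
    (hU : ∀ n, ∀ δ > (0:ℝ), IsClassicalSolution Ω T (ε n) δ f B (u₀nd n δ) (U n δ))
    (un : ℕ → (Fin d → ℝ) → ℝ → ℝ)
    (haeδ : ∀ n, ∀ᵐ q ∂(volume.restrict (Ω ×ˢ Set.Ioo 0 T)),
      Filter.Tendsto (fun δ => U n δ q.1 q.2) (nhdsWithin 0 (Set.Ioi 0))
        (nhds (un n q.1 q.2))) :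
    ∃ φ : ℕ → ℕ, StrictMono φ ∧ ∃ v : (Fin d → ℝ) × ℝ → ℝ,
      Filter.Tendsto
        (fun k => eLpNorm ((fun q : (Fin d → ℝ) × ℝ => un (φ k) q.1 q.2) - v) 1
          (volume.restrict (Ω ×ˢ Set.Ioo 0 T)))
        Filter.atTop (nhds 0) ∧
      ∀ᵐ q ∂(volume.restrict (Ω ×ˢ Set.Ioo 0 T)),
        Filter.Tendsto (fun k => un (φ k) q.1 q.2) Filter.atTop (nhds (v q)) := by
  have hQ : IsOpen (Ω ×ˢ Ioo 0 T) := hΩopen.prod isOpen_Ioo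
  have : IsFiniteMeasure ((volume : Measure ((Fin d → ℝ) × ℝ)).restrict (Ω ×ˢ Ioo 0 T)) :=
    isFiniteMeasure_restrict.2 (hΩbd.prod (Metric.isBounded_Ioo 0 T)).measure_lt_top.ne
  have hfd : ∀ j, Differentiable ℝ (f j) := fun j => (hf j).differentiable two_ne_zero
  have hBd : Differentiable ℝ B := hB.differentiable one_ne_zero
  have hUm : ∀ n, ∀ δ > (0 : ℝ), AEStronglyMeasurable (fun q : (Fin d → ℝ) × ℝ => U n δ q.1 q.2)
      (volume.restrict (Ω ×ˢ Ioo 0 T)) := fun n δ hδ =>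
    ((hU n δ hδ).cont.mono (prod_mono subset_closure Ioo_subset_Icc_self)).aestronglyMeasurable
      hQ.measurableSet
  have hUA : ∀ n, ∀ δ > (0 : ℝ), ∀ᵐ q ∂(volume.restrict (Ω ×ˢ Ioo 0 T)), |U n δ q.1 q.2| ≤ A :=
    fun n δ hδ => (ae_restrict_mem hQ.measurableSet).mono fun q hq =>
      (hU n δ hδ).abs_le hΩopen hΩbd hfd hBd hBnonneg (hεpos n) hδ hA.le (hu₀A n δ hδ) hq.1 hq.2
  have hlim := fun n => tendsto_integral_abs_sub_of_tendsto_ae (hUm n) (hUA n) (haeδ n)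
  have hδ : ∀ n : ℕ, ∃ δ ∈ Ioc (0 : ℝ) 1,
      ∫ q in Ω ×ˢ Ioo 0 T, |U n δ q.1 q.2 - un n q.1 q.2| < 1 / ((n : ℝ) + 1) := fun n =>
    (((hlim n).2.eventually_lt_const (by positivity)).and
      (Ioc_mem_nhdsGT zero_lt_one)).exists.imp fun δ h => ⟨h.2, h.1⟩
  choose δ hδ01 hδ using hδ
  obtain ⟨N₀, hN₀⟩ := Filter.eventually_atTop.1 (hε0.eventually_le_const zero_lt_one)
  obtain ⟨σ, hσ, hσc⟩ := exists_strictMono_setIntegral_abs_sub_le_of_isClassicalSolution hΩopen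
    hΩbd hA hf hf' hnondeg hB hBbd hBnonneg (fun n => hεpos (n + N₀))
    (fun n => hN₀ _ (Nat.le_add_left _ _)) (hε0.comp (Filter.tendsto_add_atTop_nat N₀))
    (fun n => (hδ01 (n + N₀)).1) (fun n => (hδ01 (n + N₀)).2)
    (fun n => hu₀A (n + N₀) _ (hδ01 (n + N₀)).1) (fun n => hU (n + N₀) _ (hδ01 (n + N₀)).1)
  have hσN : StrictMono fun k => σ k + N₀ := fun _ _ h => Nat.add_lt_add_right (hσ h) N₀
  have hUi : ∀ n, Integrable (fun q : (Fin d → ℝ) × ℝ => U n (δ n) q.1 q.2)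
      (volume.restrict (Ω ×ˢ Ioo 0 T)) := fun n =>
    Integrable.of_bound (hUm n _ (hδ01 n).1) A (hUA n _ (hδ01 n).1)
  obtain ⟨ψ, hψ, v, hv, hae⟩ := exists_strictMono_tendsto_of_integral_abs_sub_le
    (g := fun k (q : (Fin d → ℝ) × ℝ) => un (σ k + N₀) q.1 q.2) (fun k => (hlim (σ k + N₀)).1)
    fun η hη => by
      obtain ⟨N₁, hN₁⟩ := hσc (η / 3) (by positivity)
      obtain ⟨N₂, hN₂⟩ := Filter.eventually_atTop.1 ((tendsto_one_div_add_atTop_nhds_zero_nat.comp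
        hσN.tendsto_atTop).eventually_le_const (show (0 : ℝ) < η / 3 by positivity))
      have hclose : ∀ n ≥ N₂, ∫ q in Ω ×ˢ Ioo 0 T,
          |U (σ n + N₀) (δ (σ n + N₀)) q.1 q.2 - un (σ n + N₀) q.1 q.2| ≤ η / 3 := fun n hn =>
        (hδ _).le.trans (hN₂ n hn)
      refine ⟨max N₁ N₂, fun n hn m hm => ?_⟩
      have hi := fun k => ((hUi (σ k + N₀)).sub' (hlim (σ k + N₀)).1).abs
      have hii := ((hUi (σ n + N₀)).sub' (hUi (σ m + N₀))).abs
      calc ∫ q in Ω ×ˢ Ioo 0 T, |un (σ n + N₀) q.1 q.2 - un (σ m + N₀) q.1 q.2|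
          ≤ ∫ q in Ω ×ˢ Ioo 0 T,
            (|U (σ n + N₀) (δ (σ n + N₀)) q.1 q.2 - un (σ n + N₀) q.1 q.2| +
              |U (σ n + N₀) (δ (σ n + N₀)) q.1 q.2 - U (σ m + N₀) (δ (σ m + N₀)) q.1 q.2| +
              |U (σ m + N₀) (δ (σ m + N₀)) q.1 q.2 - un (σ m + N₀) q.1 q.2|) := by
            refine integral_mono_of_nonneg (ae_of_all _ fun q => abs_nonneg _)
              (((hi n).fun_add hii).fun_add (hi m)) (ae_of_all _ fun q => ?_)
            simp only
            rw [abs_sub_comm (U (σ n + N₀) (δ (σ n + N₀)) q.1 q.2) (un (σ n + N₀) q.1 q.2)]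
            exact (abs_sub_le _ (U (σ m + N₀) (δ (σ m + N₀)) q.1 q.2) _).trans
              (add_le_add_left (abs_sub_le _ _ _) _)
        _ ≤ η / 3 + η / 3 + η / 3 := by
            rw [integral_add ((hi n).fun_add hii) (hi m), integral_add (hi n) hii]
            exact add_le_add (add_le_add (hclose n (le_of_max_le_right hn))
              (hN₁ n (le_of_max_le_left hn) m (le_of_max_le_left hm)))
              (hclose m (le_of_max_le_right hm))
        _ = η := by ring
  exact ⟨fun k => σ (ψ k) + N₀, hσN.comp hψ, v, hv, hae⟩
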